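/- There exist constants ε₀, ν₀ ∈ (0,1) and C > 0, independent of ν, k, λ and ε, such that for every 0 < ν ≤ ν₀, every 0 < ε ≤ ε₀, every k = (k₁,k₃) ∈ ℤ² with |k₁| ≥ 1, every λ ∈ ℝ, every F ∈ H¹(I) with F(−1) = F(1) = 0, and every solution w ∈ H³(I) of the ε-modified Orr–Sommerfeld problem with Navier-slip boundary conditions and right-hand side F, one has |ν/k₁|^{1/2} ‖w'‖_{L²} + |ν/k₁|^{1/4} ‖w‖_{L²} + |ν/k₁|^{1/8} ‖u‖_{L∞} + ‖u‖_{L²} ≤ C |k₁|^{−1} ‖(∂_y,|k|)F‖_{L²}. -/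

import Mathlib

open Real MeasureTheory

noncomputable section

/-- `|k| = sqrt (k₁² + k₃²)` for `k = (k₁,k₃) ∈ ℤ²`. -/
def kabs (k₁ k₃ : ℤ) : ℝ := Real.sqrt ((k₁ : ℝ) ^ 2 + (k₃ : ℝ) ^ 2)

/-- The `L²` norm on the interval `(-1,1)`. -/
def l2 (f : ℝ → ℂ) : ℝ := Real.sqrt (∫ y in (-1:ℝ)..1, ‖f y‖ ^ 2)

/-- `‖(∂_y,|k|)f‖_{L²} = (‖f'‖² + |k|²‖f‖²)^{1/2}`. -/
def hk (k₁ k₃ : ℤ) (f : ℝ → ℂ) : ℝ :=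
  Real.sqrt ((∫ y in (-1:ℝ)..1, ‖deriv f y‖ ^ 2) +
    (kabs k₁ k₃) ^ 2 * ∫ y in (-1:ℝ)..1, ‖f y‖ ^ 2)

/-- `‖u‖_{L∞} = sup_y (|φ'(y)|² + |k|²|φ(y)|²)^{1/2}` for `u = (∂_yφ, -i|k|φ)`. -/
def uLinf (k₁ k₃ : ℤ) (φ : ℝ → ℂ) : ℝ :=
  ⨆ y ∈ Set.Icc (-1:ℝ) 1,
    Real.sqrt (‖deriv φ y‖ ^ 2 + (kabs k₁ k₃) ^ 2 * ‖φ y‖ ^ 2)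

/-- The `ε`-modified Orr–Sommerfeld problem with Navier-slip boundary
conditions: `-ν(∂_y²-|k|²)w + ik₁[(1-y²-λ)w + 2φ] - ε(ν|k₁|)^{1/2}w = F`
on `[-1,1]`, with `(∂_y²-|k|²)φ = w`, `φ(±1) = φ''(±1) = 0`, `w(±1) = 0`.
Here the solution `w` is taken in `H³`. -/
def OSslipE3 (ν : ℝ) (k₁ k₃ : ℤ) (lam : ℂ) (ε : ℝ) (w φ F : ℝ → ℂ) : Prop :=
  ContDiff ℝ 3 w ∧ ContDiff ℝ 2 φ ∧
  (∀ y ∈ Set.Icc (-1:ℝ) 1,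
    -(ν : ℂ) * (deriv (deriv w) y - ((kabs k₁ k₃ : ℝ) : ℂ) ^ 2 * w y) +
      Complex.I * (k₁ : ℂ) * ((1 - (y : ℂ) ^ 2 - lam) * w y + 2 * φ y) -
      ((ε * Real.sqrt (ν * |(k₁ : ℝ)|) : ℝ) : ℂ) * w y = F y) ∧
  (∀ y ∈ Set.Icc (-1:ℝ) 1,
    deriv (deriv φ) y - ((kabs k₁ k₃ : ℝ) : ℂ) ^ 2 * φ y = w y) ∧
  w (-1) = 0 ∧ w 1 = 0 ∧
  φ (-1) = 0 ∧ φ 1 = 0 ∧ deriv (deriv φ) (-1) = 0 ∧ deriv (deriv φ) 1 = 0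

section
open Set

theorem kadd {f g : ℝ → ℝ} {s : Set ℝ} (h : ContinuousOn f s) (h' : ContinuousOn g s) : ContinuousOn (fun y => f y + g y) s := h.fun_add h'
theorem kmul {f g : ℝ → ℝ} {s : Set ℝ} (h : ContinuousOn f s) (h' : ContinuousOn g s) : ContinuousOn (fun y => f y * g y) s := h.fun_mul h'
theorem ksub {f g : ℝ → ℝ} {s : Set ℝ} (h : ContinuousOn f s) (h' : ContinuousOn g s) : ContinuousOn (fun y => f y - g y) s := h.fun_sub h'
theorem kneg {f : ℝ → ℝ} {s : Set ℝ} (h : ContinuousOn f s) : ContinuousOn (fun y => -f y) s := h.fun_neg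
theorem kpow {f : ℝ → ℝ} {s : Set ℝ} (h : ContinuousOn f s) (n : ℕ) : ContinuousOn (fun y => f y ^ n) s := h.fun_pow n
theorem kdiv {f : ℝ → ℝ} {s : Set ℝ} (h : ContinuousOn f s) (n : ℝ) : ContinuousOn (fun y => f y / n) s := h.div_const n

/-- continuity by automation -/
theorem kont {P : Prop} (h : P := by first | (repeat' (with_reducible first | assumption | exact continuousOn_const | exact continuousOn_id' _ | exact Continuous.continuousOn (by assumption) | refine kadd ?_ ?_ | refine kmul ?_ ?_ | refine ksub ?_ ?_ | refine kpow ?_ _ | refine kneg ?_ | refine kdiv ?_ _ | refine ContinuousOn.norm ?_ | refine ContinuousOn.inner ?_ ?_ | refine ContinuousOn.fun_add ?_ ?_ | refine ContinuousOn.fun_sub ?_ ?_ | refine ContinuousOn.fun_smul ?_ ?_ | (refine Continuous.continuousOn ?_; fun_prop))); done | fun_prop) : P := h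

theorem icm {a b : ℝ} (r : ℝ) (f : ℝ → ℝ) : (∫ x in a..b, r * f x) = r * ∫ x in a..b, f x :=
  intervalIntegral.integral_const_mul r f

theorem ii_of {c d : ℝ} {G : ℝ → ℝ} (hcd : c ≤ d) (h : ContinuousOn G (Icc c d)) :
    IntervalIntegrable G volume c d := h.intervalIntegrable_of_Icc hcd

theorem int_le {c d : ℝ} {F G : ℝ → ℝ} (hcd : c ≤ d) (hF : ContinuousOn F (Icc c d))
    (hG : ContinuousOn G (Icc c d)) (h : ∀ y ∈ Icc c d, F y ≤ G y) :
    (∫ y in c..d, F y) ≤ ∫ y in c..d, G y :=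
  intervalIntegral.integral_mono_on hcd (ii_of hcd hF) (ii_of hcd hG) h

theorem int_nn {c d : ℝ} {F : ℝ → ℝ} (hcd : c ≤ d) (h : ∀ y ∈ Icc c d, 0 ≤ F y) :
    0 ≤ (∫ y in c..d, F y) := intervalIntegral.integral_nonneg hcd h

theorem int_sub {c d c' d' : ℝ} {F : ℝ → ℝ} (h1 : c ≤ c') (h2 : c' ≤ d') (h3 : d' ≤ d)
    (hF : ContinuousOn F (Icc c d)) (h : ∀ y ∈ Icc c d, 0 ≤ F y) :
    (∫ y in c'..d', F y) ≤ ∫ y in c..d, F y := by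
  apply intervalIntegral.integral_mono_interval h1 h2 h3
  · rw [Filter.EventuallyLE, ae_restrict_iff' measurableSet_Ioc]
    exact Filter.Eventually.of_forall fun y hy => h y ⟨hy.1.le, hy.2⟩
  · exact ii_of (by linarith) hF

theorem amgm_opt {Q α β : ℝ} (hα : 0 ≤ α) (hβ : 0 ≤ β)
    (h : ∀ s : ℝ, 0 < s → Q ≤ s / 2 * α ^ 2 + 1 / (2 * s) * β ^ 2) : Q ≤ α * β := by
  by_contra hc
  push Not at hc
  have key : ∀ e : ℝ, 0 < e → Q ≤ (α + e) * (β + e) := by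
    intro e he
    have hs : 0 < (β + e) / (α + e) := by positivity
    have := h _ hs
    have h1 : (β + e) / (α + e) / 2 * α ^ 2 ≤ (α + e) * (β + e) / 2 := by
      rw [div_div, div_mul_eq_mul_div, div_le_div_iff₀ (by positivity) (by norm_num)]
      have : α ^ 2 ≤ (α + e) ^ 2 := by nlinarith
      nlinarith [mul_le_mul_of_nonneg_left this (show 0 ≤ (β + e) by positivity)]
    have h2 : 1 / (2 * ((β + e) / (α + e))) * β ^ 2 ≤ (α + e) * (β + e) / 2 := by
      have : 1 / (2 * ((β + e) / (α + e))) = (α + e) / (2 * (β + e)) := by field_simp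
      rw [this, div_mul_eq_mul_div, div_le_div_iff₀ (by positivity) (by norm_num)]
      have : β ^ 2 ≤ (β + e) ^ 2 := by nlinarith
      nlinarith [mul_le_mul_of_nonneg_left this (show 0 ≤ (α + e) by positivity)]
    linarith
  have hlim : Filter.Tendsto (fun e : ℝ => (α + e) * (β + e)) (nhdsWithin 0 (Set.Ioi 0)) (nhds ((α + 0) * (β + 0))) := by
    apply Filter.Tendsto.mono_left _ nhdsWithin_le_nhds
    apply Continuous.tendsto; fun_prop
  have := ge_of_tendsto hlim (Filter.eventually_of_mem self_mem_nhdsWithin fun e he => key e he)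
  simp at this
  linarith

/-- Cauchy-Schwarz with pointwise domination -/
theorem cs_dom {c d : ℝ} (hcd : c ≤ d) {F A B : ℝ → ℝ} (hF : ContinuousOn F (Icc c d))
    (hA : ContinuousOn A (Icc c d)) (hB : ContinuousOn B (Icc c d)) {α β : ℝ} (hα : 0 ≤ α) (hβ : 0 ≤ β)
    (h : ∀ y ∈ Icc c d, |F y| ≤ A y * B y)
    (h1 : (∫ y in c..d, (A y) ^ 2) ≤ α ^ 2) (h2 : (∫ y in c..d, (B y) ^ 2) ≤ β ^ 2) :
    |∫ y in c..d, F y| ≤ α * β := by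
  apply amgm_opt hα hβ
  intro s hs
  have e1 : |∫ y in c..d, F y| ≤ ∫ y in c..d, |F y| := intervalIntegral.abs_integral_le_integral_abs hcd
  have e2 : (∫ y in c..d, |F y|) ≤ ∫ y in c..d, (s / 2 * (A y) ^ 2 + 1 / (2 * s) * (B y) ^ 2) := by
    apply int_le hcd hF.abs kont
    intro y hy
    refine (h y hy).trans ?_
    have : s / 2 * (A y) ^ 2 + 1 / (2 * s) * (B y) ^ 2 - A y * B y = (s * A y - B y) ^ 2 / (2 * s) := by
      field_simp; ring
    have h0 : 0 ≤ (s * A y - B y) ^ 2 / (2 * s) := by positivity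
    linarith
  rw [intervalIntegral.integral_add (ii_of hcd kont) (ii_of hcd kont),
    icm, icm] at e2
  have : s / 2 * (∫ y in c..d, (A y) ^ 2) ≤ s / 2 * α ^ 2 := by gcongr
  have : 1 / (2 * s) * (∫ y in c..d, (B y) ^ 2) ≤ 1 / (2 * s) * β ^ 2 := by gcongr
  linarith

/-- Cauchy-Schwarz for pairs -/
theorem cs_pair {c d k : ℝ} (hcd : c ≤ d) {A B P Q : ℝ → ℂ} (hA : ContinuousOn A (Icc c d))
    (hB : ContinuousOn B (Icc c d)) (hP : ContinuousOn P (Icc c d)) (hQ : ContinuousOn Q (Icc c d))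
    {α β : ℝ} (hα : 0 ≤ α) (hβ : 0 ≤ β)
    (h1 : (∫ y in c..d, (‖A y‖ ^ 2 + k ^ 2 * ‖B y‖ ^ 2)) ≤ α ^ 2)
    (h2 : (∫ y in c..d, (‖P y‖ ^ 2 + k ^ 2 * ‖Q y‖ ^ 2)) ≤ β ^ 2) :
    |∫ y in c..d, (inner ℝ (A y) (P y) + k ^ 2 * inner ℝ (B y) (Q y))| ≤ α * β := by
  apply amgm_opt hα hβ
  intro s hs
  have e1 := intervalIntegral.abs_integral_le_integral_abs (μ := volume) (f := fun y => inner ℝ (A y) (P y) + k ^ 2 * inner ℝ (B y) (Q y)) hcd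
  have e2 : (∫ y in c..d, |inner ℝ (A y) (P y) + k ^ 2 * inner ℝ (B y) (Q y)|) ≤
      ∫ y in c..d, (s / 2 * (‖A y‖ ^ 2 + k ^ 2 * ‖B y‖ ^ 2) + 1 / (2 * s) * (‖P y‖ ^ 2 + k ^ 2 * ‖Q y‖ ^ 2)) := by
    apply int_le hcd (ContinuousOn.abs kont) kont
    intro y hy
    have i1 := abs_real_inner_le_norm (A y) (P y)
    have i2 := abs_real_inner_le_norm (B y) (Q y)
    have am : ∀ u v : ℝ, u * v ≤ s / 2 * u ^ 2 + 1 / (2 * s) * v ^ 2 := by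
      intro u v
      have : s / 2 * u ^ 2 + 1 / (2 * s) * v ^ 2 - u * v = (s * u - v) ^ 2 / (2 * s) := by
        field_simp; ring
      have h0 : 0 ≤ (s * u - v) ^ 2 / (2 * s) := by positivity
      linarith
    have i3 := am ‖A y‖ ‖P y‖
    have i4 := am ‖B y‖ ‖Q y‖
    have i5 : |k ^ 2 * inner ℝ (B y) (Q y)| ≤ k ^ 2 * (‖B y‖ * ‖Q y‖) := by
      rw [abs_mul, abs_of_nonneg (sq_nonneg k)]; gcongr
    have i6 := mul_le_mul_of_nonneg_left i4 (sq_nonneg k)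
    have := abs_add_le (inner ℝ (A y) (P y)) (k ^ 2 * inner ℝ (B y) (Q y))
    nlinarith
  rw [intervalIntegral.integral_add (ii_of hcd kont) (ii_of hcd kont),
    icm, icm] at e2
  have : s / 2 * (∫ y in c..d, (‖A y‖ ^ 2 + k ^ 2 * ‖B y‖ ^ 2)) ≤ s / 2 * α ^ 2 := by gcongr
  have : 1 / (2 * s) * (∫ y in c..d, (‖P y‖ ^ 2 + k ^ 2 * ‖Q y‖ ^ 2)) ≤ 1 / (2 * s) * β ^ 2 := by gcongr
  linarith

theorem ftc {c d : ℝ} (hcd : c ≤ d) {G G' : ℝ → ℝ} (h : ∀ y ∈ Icc c d, HasDerivAt G (G' y) y)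
    (hc : ContinuousOn G' (Icc c d)) : (∫ y in c..d, G' y) = G d - G c := by
  apply intervalIntegral.integral_eq_sub_of_hasDerivAt
  · intro y hy; rw [uIcc_of_le hcd] at hy; exact h y hy
  · exact ii_of hcd hc

theorem cont_of {c d : ℝ} {g g' : ℝ → ℂ} (h : ∀ y ∈ Icc c d, HasDerivAt g (g' y) y) :
    ContinuousOn g (Icc c d) := fun y hy => (h y hy).continuousAt.continuousWithinAt

theorem cont_ofR {c d : ℝ} {g g' : ℝ → ℝ} (h : ∀ y ∈ Icc c d, HasDerivAt g (g' y) y) :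
    ContinuousOn g (Icc c d) := fun y hy => (h y hy).continuousAt.continuousWithinAt

theorem hd_normsq {g : ℝ → ℂ} {g' : ℂ} {y : ℝ} (h : HasDerivAt g g' y) :
    HasDerivAt (fun y => ‖g y‖ ^ 2) (2 * inner ℝ (g y) g') y := h.norm_sq

theorem qid {c d : ℝ} (hcd : c ≤ d) {g g' : ℝ → ℂ} {q q' : ℝ → ℝ}
    (hg : ∀ y ∈ Icc c d, HasDerivAt g (g' y) y) (hq : ∀ y ∈ Icc c d, HasDerivAt q (q' y) y)
    (cg : ContinuousOn g' (Icc c d)) (cq : ContinuousOn q' (Icc c d)) :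
    (∫ y in c..d, ‖g' y - q y • g y‖ ^ 2) =
      (∫ y in c..d, (‖g' y‖ ^ 2 + (q' y + q y ^ 2) * ‖g y‖ ^ 2)) - (q d * ‖g d‖ ^ 2 - q c * ‖g c‖ ^ 2) := by
  have c1 := cont_of hg
  have c2 := cont_ofR hq
  have := ftc hcd (G := fun y => q y * ‖g y‖ ^ 2) (G' := fun y => q' y * ‖g y‖ ^ 2 + q y * (2 * inner ℝ (g y) (g' y)))
    (fun y hy => (hq y hy).mul (hd_normsq (hg y hy))) kont
  rw [← this, ← intervalIntegral.integral_sub (ii_of hcd kont) (ii_of hcd kont)]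
  apply intervalIntegral.integral_congr
  intro y hy
  simp only
  rw [norm_sub_sq_real, norm_smul, inner_smul_right, real_inner_comm, mul_pow, Real.norm_eq_abs, sq_abs]
  ring

theorem hardyR {a d ι : ℝ} (hcd : a ≤ d) (hι : 0 < ι) {g g' : ℝ → ℂ}
    (hg : ∀ y ∈ Icc a d, HasDerivAt g (g' y) y) (cg : ContinuousOn g' (Icc a d)) (g0 : g a = 0) :
    (∫ y in a..d, ‖g y‖ ^ 2 / (y - a + ι) ^ 2) ≤ 4 * ∫ y in a..d, ‖g' y‖ ^ 2 := by
  have c1 := cont_of hg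
  have pos : ∀ y ∈ Icc a d, 0 < y - a + ι := fun y hy => by linarith [hy.1]
  have pos' : ∀ y ∈ Icc a d, (y - a + ι) ^ 2 ≠ 0 := fun y hy => (pow_pos (pos y hy) 2).ne'
  have cq : ContinuousOn (fun y => -1 / (2 * (y - a + ι) ^ 2)) (Icc a d) := by
    apply ContinuousOn.div kont kont
    intro y hy; have := pos' y hy; positivity
  have c3 : ContinuousOn (fun y => ‖g y‖ ^ 2 / (y - a + ι) ^ 2) (Icc a d) := by
    apply ContinuousOn.div kont kont pos'
  have := qid hcd (q := fun y => 1 / (2 * (y - a + ι))) (q' := fun y => -1 / (2 * (y - a + ι) ^ 2)) hg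
    (by
      intro y hy
      have hp := pos y hy
      have h1 : HasDerivAt (fun y : ℝ => 2 * (y - a + ι)) (2 * 1) y := (((hasDerivAt_id y).sub_const a).add_const ι).const_mul 2
      have := (hasDerivAt_const y (1:ℝ)).div h1 (by positivity)
      refine this.congr_deriv ?_
      field_simp; ring) cg cq
  have h0 : 0 ≤ ∫ y in a..d, ‖g' y - (1 / (2 * (y - a + ι))) • g y‖ ^ 2 := int_nn hcd (fun y _ => by positivity)
  rw [this] at h0
  have e : (∫ y in a..d, (‖g' y‖ ^ 2 + (-1 / (2 * (y - a + ι) ^ 2) + (1 / (2 * (y - a + ι))) ^ 2) * ‖g y‖ ^ 2)) =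
      (∫ y in a..d, ‖g' y‖ ^ 2) - (1/4) * ∫ y in a..d, ‖g y‖ ^ 2 / (y - a + ι) ^ 2 := by
    rw [← icm, ← intervalIntegral.integral_sub (ii_of hcd kont) (ii_of hcd kont)]
    apply intervalIntegral.integral_congr
    intro y hy
    rw [uIcc_of_le hcd] at hy
    have hp := pos y hy
    simp only
    field_simp; ring
  rw [e] at h0
  have : 0 ≤ 1 / (2 * (d - a + ι)) * ‖g d‖ ^ 2 := by
    have := pos d ⟨hcd, le_rfl⟩
    positivity
  simp only [g0] at h0
  norm_num at h0 this
  linarith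

theorem hardyL {c a ι : ℝ} (hcd : c ≤ a) (hι : 0 < ι) {g g' : ℝ → ℂ}
    (hg : ∀ y ∈ Icc c a, HasDerivAt g (g' y) y) (cg : ContinuousOn g' (Icc c a)) (g0 : g a = 0) :
    (∫ y in c..a, ‖g y‖ ^ 2 / (a - y + ι) ^ 2) ≤ 4 * ∫ y in c..a, ‖g' y‖ ^ 2 := by
  have := hardyR (a := -a) (d := -c) (g := fun y => g (-y)) (g' := fun y => - g' (-y)) (by linarith) hι
    (by
      intro y hy
      have h := hg (-y) ⟨by linarith [hy.2], by linarith [hy.1]⟩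
      exact HasDerivAt.congr_deriv (h.scomp y (hasDerivAt_neg y)) (by simp))
    (by
      apply ContinuousOn.neg
      apply cg.comp kont
      intro y hy
      exact ⟨by linarith [hy.2], by linarith [hy.1]⟩)
    (by simpa using g0)
  have e1 := intervalIntegral.integral_comp_neg (a := -a) (b := -c) (fun y => ‖g y‖ ^ 2 / (a - y + ι) ^ 2)
  have e2 := intervalIntegral.integral_comp_neg (a := -a) (b := -c) (fun y => ‖g' y‖ ^ 2)
  simp only [neg_neg] at e1 e2
  rw [← e1, ← e2]
  simp only [norm_neg] at this
  convert this using 5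
  ring

theorem invsqR {a d ι : ℝ} (hcd : a ≤ d) (hι : 0 < ι) :
    (∫ y in a..d, 1 / (y - a + ι) ^ 2) ≤ 1 / ι := by
  have pos : ∀ y ∈ Icc a d, 0 < y - a + ι := fun y hy => by linarith [hy.1]
  rw [ftc hcd (G := fun y => - 1 / (y - a + ι))]
  · simp only [sub_self, zero_add]
    have : 0 < 1 / (d - a + ι) := by have := pos d ⟨hcd, le_rfl⟩; positivity
    rw [neg_div, neg_div]; linarith
  · intro y hy
    have hp := pos y hy
    have h1 : HasDerivAt (fun y : ℝ => (y - a + ι)) 1 y := (((hasDerivAt_id y).sub_const a).add_const ι)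
    have := (hasDerivAt_const y (-1:ℝ)).div h1 (by positivity)
    refine this.congr_deriv ?_
    field_simp; ring
  · apply ContinuousOn.div kont kont
    intro y hy; have := pos y hy; positivity

theorem invsqL {c a ι : ℝ} (hcd : c ≤ a) (hι : 0 < ι) :
    (∫ y in c..a, 1 / (a - y + ι) ^ 2) ≤ 1 / ι := by
  have := invsqR (a := -a) (d := -c) (by linarith) hι
  have e1 := intervalIntegral.integral_comp_neg (a := -a) (b := -c) (fun y => 1 / (a - y + ι) ^ 2)
  simp only [neg_neg] at e1
  rw [← e1]
  convert this using 5
  ring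

theorem int_add {c d : ℝ} {F G : ℝ → ℝ} (hcd : c ≤ d) (hF : ContinuousOn F (Icc c d))
    (hG : ContinuousOn G (Icc c d)) :
    (∫ y in c..d, (F y + G y)) = (∫ y in c..d, F y) + ∫ y in c..d, G y :=
  intervalIntegral.integral_add (ii_of hcd hF) (ii_of hcd hG)

theorem int_min {c d : ℝ} {F G : ℝ → ℝ} (hcd : c ≤ d) (hF : ContinuousOn F (Icc c d))
    (hG : ContinuousOn G (Icc c d)) :
    (∫ y in c..d, (F y - G y)) = (∫ y in c..d, F y) - ∫ y in c..d, G y :=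
  intervalIntegral.integral_sub (ii_of hcd hF) (ii_of hcd hG)

theorem int_cg {c d : ℝ} {F G : ℝ → ℝ} (hcd : c ≤ d) (h : ∀ y ∈ Icc c d, F y = G y) :
    (∫ y in c..d, F y) = ∫ y in c..d, G y := by
  apply intervalIntegral.integral_congr
  intro y hy
  rw [uIcc_of_le hcd] at hy
  exact h y hy

theorem int_le1 {c d α : ℝ} {F G : ℝ → ℝ} (hcd : c ≤ d) (hF : ContinuousOn F (Icc c d))
    (hG : ContinuousOn G (Icc c d)) (h : ∀ y ∈ Icc c d, F y ≤ α * G y) :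
    (∫ y in c..d, F y) ≤ α * ∫ y in c..d, G y := by
  rw [← icm]
  exact int_le hcd hF kont h

theorem int_le2 {c d α β : ℝ} {F G H : ℝ → ℝ} (hcd : c ≤ d) (hF : ContinuousOn F (Icc c d))
    (hG : ContinuousOn G (Icc c d)) (hH : ContinuousOn H (Icc c d))
    (h : ∀ y ∈ Icc c d, F y ≤ α * G y + β * H y) :
    (∫ y in c..d, F y) ≤ α * (∫ y in c..d, G y) + β * ∫ y in c..d, H y := by
  rw [← icm, ← icm, ← int_add hcd kont kont]
  exact int_le hcd hF kont h

theorem int_le3 {c d α β γ : ℝ} {F G H K : ℝ → ℝ} (hcd : c ≤ d) (hF : ContinuousOn F (Icc c d))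
    (hG : ContinuousOn G (Icc c d)) (hH : ContinuousOn H (Icc c d)) (hK : ContinuousOn K (Icc c d))
    (h : ∀ y ∈ Icc c d, F y ≤ α * G y + β * H y + γ * K y) :
    (∫ y in c..d, F y) ≤ α * (∫ y in c..d, G y) + β * (∫ y in c..d, H y) + γ * ∫ y in c..d, K y := by
  rw [← icm, ← icm,
    ← icm, ← int_add hcd kont kont, ← int_add hcd kont kont]
  exact int_le hcd hF kont h

theorem int_le4 {c d α β γ θ : ℝ} {F G H K J : ℝ → ℝ} (hcd : c ≤ d) (hF : ContinuousOn F (Icc c d))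
    (hG : ContinuousOn G (Icc c d)) (hH : ContinuousOn H (Icc c d)) (hK : ContinuousOn K (Icc c d))
    (hJ : ContinuousOn J (Icc c d))
    (h : ∀ y ∈ Icc c d, F y ≤ α * G y + β * H y + γ * K y + θ * J y) :
    (∫ y in c..d, F y) ≤ α * (∫ y in c..d, G y) + β * (∫ y in c..d, H y) + γ * (∫ y in c..d, K y)
      + θ * ∫ y in c..d, J y := by
  rw [← icm, ← icm,
    ← icm, ← icm, ← int_add hcd kont kont, ← int_add hcd kont kont, ← int_add hcd kont kont]
  exact int_le hcd hF kont h

theorem int_split {a b c : ℝ} {F : ℝ → ℝ} (h1 : a ≤ b) (h2 : b ≤ c) (hF : ContinuousOn F (Icc a c)) :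
    (∫ y in a..c, F y) = (∫ y in a..b, F y) + ∫ y in b..c, F y :=
  (intervalIntegral.integral_add_adjacent_intervals
    (ii_of h1 (hF.mono (Icc_subset_Icc le_rfl h2))) (ii_of h2 (hF.mono (Icc_subset_Icc h1 le_rfl)))).symm

theorem norm_add_sq_le2 (a b : ℂ) : ‖a + b‖ ^ 2 ≤ 2 * ‖a‖ ^ 2 + 2 * ‖b‖ ^ 2 := by
  have := norm_add_le a b
  have h0 := norm_nonneg (a + b)
  nlinarith [sq_nonneg (‖a‖ - ‖b‖)]

theorem norm_rsmul_sq (r : ℝ) (z : ℂ) : ‖r • z‖ ^ 2 = r ^ 2 * ‖z‖ ^ 2 := by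
  rw [norm_smul, mul_pow, Real.norm_eq_abs, sq_abs]

theorem norm_comb_sq (r s : ℝ) (z v : ℂ) : ‖r • z + s • v‖ ^ 2 ≤ 2 * r ^ 2 * ‖z‖ ^ 2 + 2 * s ^ 2 * ‖v‖ ^ 2 := by
  have := norm_add_sq_le2 (r • z) (s • v)
  rw [norm_rsmul_sq, norm_rsmul_sq] at this
  linarith

structure Sys (n k A0 Θ : ℝ) (w w' f f' : ℝ → ℂ) : Prop where
  hn : 0 < n
  hn1 : n ≤ 1
  hk : 1 ≤ k
  hΘ : 0 ≤ Θ
  dw : ∀ y, HasDerivAt w (w' y) y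
  df : ∀ y, HasDerivAt f (f' y) y
  cw : Continuous w'
  cf : Continuous f'
  w0 : w (-1) = 0
  w1 : w 1 = 0
  f0 : f (-1) = 0
  f1 : f 1 = 0
  P1 : ∀ (c d R : ℝ) (ψ ψ' : ℝ → ℂ), -1 ≤ c → c ≤ d → d ≤ 1 → (∀ y ∈ Icc c d, HasDerivAt ψ (ψ' y) y) →
    ContinuousOn ψ' (Icc c d) → ψ c = 0 → ψ d = 0 → 0 ≤ R →
    (∫ y in c..d, (‖ψ' y‖ ^ 2 + k ^ 2 * ‖ψ y‖ ^ 2)) ≤ R ^ 2 →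
    |∫ y in c..d, (inner ℝ (w y) (ψ y) + inner ℝ (f' y) (ψ' y) + k ^ 2 * inner ℝ (f y) (ψ y))| ≤ Θ * R
  P2 : ∀ (c d R : ℝ) (ψ ψ' : ℝ → ℂ), -1 ≤ c → c ≤ d → d ≤ 1 → (∀ y ∈ Icc c d, HasDerivAt ψ (ψ' y) y) →
    ContinuousOn ψ' (Icc c d) → ψ c = 0 → ψ d = 0 → 0 ≤ R →
    (∫ y in c..d, (‖ψ' y‖ ^ 2 + k ^ 2 * ‖ψ y‖ ^ 2)) ≤ R ^ 2 →
    |∫ y in c..d, ((A0 - y ^ 2) * inner ℝ (w y) (ψ y) + 2 * inner ℝ (f y) (ψ y))| ≤ Θ * n * R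
  P3a : (∫ y in (-1:ℝ)..1, ‖w' y‖ ^ 2) ≤ (Θ / n) ^ 2
  P3b : (∫ y in (-1:ℝ)..1, ‖w y‖ ^ 2) ≤ Θ ^ 2 / n
  P4 : ∀ (R : ℝ) (q q' : ℝ → ℝ), (∀ y ∈ Icc (-1:ℝ) 1, HasDerivAt q (q' y) y) →
    ContinuousOn q' (Icc (-1:ℝ) 1) → 0 ≤ R →
    (∫ y in (-1:ℝ)..1, ‖w y‖ ^ 2 * (q' y) ^ 2) ≤ R ^ 2 →
    |∫ y in (-1:ℝ)..1, q y * ((A0 - y ^ 2) * ‖w y‖ ^ 2 + 2 * inner ℝ (f y) (w y))| ≤ n * Θ * R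
  M1 : 1 / 4 ≤ ∫ y in (-1:ℝ)..1, (‖f' y‖ ^ 2 + k ^ 2 * ‖f y‖ ^ 2)
  M2 : (∫ y in (-1:ℝ)..1, (‖f' y‖ ^ 2 + k ^ 2 * ‖f y‖ ^ 2)) ≤ 4

namespace Sys
variable {n k A0 Θ : ℝ} {w w' f f' : ℝ → ℂ}

theorem cW (S : Sys n k A0 Θ w w' f f') : Continuous w :=
  continuous_iff_continuousAt.2 fun y => (S.dw y).continuousAt

theorem cF (S : Sys n k A0 Θ w w' f f') : Continuous f :=
  continuous_iff_continuousAt.2 fun y => (S.df y).continuousAt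

end Sys

set_option maxHeartbeats 2000000 in
theorem caseI {n k A0 Θ h : ℝ} {w w' f f' : ℝ → ℂ} (S : Sys n k A0 Θ w w' f f')
    (hh : 0 < h) (hnh : n = h ^ 2) (hA : 1 - h ≤ A0) (hT : Θ ≤ 1 / 400) : False := by
  have hk := S.hk
  have hΘ := S.hΘ
  have cw := S.cW
  have cf := S.cF
  have cw' := S.cw
  have cf' := S.cf
  have h1 : h ≤ 1 := by have := S.hn1; rw [hnh] at this; nlinarith
  set B := A0 + 2 * h with hB
  have hPB : ∀ y ∈ Icc (-1:ℝ) 1, h ≤ B - y ^ 2 := fun y hy => by nlinarith [hy.1, hy.2]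
  have hP0 : ∀ y ∈ Icc (-1:ℝ) 1, 0 < B - y ^ 2 := fun y hy => lt_of_lt_of_le hh (hPB y hy)
  have hPn : ∀ y ∈ Icc (-1:ℝ) 1, B - y ^ 2 ≠ 0 := fun y hy => (hP0 y hy).ne'
  have hPn2 : ∀ y ∈ Icc (-1:ℝ) 1, (B - y ^ 2) ^ 2 ≠ 0 := fun y hy => (pow_pos (hP0 y hy) 2).ne'
  have c01 : (-1:ℝ) ≤ 1 := by norm_num
  have dP : ∀ y, HasDerivAt (fun y : ℝ => B - y ^ 2) (-2 * y) y := fun y => by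
    have := (hasDerivAt_pow 2 y).const_sub B
    refine this.congr_deriv (by norm_num)
  have dI : ∀ y ∈ Icc (-1:ℝ) 1, HasDerivAt (fun y : ℝ => 1 / (B - y ^ 2)) (2 * y / (B - y ^ 2) ^ 2) y := fun y hy => by
    have := (hasDerivAt_const y (1:ℝ)).div (dP y) (hPn y hy)
    refine this.congr_deriv (by simp)
  have cI : ContinuousOn (fun y : ℝ => 1 / (B - y ^ 2)) (Icc (-1) 1) := cont_ofR dI
  have cI' : ContinuousOn (fun y : ℝ => 2 * y / (B - y ^ 2) ^ 2) (Icc (-1) 1) :=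
    ContinuousOn.div kont kont hPn2
  have cI2 : ContinuousOn (fun y : ℝ => ‖f y‖ ^ 2 / (B - y ^ 2) ^ 2) (Icc (-1) 1) :=
    ContinuousOn.div kont kont hPn2
  have cI1 : ContinuousOn (fun y : ℝ => ‖f y‖ ^ 2 / (B - y ^ 2)) (Icc (-1) 1) :=
    ContinuousOn.div kont kont hPn
  -- quantities
  set E := ∫ y in (-1:ℝ)..1, ‖f' y‖ ^ 2 with hE
  set K := ∫ y in (-1:ℝ)..1, k ^ 2 * ‖f y‖ ^ 2 with hK
  set D := ∫ y in (-1:ℝ)..1, ‖f y‖ ^ 2 / (B - y ^ 2) with hD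
  set D2 := ∫ y in (-1:ℝ)..1, ‖f y‖ ^ 2 / (B - y ^ 2) ^ 2 with hD2
  have hM : (∫ y in (-1:ℝ)..1, (‖f' y‖ ^ 2 + k ^ 2 * ‖f y‖ ^ 2)) = E + K := int_add c01 kont kont
  have M1 := S.M1
  have M2 := S.M2
  rw [hM] at M1 M2
  have K0 : 0 ≤ K := int_nn c01 fun y _ => by positivity
  have E0 : 0 ≤ E := int_nn c01 fun y _ => by positivity
  have hD20 : 0 ≤ D2 := int_nn c01 fun y _ => by positivity
  -- Hardy 1
  have H1 : D2 ≤ E := by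
    have := qid (c := -1) (d := 1) c01 (g := f) (g' := f') (q := fun y => - y * (1 / (B - y ^ 2)))
      (q' := fun y => (-1) * (1 / (B - y ^ 2)) + (-y) * (2 * y / (B - y ^ 2) ^ 2)) (fun y _ => S.df y)
      (fun y hy => (hasDerivAt_neg y).mul (dI y hy)) kont kont
    rw [S.f0, S.f1] at this
    have h0 : 0 ≤ ∫ y in (-1:ℝ)..1, ‖f' y - (- y * (1 / (B - y ^ 2))) • f y‖ ^ 2 := int_nn c01 fun y _ => by positivity
    rw [this] at h0
    have := int_le2 c01 (α := 1) (β := -1) (F := fun y => ‖f' y‖ ^ 2 + ((-1) * (1 / (B - y ^ 2)) + (-y) * (2 * y / (B - y ^ 2) ^ 2) + (- y * (1 / (B - y ^ 2))) ^ 2) * ‖f y‖ ^ 2)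
      (G := fun y => ‖f' y‖ ^ 2) (H := fun y => ‖f y‖ ^ 2 / (B - y ^ 2) ^ 2) kont kont kont (by
        intro y hy
        have hp := hP0 y hy
        have : ((-1) * (1 / (B - y ^ 2)) + (-y) * (2 * y / (B - y ^ 2) ^ 2) + (- y * (1 / (B - y ^ 2))) ^ 2) = - B * (1 / (B - y ^ 2) ^ 2) := by
          field_simp; ring
        rw [this]
        have h2 : (B - 1) * (‖f y‖ ^ 2 / (B - y ^ 2) ^ 2) ≥ 0 := by
          apply mul_nonneg; linarith; positivity
        have h3 : - B * (1 / (B - y ^ 2) ^ 2) * ‖f y‖ ^ 2 = - B * (‖f y‖ ^ 2 / (B - y ^ 2) ^ 2) := by ring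
        rw [h3]; linarith)
    rw [norm_zero] at h0
    linarith
  -- Hardy 2
  have H2 : 2 * D ≤ E := by
    have := qid (c := -1) (d := 1) c01 (g := f) (g' := f') (q := fun y => (- 2 * y) * (1 / (B - y ^ 2)))
      (q' := fun y => (-2 * 1) * (1 / (B - y ^ 2)) + (-2 * y) * (2 * y / (B - y ^ 2) ^ 2)) (fun y _ => S.df y)
      (fun y hy => ((hasDerivAt_id y).const_mul (-2)).mul (dI y hy)) kont kont
    rw [S.f0, S.f1] at this
    have h0 : 0 ≤ ∫ y in (-1:ℝ)..1, ‖f' y - (-2 * y * (1 / (B - y ^ 2))) • f y‖ ^ 2 := int_nn c01 fun y _ => by positivity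
    rw [this] at h0
    have := int_le2 c01 (α := 1) (β := -2) (F := fun y => ‖f' y‖ ^ 2 + ((-2 * 1) * (1 / (B - y ^ 2)) + (-2 * y) * (2 * y / (B - y ^ 2) ^ 2) + (-2 * y * (1 / (B - y ^ 2))) ^ 2) * ‖f y‖ ^ 2)
      (G := fun y => ‖f' y‖ ^ 2) (H := fun y => ‖f y‖ ^ 2 / (B - y ^ 2)) kont kont kont (by
        intro y hy
        have hp := hP0 y hy
        apply le_of_eq
        field_simp; ring)
    rw [norm_zero] at h0
    linarith
  -- test function
  have dψ : ∀ y ∈ Icc (-1:ℝ) 1, HasDerivAt (fun y => (1 / (B - y ^ 2)) • f y) ((1 / (B - y ^ 2)) • f' y + (2 * y / (B - y ^ 2) ^ 2) • f y) y :=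
    fun y hy => (dI y hy).smul (S.df y)
  have T1 := S.P1 (-1) 1 2 f f' le_rfl c01 le_rfl (fun y _ => S.df y) kont S.f0 S.f1 (by norm_num) (by rw [hM]; linarith)
  have T2 := S.P2 (-1) 1 (7 / h) (fun y => (1 / (B - y ^ 2)) • f y) (fun y => (1 / (B - y ^ 2)) • f' y + (2 * y / (B - y ^ 2) ^ 2) • f y) le_rfl c01 le_rfl dψ kont (by simp [S.f0]) (by simp [S.f1]) (by positivity) (by
    have := int_le3 c01 (α := 2 / h ^ 2) (β := 2 / h ^ 2) (γ := 8 / h ^ 2) (F := fun y => ‖(1 / (B - y ^ 2)) • f' y + (2 * y / (B - y ^ 2) ^ 2) • f y‖ ^ 2 + k ^ 2 * ‖(1 / (B - y ^ 2)) • f y‖ ^ 2) (G := fun y => ‖f' y‖ ^ 2) (H := fun y => k ^ 2 * ‖f y‖ ^ 2) (K := fun y => ‖f y‖ ^ 2 / (B - y ^ 2) ^ 2) kont kont kont kont (by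
      intro y hy
      have hp := hPB y hy
      have hp0 := hP0 y hy
      have i1 := norm_comb_sq (1 / (B - y ^ 2)) (2 * y / (B - y ^ 2) ^ 2) (f' y) (f y)
      rw [norm_rsmul_sq]
      have i2 : 1 / (B - y ^ 2) ≤ 1 / h := by gcongr
      have i3 : (1 / (B - y ^ 2)) ^ 2 ≤ 1 / h ^ 2 := by
        rw [one_div_pow]; gcongr
      have i4 : (2 * y / (B - y ^ 2) ^ 2) ^ 2 * ‖f y‖ ^ 2 ≤ 4 / h ^ 2 * (‖f y‖ ^ 2 / (B - y ^ 2) ^ 2) := by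
        have : (2 * y / (B - y ^ 2) ^ 2) ^ 2 * ‖f y‖ ^ 2 = 4 * y ^ 2 * (1 / (B - y ^ 2)) ^ 2 * (‖f y‖ ^ 2 / (B - y ^ 2) ^ 2) := by
          field_simp; ring
        rw [this]
        apply mul_le_mul_of_nonneg_right _ (by positivity)
        have : y ^ 2 ≤ 1 := by nlinarith only [hy.1, hy.2]
        calc 4 * y ^ 2 * (1 / (B - y ^ 2)) ^ 2 ≤ 4 * 1 * (1 / h ^ 2) := by gcongr
          _ = _ := by ring
      have i5 := mul_le_mul_of_nonneg_right i3 (sq_nonneg ‖f' y‖)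
      have i6 := mul_le_mul_of_nonneg_right i3 (show 0 ≤ k ^ 2 * ‖f y‖ ^ 2 by positivity)
      have i7 : 0 ≤ 1 / h ^ 2 * (k ^ 2 * ‖f y‖ ^ 2) := by positivity
      have e1 : 2 / h ^ 2 = 2 * (1 / h ^ 2) := by ring
      have e2 : 8 / h ^ 2 = 2 * (4 / h ^ 2) := by ring
      rw [e1, e2]
      linarith)
    refine this.trans ?_
    rw [← hE, ← hK, ← hD2]
    have : (2 / h ^ 2 * E + 2 / h ^ 2 * K + 8 / h ^ 2 * D2) = (2 * (E + K) + 8 * D2) / h ^ 2 := by ring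
    rw [this, div_pow]
    gcongr
    linarith)
  have T3 := cs_dom c01 (F := fun y => 2 * h * inner ℝ (w y) ((1 / (B - y ^ 2)) • f y)) (A := fun y => ‖w y‖) (B := fun y => 2 * h * ‖(1 / (B - y ^ 2)) • f y‖) (α := Θ / h) (β := 4 * h) kont kont kont (by positivity) (by positivity) (by
      intro y hy
      rw [abs_mul, abs_of_nonneg (by positivity)]
      have := abs_real_inner_le_norm (w y) ((1 / (B - y ^ 2)) • f y)
      nlinarith only [this, hh]) (by
      have := S.P3b
      rw [hnh] at this
      rwa [div_pow]) (by
      have := int_le1 c01 (α := 4 * h ^ 2) (F := fun y => (2 * h * ‖(1 / (B - y ^ 2)) • f y‖) ^ 2) (G := fun y => ‖f y‖ ^ 2 / (B - y ^ 2) ^ 2) kont kont (by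
        intro y hy
        rw [mul_pow, norm_rsmul_sq]
        apply le_of_eq
        have := hPn y hy
        field_simp; ring)
      refine this.trans ?_
      rw [← hD2]
      nlinarith only [H1, M2, K0, hh])
  -- combine
  have comb : E + K = (∫ y in (-1:ℝ)..1, (inner ℝ (w y) (f y) + inner ℝ (f' y) (f' y) + k ^ 2 * inner ℝ (f y) (f y)))
      - (∫ y in (-1:ℝ)..1, ((A0 - y ^ 2) * inner ℝ (w y) ((1 / (B - y ^ 2)) • f y) + 2 * inner ℝ (f y) ((1 / (B - y ^ 2)) • f y)))
      - (∫ y in (-1:ℝ)..1, 2 * h * inner ℝ (w y) ((1 / (B - y ^ 2)) • f y)) + 2 * D := by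
    rw [← hM, hD, ← icm, ← int_min c01 kont kont, ← int_min c01 kont kont, ← int_add c01 kont kont]
    apply int_cg c01
    intro y hy
    have := hPn y hy
    simp only [inner_smul_right, real_inner_self_eq_norm_sq]
    rw [hB] at *
    field_simp
    ring
  have t1 := abs_le.1 T1
  have t2 := abs_le.1 T2
  have t3 := abs_le.1 T3
  have z1 : Θ * n * (7 / h) ≤ 7 * Θ := by
    rw [hnh]
    have : Θ * h ^ 2 * (7 / h) = 7 * Θ * h := by field_simp
    rw [this]; nlinarith only [hΘ, h1]
  have z2 : Θ / h * (4 * h) = 4 * Θ := by field_simp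
  have r1 : E + K ≤ 2 * D + 13 * Θ := by linarith [t1.2, t2.1, t3.1]
  have r2 : K ≤ 13 * Θ := by linarith
  have r3 : 2 * D ≤ 1 / 2 * D2 + 2 * K := by
    have := int_le2 c01 (α := 1 / 4) (β := 1) (F := fun y => ‖f y‖ ^ 2 / (B - y ^ 2)) (G := fun y => ‖f y‖ ^ 2 / (B - y ^ 2) ^ 2) (H := fun y => k ^ 2 * ‖f y‖ ^ 2) kont kont kont (by
      intro y hy
      have hp := hP0 y hy
      have i1 : ‖f y‖ ^ 2 / (B - y ^ 2) = (1 / (B - y ^ 2)) * ‖f y‖ ^ 2 := by ring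
      have i2 : ‖f y‖ ^ 2 / (B - y ^ 2) ^ 2 = (1 / (B - y ^ 2)) ^ 2 * ‖f y‖ ^ 2 := by field_simp
      rw [i1, i2]
      have i3 : ‖f y‖ ^ 2 ≤ k ^ 2 * ‖f y‖ ^ 2 := by
        have : 1 ≤ k ^ 2 := by nlinarith only [hk]
        nlinarith only [sq_nonneg ‖f y‖, this]
      have i4 : 0 ≤ (1 / 2 * (1 / (B - y ^ 2)) - 1) ^ 2 * ‖f y‖ ^ 2 := by positivity
      nlinarith only [i3, i4])
    rw [← hD, ← hD2, ← hK] at this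
    linarith
  linarith

set_option maxHeartbeats 2000000 in
theorem caseII {n k A0 Θ A h : ℝ} {w w' f f' : ℝ → ℂ} (S : Sys n k A0 Θ w w' f f') (hh : 0 < h) (hnh : n = h ^ 2)
    (hA1 : 1 ≤ A) (hA : A0 ≤ A / 2 * n) (hT : Θ * A ≤ 1 / 400) : False := by
  have hk := S.hk
  have hΘ := S.hΘ
  have cw := S.cW
  have cf := S.cF
  have cw' := S.cw
  have cf' := S.cf
  have hn := S.hn
  have hT1 : Θ ≤ 1 / 400 := by nlinarith only [hT, hΘ, hA1]
  set b := A * n - A0 with hb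
  have hb1 : A * n ≤ 2 * b := by rw [hb]; linarith
  have hb0 : 0 < b := by have : 0 < A * n := by positivity
                         linarith
  have hPB : ∀ y ∈ Icc (-1:ℝ) 1, b ≤ b + y ^ 2 := fun y hy => by nlinarith only [sq_nonneg y]
  have hP0 : ∀ y ∈ Icc (-1:ℝ) 1, 0 < b + y ^ 2 := fun y hy => lt_of_lt_of_le hb0 (hPB y hy)
  have hPn : ∀ y ∈ Icc (-1:ℝ) 1, b + y ^ 2 ≠ 0 := fun y hy => (hP0 y hy).ne'
  have hPn2 : ∀ y ∈ Icc (-1:ℝ) 1, (b + y ^ 2) ^ 2 ≠ 0 := fun y hy => (pow_pos (hP0 y hy) 2).ne'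
  have c01 : (-1:ℝ) ≤ 1 := by norm_num
  have dP : ∀ y, HasDerivAt (fun y : ℝ => b + y ^ 2) (2 * y) y := fun y => by
    have := (hasDerivAt_pow 2 y).const_add b
    refine this.congr_deriv (by norm_num)
  have dI : ∀ y ∈ Icc (-1:ℝ) 1, HasDerivAt (fun y : ℝ => 1 / (b + y ^ 2)) (-(2 * y) / (b + y ^ 2) ^ 2) y := fun y hy => by
    have := (hasDerivAt_const y (1:ℝ)).div (dP y) (hPn y hy)
    refine this.congr_deriv (by simp)
  have cI : ContinuousOn (fun y : ℝ => 1 / (b + y ^ 2)) (Icc (-1) 1) := cont_ofR dI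
  have cI' : ContinuousOn (fun y : ℝ => -(2 * y) / (b + y ^ 2) ^ 2) (Icc (-1) 1) :=
    ContinuousOn.div kont kont hPn2
  have cI1 : ContinuousOn (fun y : ℝ => ‖f y‖ ^ 2 / (b + y ^ 2)) (Icc (-1) 1) :=
    ContinuousOn.div kont kont hPn
  set E := ∫ y in (-1:ℝ)..1, ‖f' y‖ ^ 2 with hE
  set K := ∫ y in (-1:ℝ)..1, k ^ 2 * ‖f y‖ ^ 2 with hK
  set D := ∫ y in (-1:ℝ)..1, ‖f y‖ ^ 2 / (b + y ^ 2) with hD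
  have hM : (∫ y in (-1:ℝ)..1, (‖f' y‖ ^ 2 + k ^ 2 * ‖f y‖ ^ 2)) = E + K := int_add c01 kont kont
  have M1 := S.M1
  have M2 := S.M2
  rw [hM] at M1 M2
  have D0 : 0 ≤ D := int_nn c01 fun y hy => by have := hP0 y hy; positivity
  have dψ : ∀ y ∈ Icc (-1:ℝ) 1, HasDerivAt (fun y => (1 / (b + y ^ 2)) • f y) ((1 / (b + y ^ 2)) • f' y + (-(2 * y) / (b + y ^ 2) ^ 2) • f y) y :=
    fun y hy => (dI y hy).smul (S.df y)
  have T1 := S.P1 (-1) 1 2 f f' le_rfl c01 le_rfl (fun y _ => S.df y) kont S.f0 S.f1 (by norm_num) (by rw [hM]; linarith)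
  have T2 := S.P2 (-1) 1 (3 * (1 + D) / b) (fun y => (1 / (b + y ^ 2)) • f y) (fun y => (1 / (b + y ^ 2)) • f' y + (-(2 * y) / (b + y ^ 2) ^ 2) • f y) le_rfl c01 le_rfl dψ kont (by simp [S.f0]) (by simp [S.f1]) (by positivity) (by
    have := int_le3 c01 (α := 2 / b ^ 2) (β := 2 / b ^ 2) (γ := 8 / b ^ 2) (F := fun y => ‖(1 / (b + y ^ 2)) • f' y + (-(2 * y) / (b + y ^ 2) ^ 2) • f y‖ ^ 2 + k ^ 2 * ‖(1 / (b + y ^ 2)) • f y‖ ^ 2) (G := fun y => ‖f' y‖ ^ 2) (H := fun y => k ^ 2 * ‖f y‖ ^ 2) (K := fun y => ‖f y‖ ^ 2 / (b + y ^ 2)) kont kont kont kont (by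
      intro y hy
      have hp := hPB y hy
      have hp0 := hP0 y hy
      have i1 := norm_comb_sq (1 / (b + y ^ 2)) (-(2 * y) / (b + y ^ 2) ^ 2) (f' y) (f y)
      rw [norm_rsmul_sq]
      have i3 : (1 / (b + y ^ 2)) ^ 2 ≤ 1 / b ^ 2 := by
        rw [one_div_pow]; gcongr
      have i4 : (-(2 * y) / (b + y ^ 2) ^ 2) ^ 2 * ‖f y‖ ^ 2 ≤ 4 / b ^ 2 * (‖f y‖ ^ 2 / (b + y ^ 2)) := by
        have : (-(2 * y) / (b + y ^ 2) ^ 2) ^ 2 * ‖f y‖ ^ 2 = 4 * (y ^ 2 / (b + y ^ 2)) * (1 / (b + y ^ 2)) ^ 2 * (‖f y‖ ^ 2 / (b + y ^ 2)) := by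
          field_simp; ring
        rw [this]
        apply mul_le_mul_of_nonneg_right _ (by positivity)
        have : y ^ 2 / (b + y ^ 2) ≤ 1 := by rw [div_le_one hp0]; linarith
        calc 4 * (y ^ 2 / (b + y ^ 2)) * (1 / (b + y ^ 2)) ^ 2 ≤ 4 * 1 * (1 / b ^ 2) := by gcongr
          _ = _ := by ring
      have i5 := mul_le_mul_of_nonneg_right i3 (sq_nonneg ‖f' y‖)
      have i6 := mul_le_mul_of_nonneg_right i3 (show 0 ≤ k ^ 2 * ‖f y‖ ^ 2 by positivity)
      have i7 : 0 ≤ 1 / b ^ 2 * (k ^ 2 * ‖f y‖ ^ 2) := by positivity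
      have e1 : 2 / b ^ 2 = 2 * (1 / b ^ 2) := by ring
      have e2 : 8 / b ^ 2 = 2 * (4 / b ^ 2) := by ring
      rw [e1, e2]
      linarith)
    refine this.trans ?_
    rw [← hE, ← hK, ← hD]
    have : (2 / b ^ 2 * E + 2 / b ^ 2 * K + 8 / b ^ 2 * D) = (2 * (E + K) + 8 * D) / b ^ 2 := by ring
    rw [this, div_pow]
    gcongr
    nlinarith only [M2, D0])
  have T3 : (∫ y in (-1:ℝ)..1, (- (A * n)) * inner ℝ (w y) ((1 / (b + y ^ 2)) • f y)) ≤ (A * n / 2) * (∫ y in (-1:ℝ)..1, ‖w y‖ ^ 2) + 1 * D := by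
    apply int_le2 c01 kont kont kont
    intro y hy
    have hp := hPB y hy
    have hp0 := hP0 y hy
    have := abs_real_inner_le_norm (w y) (f y)
    rw [inner_smul_right]
    set I : ℝ := inner ℝ (w y) (f y)
    have i0 : -I ≤ ‖w y‖ * ‖f y‖ := by linarith [(abs_le.1 this).1]
    have i1 : 0 ≤ (‖w y‖ * (b + y ^ 2) - ‖f y‖) ^ 2 := sq_nonneg _
    have e : -(A * n) * (1 / (b + y ^ 2) * I) ≤ A * n * (1 / (b + y ^ 2)) * (‖w y‖ * ‖f y‖) := by
      have : -(A * n) * (1 / (b + y ^ 2) * I) = A * n * (1 / (b + y ^ 2)) * (-I) := by ring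
      rw [this]
      apply mul_le_mul_of_nonneg_left i0; positivity
    refine e.trans ?_
    have e2 : A * n / 2 * ‖w y‖ ^ 2 + 1 * (‖f y‖ ^ 2 / (b + y ^ 2)) - A * n * (1 / (b + y ^ 2)) * (‖w y‖ * ‖f y‖)
      = (A * n / 2) * (‖w y‖ * (b + y ^ 2) - ‖f y‖) ^ 2 / (b + y ^ 2) ^ 2 + ‖f y‖ ^ 2 * (b + y ^ 2 - A * n / 2) / (b + y ^ 2) ^ 2 := by
      field_simp; ring
    have e3 : 0 ≤ (A * n / 2) * (‖w y‖ * (b + y ^ 2) - ‖f y‖) ^ 2 / (b + y ^ 2) ^ 2 := by positivity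
    have e4 : 0 ≤ ‖f y‖ ^ 2 * (b + y ^ 2 - A * n / 2) / (b + y ^ 2) ^ 2 := by
      apply div_nonneg _ (by positivity)
      apply mul_nonneg (by positivity); linarith
    linarith
  have comb : E + K = (∫ y in (-1:ℝ)..1, (inner ℝ (w y) (f y) + inner ℝ (f' y) (f' y) + k ^ 2 * inner ℝ (f y) (f y)))
      + (∫ y in (-1:ℝ)..1, ((A0 - y ^ 2) * inner ℝ (w y) ((1 / (b + y ^ 2)) • f y) + 2 * inner ℝ (f y) ((1 / (b + y ^ 2)) • f y)))
      + (∫ y in (-1:ℝ)..1, (- (A * n)) * inner ℝ (w y) ((1 / (b + y ^ 2)) • f y)) + (-2) * D := by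
    rw [← hM, hD, ← icm, ← int_add c01 kont kont, ← int_add c01 kont kont, ← int_add c01 kont kont]
    apply int_cg c01
    intro y hy
    have := hPn y hy
    simp only [inner_smul_right, real_inner_self_eq_norm_sq]
    rw [hb] at *
    field_simp
    ring
  have t1 := abs_le.1 T1
  have t2 := abs_le.1 T2
  have z1 : Θ * n * (3 * (1 + D) / b) ≤ 6 * Θ * (1 + D) := by
    rw [mul_div_assoc', div_le_iff₀ hb0]
    have : n ≤ 2 * b := by nlinarith only [hb1, hn, hA1]
    linarith only [mul_le_mul_of_nonneg_left this (show 0 ≤ 3 * Θ * (1 + D) by positivity)]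
  have z2 : (A * n / 2) * (∫ y in (-1:ℝ)..1, ‖w y‖ ^ 2) ≤ A * Θ ^ 2 / 2 := by
    have := mul_le_mul_of_nonneg_left S.P3b (show 0 ≤ A * n / 2 by positivity)
    refine this.trans (le_of_eq ?_)
    field_simp
  nlinarith only [t1.2, t2.2, z1, z2, T3, comb, hT1, hT, hΘ, D0, M1]

structure CP (r t δ : ℝ) : Prop where
  t0 : 0 < t
  r0 : 0 < r
  td : t ≤ δ * r ^ 2
  tl : t ^ 2 ≤ 1 - r ^ 4
  d0 : 0 < δ
  d1 : δ ≤ 1 / 10 ^ 12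

def Sv (r t y : ℝ) : ℝ := (r ^ 4 - y ^ 2) ^ 2 + t ^ 4
def ro (r t y : ℝ) : ℝ := (r ^ 4 - y ^ 2) / Sv r t y
def ro' (r t y : ℝ) : ℝ := 2 * y * ((r ^ 4 - y ^ 2) ^ 2 - t ^ 4) / Sv r t y ^ 2

namespace CP
variable {r t δ : ℝ}

theorem r1 (h : CP r t δ) : r < 1 := by
  have := h.tl; have := h.t0; have := h.r0
  have : r ^ 4 < 1 := by nlinarith [pow_pos h.t0 2]
  exact lt_of_pow_lt_pow_left₀ 4 (by norm_num) (by simpa using this)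

theorem t_le (h : CP r t δ) : t ≤ r ^ 2 := by
  have := h.td; have := h.d1
  nlinarith [pow_pos h.r0 2]

theorem t2_le (h : CP r t δ) : t ^ 2 ≤ δ ^ 2 * r ^ 4 := by
  have := pow_le_pow_left₀ h.t0.le h.td 2
  calc t ^ 2 ≤ (δ * r ^ 2) ^ 2 := this
    _ = _ := by ring

theorem t2_le' (h : CP r t δ) : t ^ 2 ≤ 1 / 10 ^ 24 * r ^ 4 := by
  have h1 := h.t2_le
  have : δ ^ 2 ≤ (1 / 10 ^ 12) ^ 2 := pow_le_pow_left₀ h.d0.le h.d1 2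
  have := mul_le_mul_of_nonneg_right this (pow_nonneg h.r0.le 4)
  norm_num at this ⊢
  linarith

theorem Spos (h : CP r t δ) (y : ℝ) : 0 < Sv r t y := by
  have := pow_pos h.t0 4; unfold Sv; positivity

theorem cS : Continuous (Sv r t) := by unfold Sv; fun_prop

theorem cro (h : CP r t δ) : Continuous (ro r t) := by
  unfold ro
  exact Continuous.div kont cS (fun y => (h.Spos y).ne')

theorem cro' (h : CP r t δ) : Continuous (ro' r t) := by
  have := @cS r t
  unfold ro'
  exact Continuous.div kont kont (fun y => (pow_pos (h.Spos y) 2).ne')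

theorem dS (y : ℝ) : HasDerivAt (Sv r t) (-4 * y * (r ^ 4 - y ^ 2)) y := by
  have h1 : HasDerivAt (fun y : ℝ => r ^ 4 - y ^ 2) (-(2 * y)) y := by
    refine ((hasDerivAt_pow 2 y).const_sub (r ^ 4)).congr_deriv (by norm_num)
  have := (h1.pow 2).add_const (t ^ 4)
  refine this.congr_deriv ?_
  norm_num; ring

theorem dro (h : CP r t δ) (y : ℝ) : HasDerivAt (ro r t) (ro' r t y) y := by
  have h1 : HasDerivAt (fun y : ℝ => r ^ 4 - y ^ 2) (-(2 * y)) y := by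
    refine ((hasDerivAt_pow 2 y).const_sub (r ^ 4)).congr_deriv (by norm_num)
  have := h1.div (dS (r := r) (t := t) y) (h.Spos y).ne'
  refine this.congr_deriv ?_
  unfold ro'
  congr 1
  unfold Sv; ring

theorem ro_abs (h : CP r t δ) (y : ℝ) : |ro r t y| ≤ 1 / (2 * t ^ 2) := by
  have hS := h.Spos y
  have ht := pow_pos h.t0 2
  rw [ro, abs_div, abs_of_pos hS, div_le_div_iff₀ hS (by positivity)]
  unfold Sv
  nlinarith [sq_nonneg (|r ^ 4 - y ^ 2| - t ^ 2), sq_abs (r ^ 4 - y ^ 2)]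

theorem ro_sq1 (h : CP r t δ) (y : ℝ) : ro r t y ^ 2 ≤ 1 / (4 * t ^ 4) := by
  have := h.ro_abs y
  have := pow_le_pow_left₀ (abs_nonneg _) this 2
  rw [sq_abs] at this
  refine this.trans (le_of_eq ?_)
  have := h.t0.ne'
  field_simp; norm_num

theorem roV (y : ℝ) : ro r t y * (r ^ 4 - y ^ 2) = (r ^ 4 - y ^ 2) ^ 2 / Sv r t y := by
  unfold ro; ring

theorem one_sub (h : CP r t δ) (y : ℝ) : 1 - ro r t y * (r ^ 4 - y ^ 2) = t ^ 4 / Sv r t y := by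
  have hS := h.Spos y
  rw [roV, eq_div_iff hS.ne', sub_mul, div_mul_cancel₀ _ hS.ne']
  unfold Sv; ring

theorem ro_sq (h : CP r t δ) (y : ℝ) : ro r t y ^ 2 ≤ 1 / Sv r t y := by
  have hS := h.Spos y
  have ht := pow_pos h.t0 4
  unfold ro
  rw [div_pow, div_le_div_iff₀ (by positivity) hS, sq (Sv r t y), ← mul_assoc, one_mul]
  apply mul_le_mul_of_nonneg_right _ hS.le
  unfold Sv; linarith

theorem y2 (h : CP r t δ) (y : ℝ) : y ^ 2 * t ^ 4 ≤ 3 / 2 * r ^ 4 * Sv r t y := by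
  have h1 := h.t2_le'
  have ht := pow_pos h.t0 2
  have hr := pow_pos h.r0 4
  unfold Sv
  set V := r ^ 4 - y ^ 2 with hV
  have e : y ^ 2 = r ^ 4 - V := by rw [hV]; ring
  rw [e]
  have i1 : -V * t ^ 4 ≤ t ^ 2 * (V ^ 2 + t ^ 4) / 2 := by nlinarith [mul_nonneg ht.le (sq_nonneg (V + t ^ 2))]
  have i2 : t ^ 2 * (V ^ 2 + t ^ 4) ≤ r ^ 4 * (V ^ 2 + t ^ 4) := by
    apply mul_le_mul_of_nonneg_right _ (by positivity); linarith
  have i3 : 0 ≤ r ^ 4 * V ^ 2 := by positivity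
  nlinarith

theorem ro'_abs (h : CP r t δ) (y : ℝ) : |ro' r t y| ≤ 2 * |y| / Sv r t y := by
  have hS := h.Spos y
  have ht := pow_pos h.t0 4
  unfold ro'
  rw [abs_div, abs_of_pos (pow_pos hS 2), abs_mul, abs_mul, abs_two, div_le_div_iff₀ (pow_pos hS 2) hS]
  have : |(r ^ 4 - y ^ 2) ^ 2 - t ^ 4| ≤ Sv r t y := by
    unfold Sv
    rw [abs_le]; constructor <;> nlinarith [sq_nonneg (r ^ 4 - y ^ 2)]
  calc 2 * |y| * |(r ^ 4 - y ^ 2) ^ 2 - t ^ 4| * Sv r t y ≤ 2 * |y| * Sv r t y * Sv r t y := by gcongr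
    _ = _ := by ring

theorem ro'_sq (h : CP r t δ) (y : ℝ) : ro' r t y ^ 2 ≤ 6 * r ^ 4 / t ^ 4 * (1 / Sv r t y) := by
  have hS := h.Spos y
  have ht := pow_pos h.t0 4
  have := pow_le_pow_left₀ (abs_nonneg _) (h.ro'_abs y) 2
  rw [sq_abs, div_pow, mul_pow, sq_abs] at this
  refine this.trans ?_
  have e : 6 * r ^ 4 / t ^ 4 * (1 / Sv r t y) = 6 * r ^ 4 / (t ^ 4 * Sv r t y) := by field_simp
  rw [e, div_le_div_iff₀ (by positivity) (by positivity)]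
  have := mul_le_mul_of_nonneg_right (h.y2 y) hS.le
  nlinarith

theorem S_ge (h : CP r t δ) (y : ℝ) : t ^ 4 ≤ Sv r t y := by
  unfold Sv; nlinarith [sq_nonneg (r ^ 4 - y ^ 2)]

theorem invS (h : CP r t δ) (y : ℝ) : 1 / Sv r t y ≤ 1 / t ^ 4 := by
  have := pow_pos h.t0 4
  have := h.S_ge y
  gcongr

theorem ro'_sq2 (h : CP r t δ) (y : ℝ) : ro' r t y ^ 2 ≤ 6 * r ^ 4 / t ^ 8 := by
  have hr := pow_pos h.r0 4
  have ht := pow_pos h.t0 4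
  refine (h.ro'_sq y).trans ?_
  calc 6 * r ^ 4 / t ^ 4 * (1 / Sv r t y) ≤ 6 * r ^ 4 / t ^ 4 * (1 / t ^ 4) := by
        apply mul_le_mul_of_nonneg_left (h.invS y); positivity
    _ = _ := by field_simp

theorem yro_sq (h : CP r t δ) (y : ℝ) : (y * ro r t y) ^ 2 ≤ 3 / 2 * r ^ 4 / t ^ 4 := by
  have hS := h.Spos y
  have ht := pow_pos h.t0 4
  have i1 := h.y2 y
  have i2 := h.ro_sq y
  rw [mul_pow]
  rw [le_div_iff₀ ht]
  calc y ^ 2 * ro r t y ^ 2 * t ^ 4 = (y ^ 2 * t ^ 4) * ro r t y ^ 2 := by ring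
    _ ≤ (3 / 2 * r ^ 4 * Sv r t y) * (1 / Sv r t y) := by gcongr
    _ = _ := by field_simp

theorem S_low (h : CP r t δ) {y : ℝ} (hy : 0 ≤ y) : r ^ 4 * (|y - r ^ 2| + t ^ 2 / r ^ 2) ^ 2 ≤ 2 * Sv r t y := by
  have hr := pow_pos h.r0 2
  have ht := pow_pos h.t0 2
  have e : r ^ 4 * (|y - r ^ 2| + t ^ 2 / r ^ 2) ^ 2 = (r ^ 2 * |y - r ^ 2| + t ^ 2) ^ 2 := by
    have e0 : r ^ 2 * (t ^ 2 / r ^ 2) = t ^ 2 := mul_div_cancel₀ _ hr.ne'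
    calc r ^ 4 * (|y - r ^ 2| + t ^ 2 / r ^ 2) ^ 2 = (r ^ 2 * |y - r ^ 2| + r ^ 2 * (t ^ 2 / r ^ 2)) ^ 2 := by ring
      _ = _ := by rw [e0]
  rw [e]
  have i1 : r ^ 2 * |y - r ^ 2| ≤ |r ^ 4 - y ^ 2| := by
    have : r ^ 4 - y ^ 2 = -((r ^ 2 + y) * (y - r ^ 2)) := by ring
    rw [this, abs_neg, abs_mul, abs_of_pos (by linarith : 0 < r ^ 2 + y)]
    apply mul_le_mul_of_nonneg_right (by linarith) (abs_nonneg _)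
  have i2 : (r ^ 2 * |y - r ^ 2|) ^ 2 ≤ (r ^ 4 - y ^ 2) ^ 2 := by
    rw [← sq_abs (r ^ 4 - y ^ 2)]
    exact pow_le_pow_left₀ (by positivity) i1 2
  unfold Sv
  nlinarith [sq_nonneg (r ^ 2 * |y - r ^ 2| - t ^ 2)]

theorem invS_le (h : CP r t δ) {y : ℝ} (hy : 0 ≤ y) : 1 / Sv r t y ≤ 2 / r ^ 4 * (1 / (|y - r ^ 2| + t ^ 2 / r ^ 2) ^ 2) := by
  have hr := pow_pos h.r0 2
  have ht := pow_pos h.t0 2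
  have hS := h.Spos y
  have hr4 := pow_pos h.r0 4
  have hq : 0 < |y - r ^ 2| + t ^ 2 / r ^ 2 := by positivity
  have := h.S_low hy
  have e : 2 / r ^ 4 * (1 / (|y - r ^ 2| + t ^ 2 / r ^ 2) ^ 2) = 2 / (r ^ 4 * (|y - r ^ 2| + t ^ 2 / r ^ 2) ^ 2) := by
    field_simp
  rw [e, div_le_div_iff₀ hS (by positivity)]
  linarith

theorem int_right (h : CP r t δ) {d : ℝ} (hd : r ^ 2 ≤ d) : (∫ y in (r ^ 2)..d, 1 / Sv r t y) ≤ 2 / (r ^ 2 * t ^ 2) := by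
  have hr := pow_pos h.r0 2
  have ht := pow_pos h.t0 2
  have hι : 0 < t ^ 2 / r ^ 2 := by positivity
  have c1 : ContinuousOn (fun y => 1 / Sv r t y) (Icc (r ^ 2) d) :=
    (Continuous.div continuous_const cS (fun y => (h.Spos y).ne')).continuousOn
  have := int_le1 (α := 2 / r ^ 4) hd c1 (G := fun y => 1 / (y - r ^ 2 + t ^ 2 / r ^ 2) ^ 2) (by
    apply ContinuousOn.div kont kont
    intro y hy
    have : 0 < y - r ^ 2 + t ^ 2 / r ^ 2 := by linarith [hy.1]
    positivity) (by
    intro y hy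
    have := h.invS_le (y := y) (by linarith [hy.1])
    rwa [abs_of_nonneg (by linarith [hy.1])] at this)
  refine this.trans ?_
  have i := mul_le_mul_of_nonneg_left (invsqR hd hι) (show 0 ≤ 2 / r ^ 4 by positivity)
  refine i.trans (le_of_eq ?_)
  have := h.r0.ne'
  have := h.t0.ne'
  field_simp

theorem int_left (h : CP r t δ) : (∫ y in (0:ℝ)..(r ^ 2), 1 / Sv r t y) ≤ 2 / (r ^ 2 * t ^ 2) := by
  have hr := pow_pos h.r0 2
  have ht := pow_pos h.t0 2
  have hι : 0 < t ^ 2 / r ^ 2 := by positivity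
  have c1 : ContinuousOn (fun y => 1 / Sv r t y) (Icc 0 (r ^ 2)) :=
    (Continuous.div continuous_const cS (fun y => (h.Spos y).ne')).continuousOn
  have := int_le1 (α := 2 / r ^ 4) hr.le c1 (G := fun y => 1 / (r ^ 2 - y + t ^ 2 / r ^ 2) ^ 2) (by
    apply ContinuousOn.div kont kont
    intro y hy
    have : 0 < r ^ 2 - y + t ^ 2 / r ^ 2 := by linarith [hy.2]
    positivity) (by
    intro y hy
    have := h.invS_le (y := y) hy.1
    rwa [abs_of_nonpos (by linarith [hy.2]), neg_sub] at this)
  refine this.trans ?_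
  have i := mul_le_mul_of_nonneg_left (invsqL hr.le hι) (show 0 ≤ 2 / r ^ 4 by positivity)
  refine i.trans (le_of_eq ?_)
  have := h.r0.ne'
  have := h.t0.ne'
  field_simp

theorem int_half (h : CP r t δ) {d : ℝ} (hd : r ^ 2 ≤ d) : (∫ y in (0:ℝ)..d, 1 / Sv r t y) ≤ 4 / (r ^ 2 * t ^ 2) := by
  rw [int_split (F := fun y => 1 / Sv r t y) (pow_pos h.r0 2).le hd
    ((Continuous.div continuous_const cS (fun y => (h.Spos y).ne')).continuousOn)]
  have := h.int_left
  have := h.int_right hd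
  have : 4 / (r ^ 2 * t ^ 2) = 2 / (r ^ 2 * t ^ 2) + 2 / (r ^ 2 * t ^ 2) := by ring
  linarith

theorem hS_right (h : CP r t δ) {d : ℝ} (hd : r ^ 2 ≤ d) {g g' : ℝ → ℂ}
    (hg : ∀ y ∈ Icc (r ^ 2) d, HasDerivAt g (g' y) y) (cg : ContinuousOn g' (Icc (r ^ 2) d)) (g0 : g (r ^ 2) = 0) :
    (∫ y in (r ^ 2)..d, ‖g y‖ ^ 2 / Sv r t y) ≤ 8 / r ^ 4 * ∫ y in (r ^ 2)..d, ‖g' y‖ ^ 2 := by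
  have hr := pow_pos h.r0 2
  have ht := pow_pos h.t0 2
  have hι : 0 < t ^ 2 / r ^ 2 := by positivity
  have c0 := cont_of hg
  have c1 : ContinuousOn (fun y => ‖g y‖ ^ 2 / Sv r t y) (Icc (r ^ 2) d) :=
    ContinuousOn.div kont cS.continuousOn (fun y _ => (h.Spos y).ne')
  have := int_le1 (α := 2 / r ^ 4) hd c1 (G := fun y => ‖g y‖ ^ 2 / (y - r ^ 2 + t ^ 2 / r ^ 2) ^ 2) (by
    apply ContinuousOn.div kont kont
    intro y hy
    have : 0 < y - r ^ 2 + t ^ 2 / r ^ 2 := by linarith [hy.1]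
    positivity) (by
    intro y hy
    have := h.invS_le (y := y) (by linarith [hy.1])
    rw [abs_of_nonneg (by linarith [hy.1])] at this
    have := mul_le_mul_of_nonneg_left this (sq_nonneg ‖g y‖)
    calc ‖g y‖ ^ 2 / Sv r t y = ‖g y‖ ^ 2 * (1 / Sv r t y) := by ring
      _ ≤ _ := this
      _ = _ := by ring)
  refine this.trans ?_
  have i := mul_le_mul_of_nonneg_left (hardyR hd hι hg cg g0) (show 0 ≤ 2 / r ^ 4 by positivity)
  refine i.trans (le_of_eq ?_)
  ring

theorem hS_left (h : CP r t δ) {g g' : ℝ → ℂ}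
    (hg : ∀ y ∈ Icc 0 (r ^ 2), HasDerivAt g (g' y) y) (cg : ContinuousOn g' (Icc 0 (r ^ 2))) (g0 : g (r ^ 2) = 0) :
    (∫ y in (0:ℝ)..(r ^ 2), ‖g y‖ ^ 2 / Sv r t y) ≤ 8 / r ^ 4 * ∫ y in (0:ℝ)..(r ^ 2), ‖g' y‖ ^ 2 := by
  have hr := pow_pos h.r0 2
  have ht := pow_pos h.t0 2
  have hι : 0 < t ^ 2 / r ^ 2 := by positivity
  have c0 := cont_of hg
  have c1 : ContinuousOn (fun y => ‖g y‖ ^ 2 / Sv r t y) (Icc 0 (r ^ 2)) :=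
    ContinuousOn.div kont cS.continuousOn (fun y _ => (h.Spos y).ne')
  have := int_le1 (α := 2 / r ^ 4) hr.le c1 (G := fun y => ‖g y‖ ^ 2 / (r ^ 2 - y + t ^ 2 / r ^ 2) ^ 2) (by
    apply ContinuousOn.div kont kont
    intro y hy
    have : 0 < r ^ 2 - y + t ^ 2 / r ^ 2 := by linarith [hy.2]
    positivity) (by
    intro y hy
    have := h.invS_le (y := y) hy.1
    rw [abs_of_nonpos (by linarith [hy.2]), neg_sub] at this
    have := mul_le_mul_of_nonneg_left this (sq_nonneg ‖g y‖)
    calc ‖g y‖ ^ 2 / Sv r t y = ‖g y‖ ^ 2 * (1 / Sv r t y) := by ring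
      _ ≤ _ := this
      _ = _ := by ring)
  refine this.trans ?_
  have i := mul_le_mul_of_nonneg_left (hardyL hr.le hι hg cg g0) (show 0 ≤ 2 / r ^ 4 by positivity)
  refine i.trans (le_of_eq ?_)
  ring

theorem hS_half (h : CP r t δ) {d : ℝ} (hd : r ^ 2 ≤ d) {g g' : ℝ → ℂ}
    (hg : ∀ y, HasDerivAt g (g' y) y) (cg : Continuous g') (g0 : g (r ^ 2) = 0) :
    (∫ y in (0:ℝ)..d, ‖g y‖ ^ 2 / Sv r t y) ≤ 8 / r ^ 4 * ∫ y in (0:ℝ)..d, ‖g' y‖ ^ 2 := by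
  have hr := pow_pos h.r0 2
  have c0 : Continuous g := continuous_iff_continuousAt.2 fun y => (hg y).continuousAt
  rw [int_split (F := fun y => ‖g y‖ ^ 2 / Sv r t y) hr.le hd (ContinuousOn.div kont cS.continuousOn (fun y _ => (h.Spos y).ne')),
    int_split (F := fun y => ‖g' y‖ ^ 2) hr.le hd kont]
  have := h.hS_left (fun y _ => hg y) cg.continuousOn g0
  have := h.hS_right hd (fun y _ => hg y) cg.continuousOn g0
  linarith

end CP

theorem holder {c d α s : ℝ} (hcd : c ≤ d) {f f' : ℝ → ℂ} (df : ∀ y ∈ Icc c d, HasDerivAt f (f' y) y)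
    (cf : ContinuousOn f' (Icc c d)) (hα : 0 ≤ α) (hs : 0 ≤ s) (h1 : (∫ y in c..d, ‖f' y‖ ^ 2) ≤ α ^ 2) (h2 : d - c ≤ s ^ 2) :
    ‖f d - f c‖ ≤ α * s := by
  set e := f d - f c with he
  have := ftc hcd (G := fun y => inner ℝ (f y) e) (G' := fun y => inner ℝ (f' y) e)
    (fun y hy => by
      have := (df y hy).inner ℝ (hasDerivAt_const y e)
      simpa using this) kont
  rw [← inner_sub_left, ← he, real_inner_self_eq_norm_sq] at this
  have i := cs_dom hcd (F := fun y => inner ℝ (f' y) e) (A := fun y => ‖f' y‖) (B := fun _ => ‖e‖) (α := α) (β := s * ‖e‖)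
    kont kont kont hα (by positivity) (fun y _ => abs_real_inner_le_norm _ _) h1
    (by
      rw [intervalIntegral.integral_const, smul_eq_mul, mul_pow]
      gcongr)
  rw [this, abs_of_nonneg (by positivity)] at i
  rcases eq_or_lt_of_le (norm_nonneg e) with h0 | h0
  · rw [← h0]; positivity
  · nlinarith

namespace Sys
variable {n k A0 Θ : ℝ} {w w' f f' : ℝ → ℂ}

theorem dneg {g g' : ℝ → ℂ} {y : ℝ} (h : HasDerivAt g (g' (-y)) (-y)) : HasDerivAt (fun y => g (-y)) (- g' (-y)) y :=
  HasDerivAt.congr_deriv (h.scomp y (hasDerivAt_neg y)) (by simp)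

theorem reflect (S : Sys n k A0 Θ w w' f f') :
    Sys n k A0 Θ (fun y => w (-y)) (fun y => - w' (-y)) (fun y => f (-y)) (fun y => - f' (-y)) := by
  have cw := S.cw
  have cf := S.cf
  refine ⟨S.hn, S.hn1, S.hk, S.hΘ, fun y => dneg (S.dw _), fun y => dneg (S.df _), kont, kont,
    by simpa using S.w1, S.w0, by simpa using S.f1, S.f0, ?_, ?_, ?_, ?_, ?_, ?_, ?_⟩
  · intro c d R ψ ψ' h1 h2 h3 hd hc e1 e2 hR hI
    have := S.P1 (-d) (-c) R (fun y => ψ (-y)) (fun y => - ψ' (-y)) (by linarith) (by linarith) (by linarith)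
      (fun y hy => dneg (hd (-y) ⟨by linarith [hy.2], by linarith [hy.1]⟩))
      (by
        apply ContinuousOn.neg
        apply hc.comp kont
        intro y hy
        exact ⟨by linarith [hy.2], by linarith [hy.1]⟩) (by simpa using e2) (by simpa using e1) hR (by
        rw [← intervalIntegral.integral_comp_neg]
        simpa using hI)
    rw [← intervalIntegral.integral_comp_neg] at this
    simpa using this
  · intro c d R ψ ψ' h1 h2 h3 hd hc e1 e2 hR hI
    have := S.P2 (-d) (-c) R (fun y => ψ (-y)) (fun y => - ψ' (-y)) (by linarith) (by linarith) (by linarith)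
      (fun y hy => dneg (hd (-y) ⟨by linarith [hy.2], by linarith [hy.1]⟩))
      (by
        apply ContinuousOn.neg
        apply hc.comp kont
        intro y hy
        exact ⟨by linarith [hy.2], by linarith [hy.1]⟩) (by simpa using e2) (by simpa using e1) hR (by
        rw [← intervalIntegral.integral_comp_neg]
        simpa using hI)
    rw [← intervalIntegral.integral_comp_neg] at this
    simpa using this
  · have := intervalIntegral.integral_comp_neg (a := -1) (b := 1) (fun y => ‖w' y‖ ^ 2)
    simp only [norm_neg, neg_neg] at this ⊢
    rw [this]; exact S.P3a
  · have := intervalIntegral.integral_comp_neg (a := -1) (b := 1) (fun y => ‖w y‖ ^ 2)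
    simp only [neg_neg] at this ⊢
    rw [this]; exact S.P3b
  · intro R q q' hd hc hR hI
    have := S.P4 R (fun y => q (-y)) (fun y => - q' (-y)) (fun y hy => by
        refine HasDerivAt.congr_deriv ((hd (-y) ⟨by linarith [hy.2], by linarith [hy.1]⟩).scomp y (hasDerivAt_neg y)) (by simp))
      (by
        apply ContinuousOn.neg
        apply hc.comp kont
        intro y hy
        exact ⟨by linarith [hy.2], by linarith [hy.1]⟩) hR (by
        have e := intervalIntegral.integral_comp_neg (a := -1) (b := 1) (fun y => ‖w y‖ ^ 2 * (- q' (-y)) ^ 2)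
        simp only [neg_neg, neg_sq] at e ⊢
        rw [← e]; exact hI)
    have e := intervalIntegral.integral_comp_neg (a := -1) (b := 1) (fun y => q (-y) * ((A0 - y ^ 2) * ‖w y‖ ^ 2 + 2 * inner ℝ (f y) (w y)))
    simp only [neg_neg, neg_sq] at e
    rw [e]; exact this
  · have := intervalIntegral.integral_comp_neg (a := -1) (b := 1) (fun y => ‖f' y‖ ^ 2 + k ^ 2 * ‖f y‖ ^ 2)
    simp only [norm_neg, neg_neg] at this ⊢
    rw [this]; exact S.M1
  · have := intervalIntegral.integral_comp_neg (a := -1) (b := 1) (fun y => ‖f' y‖ ^ 2 + k ^ 2 * ‖f y‖ ^ 2)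
    simp only [norm_neg, neg_neg] at this ⊢
    rw [this]; exact S.M2

theorem sub_int (S : Sys n k A0 Θ w w' f f') {c d : ℝ} (h1 : -1 ≤ c) (h2 : c ≤ d) (h3 : d ≤ 1) :
    (∫ y in c..d, ‖f' y‖ ^ 2) ≤ 2 ^ 2 := by
  have cf := S.cf
  have cF := S.cF
  have i1 := int_sub h1 h2 h3 (F := fun y => ‖f' y‖ ^ 2) kont (fun y _ => by positivity)
  have i2 := int_le (c := -1) (d := 1) (F := fun y => ‖f' y‖ ^ 2) (G := fun y => ‖f' y‖ ^ 2 + k ^ 2 * ‖f y‖ ^ 2) (by norm_num)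
    kont kont (fun y _ => le_add_of_nonneg_right (by positivity))
  have := S.M2
  linarith
end Sys

namespace CP
variable {r t δ : ℝ}

theorem bump (h : CP r t δ) : ∃ c d : ℝ, 0 < c ∧ c ≤ r ^ 2 ∧ r ^ 2 ≤ d ∧ d ≤ 1 ∧ c ^ 2 = r ^ 4 - t ^ 2 ∧ d ^ 2 = r ^ 4 + t ^ 2 ∧
    d - c ≤ 2 * (t / r) ^ 2 ∧ r ^ 2 - c ≤ (t / r) ^ 2 ∧ d - r ^ 2 ≤ (t / r) ^ 2 ∧ d ≤ 2 * r ^ 2 := by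
  have h1 := h.t2_le'
  have ht := pow_pos h.t0 2
  have hr := pow_pos h.r0 2
  have hr4 := pow_pos h.r0 4
  have hl := h.tl
  have e4 : r ^ 4 = (r ^ 2) ^ 2 := by ring
  have hc : 0 < r ^ 4 - t ^ 2 := by nlinarith
  have hc0 := Real.sqrt_pos.2 hc
  have hcs := Real.sq_sqrt hc.le
  have hds := Real.sq_sqrt (show 0 ≤ r ^ 4 + t ^ 2 by positivity)
  have hd0 := Real.sqrt_nonneg (r ^ 4 + t ^ 2)
  set c := Real.sqrt (r ^ 4 - t ^ 2)
  set d := Real.sqrt (r ^ 4 + t ^ 2)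
  have i1 : c ≤ r ^ 2 := by nlinarith
  have i2 : r ^ 2 ≤ d := by nlinarith
  have e : (t / r) ^ 2 = t ^ 2 / r ^ 2 := by ring
  have i3 : r ^ 2 - c ≤ (t / r) ^ 2 := by
    rw [e, le_div_iff₀ hr]; nlinarith
  have i4 : d - r ^ 2 ≤ (t / r) ^ 2 := by
    rw [e, le_div_iff₀ hr]; nlinarith
  exact ⟨c, d, hc0, i1, i2, by nlinarith, hcs, hds, by linarith, i3, i4, by nlinarith⟩

end CP

namespace Sys
variable {n k Θ r t δ : ℝ} {w w' f f' : ℝ → ℂ}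

set_option maxHeartbeats 1000000 in
theorem L1a (S : Sys n k (r ^ 4) Θ w w' f f') (h : CP r t δ) (hn : n = t ^ 3 / r ^ 2) (hΘ : Θ ≤ δ) (hk : k * t ^ 2 ≤ r ^ 2) :
    ‖f (r ^ 2)‖ ≤ 14 * δ * r := by
  obtain ⟨c, d, hc0, hc, hd, hd1, ec, ed, hdc, i1, i2, hd2⟩ := h.bump
  have cw := S.cW
  have cf := S.cF
  have cw' := S.cw
  have cf' := S.cf
  have ht := h.t0
  have hr := h.r0
  have hcd : c ≤ d := hc.trans hd
  have hΘ0 := S.hΘ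
  set e := f (r ^ 2) with he
  have fV : ∀ y ∈ Icc c d, |r ^ 4 - y ^ 2| ≤ t ^ 2 := fun y hy => by
    have := pow_le_pow_left₀ hc0.le hy.1 2
    have := pow_le_pow_left₀ (hc0.le.trans hy.1) hy.2 2
    rw [abs_le]; constructor <;> linarith only [this, ec, ed, ‹c ^ 2 ≤ y ^ 2›]
  have fb : ∀ y ∈ Icc c d, 0 ≤ 1 - (r ^ 4 - y ^ 2) ^ 2 / t ^ 4 ∧ 1 - (r ^ 4 - y ^ 2) ^ 2 / t ^ 4 ≤ 1 := fun y hy => by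
    have := pow_le_pow_left₀ (abs_nonneg _) (fV y hy) 2
    rw [sq_abs] at this
    have i : (r ^ 4 - y ^ 2) ^ 2 / t ^ 4 ≤ 1 := by
      rw [div_le_one (by positivity)]; linarith only [this]
    have j : 0 ≤ (r ^ 4 - y ^ 2) ^ 2 / t ^ 4 := by positivity
    constructor <;> linarith only [i, j]
  have dV : ∀ y, HasDerivAt (fun y : ℝ => r ^ 4 - y ^ 2) (-(2 * y)) y := fun y =>
    ((hasDerivAt_pow 2 y).const_sub (r ^ 4)).congr_deriv (by norm_num)
  have db : ∀ y, HasDerivAt (fun y : ℝ => 1 - (r ^ 4 - y ^ 2) ^ 2 / t ^ 4) (4 * y * (r ^ 4 - y ^ 2) / t ^ 4) y := fun y =>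
    ((((dV y).pow 2).div_const (t ^ 4)).const_sub 1).congr_deriv (by norm_num; ring)
  set b : ℝ → ℝ := fun y => 1 - (r ^ 4 - y ^ 2) ^ 2 / t ^ 4 with hb
  have cb : Continuous b := by rw [hb]; fun_prop
  set p' : ℝ → ℝ := fun y => 1 * b y + y * (4 * y * (r ^ 4 - y ^ 2) / t ^ 4) with hp'
  have cp' : Continuous p' := by rw [hp']; fun_prop
  have dp : ∀ y, HasDerivAt (fun y => y * b y) (p' y) y := fun y => (hasDerivAt_id y).mul (db y)
  have bc : b c = 0 := by
    rw [hb]; simp only [ec]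
    have : (r ^ 4 - (r ^ 4 - t ^ 2)) ^ 2 / t ^ 4 = 1 := by
      rw [div_eq_one_iff_eq (by positivity)]; ring
    rw [this]; ring
  have bd : b d = 0 := by
    rw [hb]; simp only [ed]
    have : (r ^ 4 - (r ^ 4 + t ^ 2)) ^ 2 / t ^ 4 = 1 := by
      rw [div_eq_one_iff_eq (by positivity)]; ring
    rw [this]; ring
  have pb : ∀ y ∈ Icc c d, |p' y| ≤ 9 * r ^ 4 / t ^ 2 := fun y hy => by
    have j := fb y hy
    have q1 : |b y| ≤ 1 := by rw [abs_of_nonneg j.1]; exact j.2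
    have q2 : |y * (4 * y * (r ^ 4 - y ^ 2) / t ^ 4)| ≤ 4 * (r ^ 4 + t ^ 2) / t ^ 2 := by
      have : y * (4 * y * (r ^ 4 - y ^ 2) / t ^ 4) = 4 * y ^ 2 / t ^ 4 * (r ^ 4 - y ^ 2) := by ring
      rw [this, abs_mul, abs_of_nonneg (by positivity)]
      have y2 := pow_le_pow_left₀ (hc0.le.trans hy.1) hy.2 2
      calc 4 * y ^ 2 / t ^ 4 * |r ^ 4 - y ^ 2| ≤ 4 * (r ^ 4 + t ^ 2) / t ^ 4 * t ^ 2 := by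
            gcongr
            · linarith only [y2, ed]
            · exact fV y hy
        _ = _ := by field_simp
    have q3 : 1 + 4 * (r ^ 4 + t ^ 2) / t ^ 2 ≤ 9 * r ^ 4 / t ^ 2 := by
      rw [← sub_nonneg]
      have : 9 * r ^ 4 / t ^ 2 - (1 + 4 * (r ^ 4 + t ^ 2) / t ^ 2) = 5 * (r ^ 4 - t ^ 2) / t ^ 2 := by field_simp; ring
      rw [this, ← ec]; positivity
    have := abs_add_le (1 * b y) (y * (4 * y * (r ^ 4 - y ^ 2) / t ^ 4))
    rw [one_mul] at this
    show |1 * b y + y * (4 * y * (r ^ 4 - y ^ 2) / t ^ 4)| ≤ _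
    rw [one_mul]
    linarith only [this, q1, q2, q3]
  -- P2
  have T := S.P2 c d (14 * r ^ 3 / t * ‖e‖) (fun y => (y * b y) • e) (fun y => p' y • e) (by linarith only [hc0]) hcd hd1
    (fun y _ => (dp y).smul_const e) kont (by simp [bc]) (by simp [bd]) (by positivity) (by
      have := int_le1 hcd (F := fun y => ‖p' y • e‖ ^ 2 + k ^ 2 * ‖(y * b y) • e‖ ^ 2) (G := fun _ => 1) (α := 85 * r ^ 8 / t ^ 4 * ‖e‖ ^ 2) kont kont (by
        intro y hy
        rw [norm_rsmul_sq, norm_rsmul_sq]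
        have q1 := pow_le_pow_left₀ (abs_nonneg _) (pb y hy) 2
        rw [sq_abs] at q1
        have q2 : k ^ 2 * (y * b y) ^ 2 ≤ 4 * r ^ 8 / t ^ 4 := by
          have j := fb y hy
          have y0 : 0 ≤ y := hc0.le.trans hy.1
          have : k * (y * b y) ≤ (r ^ 2 / t ^ 2) * (2 * r ^ 2 * 1) := by
            have k1 : k ≤ r ^ 2 / t ^ 2 := by rw [le_div_iff₀ (by positivity)]; exact hk
            have k0 := S.hk
            have jb : b y ≤ 1 := j.2
            have jb0 : 0 ≤ b y := j.1
            have y2 := hy.2.trans hd2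
            gcongr
          have jb0 : 0 ≤ b y := j.1
          have := pow_le_pow_left₀ (by have := S.hk; positivity) this 2
          calc k ^ 2 * (y * b y) ^ 2 = (k * (y * b y)) ^ 2 := by ring
            _ ≤ _ := this
            _ = _ := by field_simp; norm_num
        have q3 : (9 * r ^ 4 / t ^ 2) ^ 2 = 81 * r ^ 8 / t ^ 4 := by field_simp; norm_num
        rw [q3] at q1
        have q4 : 85 * r ^ 8 / t ^ 4 = 81 * r ^ 8 / t ^ 4 + 4 * r ^ 8 / t ^ 4 := by ring
        calc p' y ^ 2 * ‖e‖ ^ 2 + k ^ 2 * ((y * b y) ^ 2 * ‖e‖ ^ 2) = (p' y ^ 2 + k ^ 2 * (y * b y) ^ 2) * ‖e‖ ^ 2 := by ring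
          _ ≤ (85 * r ^ 8 / t ^ 4) * ‖e‖ ^ 2 := by
            gcongr; linarith only [q1, q2, q4]
          _ = _ := by ring)
      refine this.trans ?_
      rw [intervalIntegral.integral_const, smul_eq_mul, mul_one]
      calc 85 * r ^ 8 / t ^ 4 * ‖e‖ ^ 2 * (d - c) ≤ 85 * r ^ 8 / t ^ 4 * ‖e‖ ^ 2 * (2 * (t / r) ^ 2) := by gcongr
        _ = 170 * (r ^ 6 / t ^ 2 * ‖e‖ ^ 2) := by field_simp; ring
        _ ≤ 196 * (r ^ 6 / t ^ 2 * ‖e‖ ^ 2) := by gcongr; norm_num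
        _ = _ := by field_simp; ring)
  -- integrate by parts
  have dκ : ∀ y, HasDerivAt (fun y => t ^ 4 / 8 * b y ^ 2) (y * b y * (r ^ 4 - y ^ 2)) y := fun y =>
    (((db y).pow 2).const_mul (t ^ 4 / 8)).congr_deriv (by
      have : t ≠ 0 := ht.ne'
      push_cast; norm_num; field_simp; ring)
  have I1 := ftc hcd (G := fun y => (t ^ 4 / 8 * b y ^ 2) * inner ℝ (w y) e)
    (G' := fun y => (y * b y * (r ^ 4 - y ^ 2)) * inner ℝ (w y) e + (t ^ 4 / 8 * b y ^ 2) * inner ℝ (w' y) e)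
    (fun y _ => (dκ y).mul (by
      have := (S.dw y).inner ℝ (hasDerivAt_const y e)
      simpa using this)) kont
  simp only [bc, bd] at I1
  rw [zero_pow two_ne_zero, mul_zero, zero_mul, zero_mul, sub_zero] at I1
  rw [int_add hcd kont kont] at I1
  have wsub : (∫ y in c..d, ‖w' y‖ ^ 2) ≤ (Θ / n) ^ 2 :=
    (int_sub (by linarith only [hc0]) hcd hd1 (F := fun y => ‖w' y‖ ^ 2) kont (fun y _ => by positivity)).trans S.P3a
  have n0 := S.hn
  have I2 := cs_dom hcd (F := fun y => (t ^ 4 / 8 * b y ^ 2) * inner ℝ (w' y) e) (A := fun y => ‖w' y‖) (B := fun _ => t ^ 4 / 8 * ‖e‖) (α := Θ / n)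
    (β := t ^ 4 / 8 * ‖e‖ * (2 * (t / r))) kont kont kont (by positivity) (by positivity) (by
      intro y hy
      have j := fb y hy
      have jb : b y ^ 2 ≤ 1 := pow_le_one₀ j.1 j.2
      rw [abs_mul, abs_of_nonneg (by positivity)]
      have := abs_real_inner_le_norm (w' y) e
      calc t ^ 4 / 8 * b y ^ 2 * |inner ℝ (w' y) e| ≤ t ^ 4 / 8 * 1 * (‖w' y‖ * ‖e‖) := by gcongr
        _ = _ := by ring) wsub (by
      rw [intervalIntegral.integral_const, smul_eq_mul]
      calc (d - c) * (t ^ 4 / 8 * ‖e‖) ^ 2 ≤ (2 * (t / r) ^ 2) * (t ^ 4 / 8 * ‖e‖) ^ 2 := by gcongr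
        _ ≤ (4 * (t / r) ^ 2) * (t ^ 4 / 8 * ‖e‖) ^ 2 := by gcongr; norm_num
        _ = _ := by ring)
  have I3 := ftc hcd (G := fun y => - (r ^ 4 - y ^ 2) / 2 + (r ^ 4 - y ^ 2) ^ 3 / (6 * t ^ 4)) (G' := fun y => y * b y)
    (fun y _ => (((dV y).neg.div_const 2).add (((dV y).pow 3).div_const (6 * t ^ 4))).congr_deriv (by
      simp only [hb]; field_simp; norm_num; ring)) kont
  have I3' : (∫ y in c..d, y * b y) = 2 * t ^ 2 / 3 := by
    rw [I3, ec, ed]; field_simp; ring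
  have I4 : (∫ y in c..d, (-2) * ((y * b y) * inner ℝ (f y) e)) ≤ (-2 * (‖e‖ ^ 2) + 4 * (t / r) * ‖e‖) * ∫ y in c..d, y * b y := by
    apply int_le1 hcd kont kont
    intro y hy
    have j := (fb y hy).1
    have y0 : 0 ≤ y := hc0.le.trans hy.1
    have jb0 : 0 ≤ b y := j
    have : ‖f y - e‖ ≤ 2 * (t / r) := by
      rcases le_total y (r ^ 2) with hy1 | hy1
      · rw [norm_sub_rev]
        exact holder hy1 (fun y _ => S.df y) kont (by norm_num) (by positivity)
          (S.sub_int (by linarith only [y0]) hy1 (by linarith only [hd, hd1])) (by linarith only [hy.1, i1])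
      · exact holder hy1 (fun y _ => S.df y) kont (by norm_num) (by positivity)
          (S.sub_int (by linarith only [hc0, hc]) hy1 (hy.2.trans hd1)) (by linarith only [hy.2, i2])
    have q : inner ℝ (f y) e = ‖e‖ ^ 2 + inner ℝ (f y - e) e := by
      rw [inner_sub_left, real_inner_self_eq_norm_sq]; ring
    have q2 := (abs_le.1 (abs_real_inner_le_norm (f y - e) e)).1
    have q3 : ‖f y - e‖ * ‖e‖ ≤ 2 * (t / r) * ‖e‖ := by gcongr
    have q4 : -2 * inner ℝ (f y) e ≤ -2 * (‖e‖ ^ 2) + 4 * (t / r) * ‖e‖ := by rw [q]; linarith only [q2, q3]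
    have := mul_le_mul_of_nonneg_right q4 (show 0 ≤ y * b y by positivity)
    linarith only [this]
  have comb : (∫ y in c..d, ((r ^ 4 - y ^ 2) * inner ℝ (w y) ((y * b y) • e) + 2 * inner ℝ (f y) ((y * b y) • e))) =
      (∫ y in c..d, (y * b y * (r ^ 4 - y ^ 2)) * inner ℝ (w y) e) - ∫ y in c..d, (-2) * ((y * b y) * inner ℝ (f y) e) := by
    rw [← int_min hcd kont kont]
    apply int_cg hcd
    intro y hy
    simp only [inner_smul_right]; ring
  rw [comb] at T
  rw [I3'] at I4
  have T' := (abs_le.1 T).2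
  have I2' := (abs_le.1 I2).2
  have z1 : Θ * n * (14 * r ^ 3 / t * ‖e‖) = 14 * Θ * t ^ 2 * r * ‖e‖ := by rw [hn]; field_simp
  have z2 : Θ / n * (t ^ 4 / 8 * ‖e‖ * (2 * (t / r))) = Θ * t ^ 2 * r / 4 * ‖e‖ := by rw [hn]; field_simp; ring
  rw [z1] at T'
  rw [z2] at I2'
  rcases eq_or_lt_of_le (norm_nonneg e) with h0 | h0
  · rw [← h0]; have := h.d0; positivity
  have fin : (4 / 3 * t ^ 2) * ‖e‖ * ‖e‖ ≤ (14.25 * Θ * t ^ 2 * r + 8 / 3 * t ^ 2 * (t / r)) * ‖e‖ := by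
    linarith only [T', I2', I4, I1]
  have fin2 := le_of_mul_le_mul_right fin h0
  have tr : t / r ≤ δ * r := by
    rw [div_le_iff₀ hr]; linarith only [h.td]
  have t2 := pow_pos ht 2
  have fin3 : t ^ 2 * (4 / 3 * ‖e‖) ≤ t ^ 2 * (14.25 * δ * r + 8 / 3 * (δ * r)) := by
    have y1 : t ^ 2 * (t / r) ≤ t ^ 2 * (δ * r) := by gcongr
    have y2 : Θ * (t ^ 2 * r) ≤ δ * (t ^ 2 * r) := by gcongr
    linarith only [fin2, y1, y2]
  have fin4 := le_of_mul_le_mul_left fin3 t2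
  have : 0 < δ * r := mul_pos h.d0 hr
  linarith only [fin4, this]

theorem L1 (S : Sys n k (r ^ 4) Θ w w' f f') (h : CP r t δ) (hn : n = t ^ 3 / r ^ 2) (hΘ : Θ ≤ δ) :
    ‖f (r ^ 2)‖ ≤ 14 * δ * r := by
  rcases le_or_gt (k * t ^ 2) (r ^ 2) with hk | hk
  · exact S.L1a h hn hΘ hk
  have cf := S.cF
  have cf' := S.cf
  have hr1 := h.r1
  have hr := h.r0
  have ht := h.t0
  have k1 := S.hk
  have r21 : r ^ 2 ≤ 1 := pow_le_one₀ hr.le hr1.le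
  have hr2 := pow_pos hr 2
  have hcd : (-1:ℝ) ≤ r ^ 2 := by linarith
  have I := ftc hcd (G := fun y => ‖f y‖ ^ 2) (G' := fun y => 2 * inner ℝ (f y) (f' y)) (fun y _ => hd_normsq (S.df y)) kont
  have I2 := int_le1 hcd (F := fun y => 2 * inner ℝ (f y) (f' y)) (G := fun y => ‖f' y‖ ^ 2 + k ^ 2 * ‖f y‖ ^ 2) (α := 1 / k) kont kont (by
    intro y hy
    have := (abs_le.1 (abs_real_inner_le_norm (f y) (f' y))).2
    have e : 1 / k * (‖f' y‖ ^ 2 + k ^ 2 * ‖f y‖ ^ 2) - 2 * (‖f y‖ * ‖f' y‖) = (‖f' y‖ - k * ‖f y‖) ^ 2 / k := by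
      field_simp; ring
    have : 0 ≤ (‖f' y‖ - k * ‖f y‖) ^ 2 / k := by positivity
    linarith)
  have I3 := int_sub (le_refl (-1:ℝ)) hcd r21 (F := fun y => ‖f' y‖ ^ 2 + k ^ 2 * ‖f y‖ ^ 2) kont (fun y _ => by positivity)
  have I4 := S.M2
  rw [I, S.f0] at I2
  simp only [norm_zero] at I2
  have k2 : 1 / k ≤ (t / r) ^ 2 := by
    rw [div_pow, div_le_div_iff₀ (by linarith) hr2]; linarith
  have I5 : ‖f (r ^ 2)‖ ^ 2 ≤ (2 * (t / r)) ^ 2 := by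
    calc ‖f (r ^ 2)‖ ^ 2 ≤ 1 / k * (∫ y in (-1:ℝ)..(r ^ 2), (‖f' y‖ ^ 2 + k ^ 2 * ‖f y‖ ^ 2)) := by linarith
      _ ≤ (t / r) ^ 2 * 4 := by
        gcongr
        · exact int_nn hcd (fun y _ => by positivity)
        · linarith
      _ = _ := by ring
  have := abs_le_of_sq_le_sq I5 (by positivity)
  have tr : t / r ≤ δ * r := by
    rw [div_le_iff₀ hr]; linarith only [h.td]
  have d0 : 0 < δ * r := mul_pos h.d0 hr
  rw [abs_norm] at this
  linarith only [this, tr, d0]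

end Sys

namespace Sys
variable {n k Θ r t δ : ℝ} {w w' f f' : ℝ → ℂ}

theorem L2h (S : Sys n k (r ^ 4) Θ w w' f f') (h : CP r t δ) (hn : n = t ^ 3 / r ^ 2) (hΘ : Θ ≤ δ) :
    (∫ y in (0:ℝ)..1, ‖f y‖ ^ 2 / Sv r t y) ≤ 1632 * δ ^ 2 / t ^ 2 := by
  have L := S.L1 h hn hΘ
  have cf := S.cF
  have cf' := S.cf
  have cS := @CP.cS r t
  have r21 : r ^ 2 ≤ 1 := pow_le_one₀ h.r0.le h.r1.le
  have nz : ∀ y, Sv r t y ≠ 0 := fun y => (h.Spos y).ne'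
  have H := h.hS_half r21 (g := fun y => f y - f (r ^ 2)) (g' := f') (fun y => (S.df y).sub_const _) cf' (sub_self _)
  have H2 := S.sub_int (c := 0) (d := 1) (by norm_num) (by norm_num) le_rfl
  have H3 := h.int_half r21
  have c1 : Continuous (fun y => ‖f y - f (r ^ 2)‖ ^ 2 / Sv r t y) := Continuous.div kont cS nz
  have c2 : Continuous (fun y => 1 / Sv r t y) := Continuous.div kont cS nz
  have c3 : Continuous (fun y => ‖f y‖ ^ 2 / Sv r t y) := Continuous.div kont cS nz
  have I := int_le2 (c := 0) (d := 1) (by norm_num) (F := fun y => ‖f y‖ ^ 2 / Sv r t y) (α := 2)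
    (β := 2 * ‖f (r ^ 2)‖ ^ 2) c3.continuousOn c1.continuousOn c2.continuousOn (by
      intro y _
      have := norm_add_sq_le2 (f y - f (r ^ 2)) (f (r ^ 2))
      rw [sub_add_cancel] at this
      have hS := h.Spos y
      have := div_le_div_of_nonneg_right this hS.le
      refine this.trans (le_of_eq ?_)
      ring)
  have L' := pow_le_pow_left₀ (norm_nonneg _) L 2
  have hr := h.r0
  have ht := h.t0
  have e1 : 1 / r ^ 4 ≤ δ ^ 2 / t ^ 2 := by
    rw [div_le_div_iff₀ (by positivity) (by positivity), one_mul]; exact h.t2_le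
  have i1 : 8 / r ^ 4 * (∫ y in (0:ℝ)..1, ‖f' y‖ ^ 2) ≤ 8 / r ^ 4 * 2 ^ 2 := by gcongr
  have i2 : 2 * ‖f (r ^ 2)‖ ^ 2 * (∫ y in (0:ℝ)..1, 1 / Sv r t y) ≤ 2 * (14 * δ * r) ^ 2 * (4 / (r ^ 2 * t ^ 2)) := by
    gcongr
    exact int_nn (by norm_num) (fun y _ => by have := h.Spos y; positivity)
  have e2 : 2 * (14 * δ * r) ^ 2 * (4 / (r ^ 2 * t ^ 2)) = 1568 * (δ ^ 2 / t ^ 2) := by field_simp; ring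
  have e3 : 8 / r ^ 4 * 2 ^ 2 = 32 * (1 / r ^ 4) := by ring
  rw [mul_div_assoc]
  linarith only [I, i1, i2, e2, e3, e1, H]

theorem L2 (S : Sys n k (r ^ 4) Θ w w' f f') (h : CP r t δ) (hn : n = t ^ 3 / r ^ 2) (hΘ : Θ ≤ δ) :
    (∫ y in (-1:ℝ)..1, ‖f y‖ ^ 2 / Sv r t y) ≤ 3264 * δ ^ 2 / t ^ 2 := by
  have h1 := S.L2h h hn hΘ
  have h2 := S.reflect.L2h h hn hΘ
  have cf := S.cF
  have cS := @CP.cS r t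
  have nz : ∀ y, Sv r t y ≠ 0 := fun y => (h.Spos y).ne'
  have c3 : Continuous (fun y => ‖f y‖ ^ 2 / Sv r t y) := Continuous.div kont cS nz
  have e1 := intervalIntegral.integral_comp_neg (a := 0) (b := 1) (fun y => ‖f y‖ ^ 2 / Sv r t y)
  have e2 : ∀ y, Sv r t (-y) = Sv r t y := fun y => by unfold Sv; ring
  simp only [e2, neg_zero] at e1
  rw [int_split (b := 0) (by norm_num) (by norm_num) c3.continuousOn, ← e1]
  have : 3264 * δ ^ 2 / t ^ 2 = 1632 * δ ^ 2 / t ^ 2 + 1632 * δ ^ 2 / t ^ 2 := by ring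
  linarith only [h1, h2, this]

theorem L3a (S : Sys n k (r ^ 4) Θ w w' f f') (h : CP r t δ) (hn : n = t ^ 3 / r ^ 2) (hΘ : Θ ≤ δ) {W : ℝ} (hW : 0 ≤ W)
    (hO : (∫ y in (-1:ℝ)..1, ‖w y‖ ^ 2) ≤ W ^ 2) :
    (∫ y in (-1:ℝ)..1, (ro r t y * (r ^ 4 - y ^ 2)) * ‖w y‖ ^ 2) ≤ 13056 * (δ / t) ^ 2 + 6 * (δ / t) * W := by
  have cf := S.cF
  have cw := S.cW
  have cS := @CP.cS r t
  have cro := h.cro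
  have cro' := h.cro'
  have hr := h.r0
  have ht := h.t0
  have h11 : (-1:ℝ) ≤ 1 := by norm_num
  have nz : ∀ y, Sv r t y ≠ 0 := fun y => (h.Spos y).ne'
  have P := S.P4 (3 * r ^ 2 * W / t ^ 4) (ro r t) (ro' r t) (fun y _ => h.dro y) cro'.continuousOn (by positivity) (by
    have := int_le1 h11 (F := fun y => ‖w y‖ ^ 2 * (ro' r t y) ^ 2) (G := fun y => ‖w y‖ ^ 2) (α := 6 * r ^ 4 / t ^ 8) kont kont (by
      intro y _
      rw [mul_comm]
      exact mul_le_mul_of_nonneg_right (h.ro'_sq2 y) (by positivity))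
    refine this.trans ?_
    calc 6 * r ^ 4 / t ^ 8 * (∫ y in (-1:ℝ)..1, ‖w y‖ ^ 2) ≤ 9 * r ^ 4 / t ^ 8 * W ^ 2 := by
          gcongr
          · exact int_nn h11 (fun y _ => by positivity)
          · norm_num
      _ = _ := by field_simp; ring)
  have c3 : Continuous (fun y => ‖f y‖ ^ 2 / Sv r t y) := Continuous.div kont cS nz
  have I := int_le3 h11 (F := fun y => (ro r t y * (r ^ 4 - y ^ 2)) * ‖w y‖ ^ 2)
    (G := fun y => ro r t y * ((r ^ 4 - y ^ 2) * ‖w y‖ ^ 2 + 2 * inner ℝ (f y) (w y)))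
    (H := fun y => (ro r t y * (r ^ 4 - y ^ 2)) * ‖w y‖ ^ 2) (K := fun y => ‖f y‖ ^ 2 / Sv r t y) (α := 1) (β := 1 / 2) (γ := 2)
    kont kont kont c3.continuousOn (by
      intro y _
      have hS := h.Spos y
      have q := (abs_le.1 (abs_real_inner_le_norm (((r ^ 4 - y ^ 2)) • f y) (w y))).1
      rw [inner_smul_left, norm_smul, Real.norm_eq_abs] at q
      simp only [conj_trivial] at q
      have q2 : -2 * ((r ^ 4 - y ^ 2) * inner ℝ (f y) (w y)) ≤ 1 / 2 * (r ^ 4 - y ^ 2) ^ 2 * ‖w y‖ ^ 2 + 2 * ‖f y‖ ^ 2 := by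
        nlinarith only [sq_nonneg (|r ^ 4 - y ^ 2| * ‖w y‖ - 2 * ‖f y‖), q, sq_abs (r ^ 4 - y ^ 2)]
      have q3 := div_le_div_of_nonneg_right q2 hS.le
      have e1 : ro r t y * inner ℝ (f y) (w y) * (-2) = -2 * ((r ^ 4 - y ^ 2) * inner ℝ (f y) (w y)) / Sv r t y := by
        unfold ro; ring
      have e2 : 1 / 2 * (ro r t y * (r ^ 4 - y ^ 2) * ‖w y‖ ^ 2) + 2 * (‖f y‖ ^ 2 / Sv r t y) =
        (1 / 2 * (r ^ 4 - y ^ 2) ^ 2 * ‖w y‖ ^ 2 + 2 * ‖f y‖ ^ 2) / Sv r t y := by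
        unfold ro; ring
      linarith only [q3, e1, e2])
  have L := S.L2 h hn hΘ
  have P' := (abs_le.1 P).2
  have e1 : n * Θ * (3 * r ^ 2 * W / t ^ 4) = 3 * Θ * W / t := by rw [hn]; field_simp
  have e2 : 3 * Θ * W / t ≤ 3 * δ * W / t := by gcongr
  rw [e1] at P'
  have e3 : 6 * (δ / t) * W = 2 * (3 * δ * W / t) := by ring
  have e4 : 13056 * (δ / t) ^ 2 = 4 * (3264 * δ ^ 2 / t ^ 2) := by ring
  linarith only [P', I, L, e2, e3, e4]

theorem L3 (S : Sys n k (r ^ 4) Θ w w' f f') (h : CP r t δ) (hn : n = t ^ 3 / r ^ 2) (hΘ : Θ ≤ δ) :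
    (∫ y in (-1:ℝ)..1, ‖w y‖ ^ 2) ≤ (1100 * (δ / t)) ^ 2 := by
  set Ω := ∫ y in (-1:ℝ)..1, ‖w y‖ ^ 2 with hΩ
  have h11 : (-1:ℝ) ≤ 1 := by norm_num
  have Ω0 : 0 ≤ Ω := int_nn h11 (fun y _ => by positivity)
  obtain ⟨W, hW0, hW⟩ : ∃ W : ℝ, 0 ≤ W ∧ W ^ 2 = Ω := ⟨√Ω, sqrt_nonneg _, sq_sqrt Ω0⟩
  have X := S.L3a h hn hΘ hW0 hW.ge
  have cw := S.cW
  have cw' := S.cw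
  have cS := @CP.cS r t
  have cro := h.cro
  have cro' := h.cro'
  have hr := h.r0
  have ht := h.t0
  have n0 := S.hn
  have Θ0 := S.hΘ
  have nz : ∀ y, Sv r t y ≠ 0 := fun y => (h.Spos y).ne'
  have ct : Continuous (fun y => t ^ 4 / Sv r t y) := Continuous.div kont cS nz
  have I1 := ftc h11 (G := fun y => (y * ro r t y) * ‖w y‖ ^ 2)
    (G' := fun y => (1 * ro r t y + y * ro' r t y) * ‖w y‖ ^ 2 + (y * ro r t y) * (2 * inner ℝ (w y) (w' y)))
    (fun y _ => ((hasDerivAt_id y).mul (h.dro y)).mul (hd_normsq (S.dw y))) kont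
  rw [S.w0, S.w1, norm_zero, zero_pow two_ne_zero, mul_zero, mul_zero, sub_zero,
    int_add h11 kont kont] at I1
  have I2 := cs_dom h11 (F := fun y => (y * ro r t y) * (2 * inner ℝ (w y) (w' y))) (A := fun y => ‖w y‖)
    (B := fun y => 5 / 2 * r ^ 2 / t ^ 2 * ‖w' y‖) (α := W) (β := 5 / 2 * r ^ 2 / t ^ 2 * (Θ / n)) kont kont kont
    hW0 (by positivity) (by
      intro y _
      have q := abs_le_of_sq_le_sq (a := y * ro r t y) (b := 5 / 4 * r ^ 2 / t ^ 2) ((h.yro_sq y).trans (by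
        have : (5 / 4 * r ^ 2 / t ^ 2) ^ 2 = 25 / 16 * r ^ 4 / t ^ 4 := by field_simp; norm_num
        have i : 0 ≤ r ^ 4 / t ^ 4 := by positivity
        rw [this, mul_div_assoc, mul_div_assoc]; linarith only [i])) (by positivity)
      rw [abs_mul (y * ro r t y), abs_mul 2, abs_two]
      have := abs_real_inner_le_norm (w y) (w' y)
      calc _ ≤ 5 / 4 * r ^ 2 / t ^ 2 * (2 * (‖w y‖ * ‖w' y‖)) := by gcongr
        _ = _ := by ring) (by rw [hW]) (by
      have := int_le1 h11 (F := fun y => (5 / 2 * r ^ 2 / t ^ 2 * ‖w' y‖) ^ 2) (G := fun y => ‖w' y‖ ^ 2) (α := (5 / 2 * r ^ 2 / t ^ 2) ^ 2)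
        kont kont (fun y _ => by rw [mul_pow])
      refine this.trans ?_
      rw [mul_pow]
      have := S.P3a
      gcongr)
  have e1 : W * (5 / 2 * r ^ 2 / t ^ 2 * (Θ / n)) = 5 / 2 * (Θ / t) * W * (r ^ 4 / t ^ 4) := by rw [hn]; field_simp
  rw [e1] at I2
  have e2 : Θ / t ≤ δ / t := by gcongr
  have I3 := int_le3 h11 (F := fun y => y ^ 2 * (t ^ 4 / Sv r t y) ^ 2 * ‖w y‖ ^ 2)
    (G := fun y => ‖w y‖ ^ 2) (H := fun y => (ro r t y * (r ^ 4 - y ^ 2)) * ‖w y‖ ^ 2)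
    (K := fun y => (1 * ro r t y + y * ro' r t y) * ‖w y‖ ^ 2) (α := t ^ 2 / 4) (β := 3 / 2 * r ^ 4) (γ := - (t ^ 4 / 2))
    kont kont kont kont (by
      intro y _
      have hS := h.Spos y
      have a1 := (abs_le.1 (h.ro_abs y)).2
      have a2 := h.y2 y
      have e : y ^ 2 * (t ^ 4 / Sv r t y) ^ 2 = t ^ 4 / 2 * ro r t y + (r ^ 4 - y ^ 2) ^ 2 / Sv r t y * (y ^ 2 * t ^ 4 / Sv r t y) -
          t ^ 4 / 2 * (1 * ro r t y + y * ro' r t y) := by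
        unfold ro'; field_simp; ring
      have b1 : t ^ 4 / 2 * ro r t y ≤ t ^ 2 / 4 := by
        calc _ ≤ t ^ 4 / 2 * (1 / (2 * t ^ 2)) := by gcongr
          _ = _ := by field_simp; norm_num
      have b2 : y ^ 2 * t ^ 4 / Sv r t y ≤ 3 / 2 * r ^ 4 := by rw [div_le_iff₀ hS]; exact a2
      have b3 : (r ^ 4 - y ^ 2) ^ 2 / Sv r t y * (y ^ 2 * t ^ 4 / Sv r t y) ≤ (r ^ 4 - y ^ 2) ^ 2 / Sv r t y * (3 / 2 * r ^ 4) := by gcongr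
      have b4 : y ^ 2 * (t ^ 4 / Sv r t y) ^ 2 ≤ t ^ 2 / 4 + 3 / 2 * r ^ 4 * (ro r t y * (r ^ 4 - y ^ 2)) + (-(t ^ 4 / 2)) * (1 * ro r t y + y * ro' r t y) := by
        rw [CP.roV]; linarith only [e, b1, b3]
      have := mul_le_mul_of_nonneg_right b4 (sq_nonneg ‖w y‖)
      linarith only [this])
  have I4 := int_le2 h11 (F := fun y => ‖w y‖ ^ 2) (G := fun y => (ro r t y * (r ^ 4 - y ^ 2)) * ‖w y‖ ^ 2)
    (H := fun y => y ^ 2 * (t ^ 4 / Sv r t y) ^ 2 * ‖w y‖ ^ 2) (α := 8) (β := 8 / r ^ 4) kont kont kont (by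
      intro y _
      have hS := h.Spos y
      have key : 1 ≤ 8 * (ro r t y * (r ^ 4 - y ^ 2)) + 8 / r ^ 4 * (y ^ 2 * (t ^ 4 / Sv r t y) ^ 2) := by
        have os := h.one_sub y
        have r4 := pow_pos hr 4
        rcases le_or_gt (1 / 8) (ro r t y * (r ^ 4 - y ^ 2)) with hc | hc
        · have : 0 ≤ 8 / r ^ 4 * (y ^ 2 * (t ^ 4 / Sv r t y) ^ 2) := by positivity
          linarith only [this, hc]
        · have g1 : 7 / 8 ≤ t ^ 4 / Sv r t y := by linarith only [os, hc]
          have g2 : 49 / 64 ≤ (t ^ 4 / Sv r t y) ^ 2 := by nlinarith only [g1]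
          have g3 : (r ^ 4 - y ^ 2) ^ 2 ≤ (t ^ 2) ^ 2 := by
            rw [le_div_iff₀ hS] at g1
            unfold Sv at g1
            nlinarith only [g1, pow_pos ht 4]
          have g4 := abs_le_of_sq_le_sq g3 (by positivity)
          have g5 := (abs_le.1 g4).2
          have g6 := h.t2_le'
          have g7 : r ^ 4 / 2 ≤ y ^ 2 := by nlinarith only [g5, g6, r4]
          have g8 : 0 ≤ ro r t y * (r ^ 4 - y ^ 2) := by rw [CP.roV]; positivity
          have : 8 / r ^ 4 * (r ^ 4 / 2 * (49 / 64)) ≤ 8 / r ^ 4 * (y ^ 2 * (t ^ 4 / Sv r t y) ^ 2) := by gcongr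
          have e : 8 / r ^ 4 * (r ^ 4 / 2 * (49 / 64)) = 49 / 16 := by field_simp; norm_num
          linarith only [this, e, g8]
      have := mul_le_mul_of_nonneg_right key (sq_nonneg ‖w y‖)
      linarith only [this])
  have I2' := (abs_le.1 I2).2
  have r4 := pow_pos hr 4
  have t4 := pow_pos ht 4
  -- combine
  have J1 : - (t ^ 4 / 2) * (∫ y in (-1:ℝ)..1, (1 * ro r t y + y * ro' r t y) * ‖w y‖ ^ 2) ≤ 5 / 4 * (δ / t) * W * r ^ 4 := by
    have z : (∫ y in (-1:ℝ)..1, (1 * ro r t y + y * ro' r t y) * ‖w y‖ ^ 2) = - ∫ y in (-1:ℝ)..1, (y * ro r t y) * (2 * inner ℝ (w y) (w' y)) := by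
      linarith only [I1]
    rw [z]
    calc _ = t ^ 4 / 2 * (∫ y in (-1:ℝ)..1, (y * ro r t y) * (2 * inner ℝ (w y) (w' y))) := by ring
      _ ≤ t ^ 4 / 2 * (5 / 2 * (Θ / t) * W * (r ^ 4 / t ^ 4)) := by gcongr
      _ ≤ t ^ 4 / 2 * (5 / 2 * (δ / t) * W * (r ^ 4 / t ^ 4)) := by gcongr
      _ = _ := by field_simp; ring
  set Xi := ∫ y in (-1:ℝ)..1, (ro r t y * (r ^ 4 - y ^ 2)) * ‖w y‖ ^ 2
  set Yi := ∫ y in (-1:ℝ)..1, y ^ 2 * (t ^ 4 / Sv r t y) ^ 2 * ‖w y‖ ^ 2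
  have J2 : Yi / r ^ 4 ≤ 1 / 100 * Ω + 3 / 2 * Xi + 5 / 4 * (δ / t) * W := by
    rw [div_le_iff₀ r4]
    have g6 := h.t2_le'
    have := mul_le_mul_of_nonneg_right g6 Ω0
    have := mul_nonneg r4.le Ω0
    nlinarith only [I3, J1, this, g6, mul_le_mul_of_nonneg_right g6 Ω0]
  have J3 : Ω ≤ 8 * Xi + 8 * (Yi / r ^ 4) := by
    have : 8 / r ^ 4 * Yi = 8 * (Yi / r ^ 4) := by ring
    linarith only [I4, this]
  set z := δ / t with hz
  have z0 : 0 < z := div_pos h.d0 ht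
  have J4 : Ω * (92 / 100) ≤ 261120 * z ^ 2 + 130 * z * W := by
    have : 0 ≤ z * W := by positivity
    linarith only [J3, J2, X, this]
  rw [← hW] at J4 ⊢
  by_contra hc
  push Not at hc
  have hc' : 1100 * z < W := lt_of_pow_lt_pow_left₀ 2 hW0 hc
  have h5 := mul_pos z0 (sub_pos.2 hc')
  nlinarith only [J4, hc, h5, z0, hc', mul_pos (sub_pos.2 hc') (sub_pos.2 hc')]

theorem L4 (S : Sys n k (r ^ 4) Θ w w' f f') (h : CP r t δ) (hn : n = t ^ 3 / r ^ 2) (hΘ : Θ ≤ δ) :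
    (∫ y in (-1:ℝ)..1, (‖f' y‖ ^ 2 + k ^ 2 * ‖f y‖ ^ 2)) - 2 * (∫ y in (-1:ℝ)..1, ro r t y * ‖f y‖ ^ 2) ≤ 3 * δ := by
  have h11 : (-1:ℝ) ≤ 1 := by norm_num
  have cw := S.cW
  have cf := S.cF
  have cf' := S.cf
  have cS := @CP.cS r t
  have cro := h.cro
  have cro' := h.cro'
  have hr := h.r0
  have ht := h.t0
  have n0 := S.hn
  have Θ0 := S.hΘ
  have d0 := h.d0
  have nz : ∀ y, Sv r t y ≠ 0 := fun y => (h.Spos y).ne'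
  have ct : Continuous (fun y => t ^ 4 / Sv r t y) := Continuous.div kont cS nz
  have c3 : Continuous (fun y => ‖f y‖ ^ 2 / Sv r t y) := Continuous.div kont cS nz
  have L2 := S.L2 h hn hΘ
  have L3 := S.L3 h hn hΘ
  have A := S.P1 (-1) 1 2 f f' le_rfl h11 le_rfl (fun y _ => S.df y) kont S.f0 S.f1 (by norm_num) (by
    have := S.M2; linarith only [this])
  have B := S.P2 (-1) 1 (198 * r ^ 2 * δ / t ^ 3) (fun y => ro r t y • f y) (fun y => ro r t y • f' y + ro' r t y • f y)
    le_rfl h11 le_rfl (fun y _ => (h.dro y).smul (S.df y)) kont (by simp [S.f0]) (by simp [S.f1]) (by positivity) (by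
      have := int_le2 h11 (F := fun y => ‖ro r t y • f' y + ro' r t y • f y‖ ^ 2 + k ^ 2 * ‖ro r t y • f y‖ ^ 2)
        (G := fun y => ‖f' y‖ ^ 2 + k ^ 2 * ‖f y‖ ^ 2) (H := fun y => ‖f y‖ ^ 2 / Sv r t y) (α := 1 / (2 * t ^ 4)) (β := 12 * r ^ 4 / t ^ 4)
        kont kont c3.continuousOn (by
          intro y _
          rw [norm_rsmul_sq]
          have q1 := norm_comb_sq (ro r t y) (ro' r t y) (f' y) (f y)
          have q2 := h.ro_sq1 y
          have q3 := h.ro'_sq y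
          have q4 := mul_le_mul_of_nonneg_right q2 (show 0 ≤ 2 * ‖f' y‖ ^ 2 + k ^ 2 * ‖f y‖ ^ 2 by positivity)
          have q5 := mul_le_mul_of_nonneg_right q3 (show 0 ≤ 2 * ‖f y‖ ^ 2 by positivity)
          have e1 : 6 * r ^ 4 / t ^ 4 * (1 / Sv r t y) * (2 * ‖f y‖ ^ 2) = 12 * r ^ 4 / t ^ 4 * (‖f y‖ ^ 2 / Sv r t y) := by ring
          have e2 : 1 / (4 * t ^ 4) * (2 * ‖f' y‖ ^ 2 + k ^ 2 * ‖f y‖ ^ 2) = 1 / (2 * t ^ 4) * (‖f' y‖ ^ 2 + k ^ 2 * ‖f y‖ ^ 2) - 1 / (4 * t ^ 4) * (k ^ 2 * ‖f y‖ ^ 2) := by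
            field_simp; ring
          have e3 : 0 ≤ 1 / (4 * t ^ 4) * (k ^ 2 * ‖f y‖ ^ 2) := by positivity
          linarith only [q1, q4, q5, e1, e2, e3])
      refine this.trans ?_
      have M := S.M2
      have i1 : 1 / (2 * t ^ 4) * (∫ y in (-1:ℝ)..1, (‖f' y‖ ^ 2 + k ^ 2 * ‖f y‖ ^ 2)) ≤ 1 / (2 * t ^ 4) * 4 := by gcongr
      have i2 : 12 * r ^ 4 / t ^ 4 * (∫ y in (-1:ℝ)..1, ‖f y‖ ^ 2 / Sv r t y) ≤ 12 * r ^ 4 / t ^ 4 * (3264 * δ ^ 2 / t ^ 2) := by gcongr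
      have i3 : 1 / (2 * t ^ 4) * 4 ≤ 2 * (δ ^ 2 * r ^ 4 / t ^ 6) := by
        calc 1 / (2 * t ^ 4) * 4 = 2 * (t ^ 2 / t ^ 6) := by field_simp; norm_num
          _ ≤ _ := by have := h.t2_le; gcongr
      have i4 : 12 * r ^ 4 / t ^ 4 * (3264 * δ ^ 2 / t ^ 2) = 39168 * (δ ^ 2 * r ^ 4 / t ^ 6) := by field_simp; norm_num
      have i5 : (198 * r ^ 2 * δ / t ^ 3) ^ 2 = 39204 * (δ ^ 2 * r ^ 4 / t ^ 6) := by field_simp; norm_num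
      have i6 : 0 ≤ δ ^ 2 * r ^ 4 / t ^ 6 := by positivity
      linarith only [i1, i2, i3, i4, i5, i6])
  have eB : Θ * n * (198 * r ^ 2 * δ / t ^ 3) ≤ 198 * δ ^ 2 := by
    have : Θ * n * (198 * r ^ 2 * δ / t ^ 3) = 198 * δ * Θ := by rw [hn]; field_simp
    rw [this]; nlinarith only [hΘ, d0]
  have D := cs_dom h11 (F := fun y => (t ^ 4 / Sv r t y) * inner ℝ (w y) (f y)) (A := fun y => ‖w y‖)
    (B := fun y => t ^ 2 * √(‖f y‖ ^ 2 / Sv r t y)) (α := 1100 * (δ / t)) (β := t ^ 2 * (58 * (δ / t))) kont kont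
    (Continuous.continuousOn (continuous_const.mul c3.sqrt)) (by positivity) (by positivity) (by
      intro y _
      have hS := h.Spos y
      have hS4 := h.S_ge y
      have q := abs_real_inner_le_norm (w y) (f y)
      rw [abs_mul, abs_of_nonneg (by positivity)]
      have : t ^ 4 / Sv r t y * ‖f y‖ ≤ t ^ 2 * √(‖f y‖ ^ 2 / Sv r t y) := by
        apply le_of_sq_le_sq _ (by positivity)
        rw [mul_pow (t ^ 2), sq_sqrt (by positivity)]
        calc (t ^ 4 / Sv r t y * ‖f y‖) ^ 2 = t ^ 4 * (‖f y‖ ^ 2 / Sv r t y) * (t ^ 4 / Sv r t y) := by field_simp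
          _ ≤ t ^ 4 * (‖f y‖ ^ 2 / Sv r t y) * 1 := by
            gcongr; rw [div_le_one hS]; exact hS4
          _ = _ := by ring
      calc t ^ 4 / Sv r t y * |inner ℝ (w y) (f y)| ≤ t ^ 4 / Sv r t y * (‖w y‖ * ‖f y‖) := by gcongr
        _ = ‖w y‖ * (t ^ 4 / Sv r t y * ‖f y‖) := by ring
        _ ≤ _ := by gcongr) L3 (by
      rw [int_cg h11 (G := fun y => t ^ 4 * (‖f y‖ ^ 2 / Sv r t y)) (fun y _ => by
        have hS := h.Spos y
        rw [mul_pow, sq_sqrt (by positivity)]; ring), icm]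
      calc t ^ 4 * (∫ y in (-1:ℝ)..1, ‖f y‖ ^ 2 / Sv r t y) ≤ t ^ 4 * (3364 * δ ^ 2 / t ^ 2) := by
            gcongr; exact L2.trans (by gcongr; norm_num)
        _ = _ := by field_simp; norm_num)
  have eD : 1100 * (δ / t) * (t ^ 2 * (58 * (δ / t))) = 63800 * δ ^ 2 := by field_simp; norm_num
  have comb := int_le4 h11 (F := fun y => ‖f' y‖ ^ 2 + k ^ 2 * ‖f y‖ ^ 2)
    (G := fun y => inner ℝ (w y) (f y) + inner ℝ (f' y) (f' y) + k ^ 2 * inner ℝ (f y) (f y))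
    (H := fun y => (r ^ 4 - y ^ 2) * inner ℝ (w y) (ro r t y • f y) + 2 * inner ℝ (f y) (ro r t y • f y))
    (K := fun y => (t ^ 4 / Sv r t y) * inner ℝ (w y) (f y)) (J := fun y => ro r t y * ‖f y‖ ^ 2) (α := 1) (β := -1) (γ := -1) (θ := 2)
    kont kont kont kont kont (by
      intro y _
      rw [← h.one_sub y]
      simp only [inner_smul_right, real_inner_self_eq_norm_sq]
      apply le_of_eq; ring)
  have A' := (abs_le.1 A).2
  have B' := (abs_le.1 B).1
  have D' := (abs_le.1 D).1
  rw [eD] at D'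
  have : 64000 * δ ^ 2 ≤ δ := by nlinarith only [h.d1, d0]
  have : 0 ≤ δ ^ 2 := sq_nonneg _
  linarith

end Sys

def Pv (r t y : ℝ) : ℝ := r ^ 4 + t ^ 4 / r ^ 4 - y ^ 2
def gg (r : ℝ) (f : ℝ → ℂ) (y : ℝ) : ℂ := f y - (y / r ^ 2) • f (r ^ 2)
def gg' (r : ℝ) (f f' : ℝ → ℂ) (y : ℝ) : ℂ := f' y - (1 / r ^ 2) • f (r ^ 2)
def ZZ (r t : ℝ) (f f' : ℝ → ℂ) (y : ℝ) : ℂ := gg' r f f' y - (-2 * y / Pv r t y) • gg r f y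

namespace CP
variable {r t δ : ℝ}

theorem Ppos (h : CP r t δ) {y : ℝ} (h0 : 0 ≤ y) (h1 : y ≤ r ^ 2) : 0 < Pv r t y := by
  have := pow_pos h.t0 4; have := pow_pos h.r0 4
  have : 0 < t ^ 4 / r ^ 4 := by positivity
  unfold Pv
  nlinarith only [this, h0, h1]

theorem dP (y : ℝ) : HasDerivAt (Pv r t) (-2 * y) y := by
  unfold Pv
  exact ((hasDerivAt_pow 2 y).const_sub _).congr_deriv (by norm_num)

theorem ro_P (h : CP r t δ) {y : ℝ} (h0 : 0 ≤ y) (h1 : y ≤ r ^ 2) : ro r t y * Pv r t y ≤ 1 := by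
  have hS := h.Spos y
  have r4 := pow_pos h.r0 4
  have t4 := pow_pos h.t0 4
  unfold ro
  rw [div_mul_eq_mul_div, div_le_one hS]
  unfold Sv Pv
  have V0 : 0 ≤ r ^ 4 - y ^ 2 := by nlinarith only [h0, h1]
  have e : (r ^ 4 - y ^ 2) * (t ^ 4 / r ^ 4) ≤ r ^ 4 * (t ^ 4 / r ^ 4) := by
    gcongr; nlinarith only [sq_nonneg y]
  rw [mul_div_cancel₀ _ r4.ne'] at e
  nlinarith only [e]

theorem ro_nn (h : CP r t δ) {y : ℝ} (h0 : 0 ≤ y) (h1 : y ≤ r ^ 2) : 0 ≤ ro r t y := by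
  have hS := h.Spos y
  have V0 : 0 ≤ r ^ 4 - y ^ 2 := by nlinarith only [h0, h1]
  unfold ro; positivity

theorem ro_np (h : CP r t δ) {y : ℝ} (h1 : r ^ 2 ≤ y) : ro r t y ≤ 0 := by
  have hS := h.Spos y
  have := pow_pos h.r0 2
  have V0 : r ^ 4 - y ^ 2 ≤ 0 := by nlinarith only [this, h1]
  unfold ro; exact div_nonpos_of_nonpos_of_nonneg V0 hS.le

end CP

namespace Sys
variable {n k Θ r t δ : ℝ} {w w' f f' : ℝ → ℂ}

theorem dg (S : Sys n k (r ^ 4) Θ w w' f f') (y : ℝ) : HasDerivAt (gg r f) (gg' r f f' y) y := by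
  unfold gg gg'
  exact (S.df y).sub (((hasDerivAt_id y).div_const _).smul_const _)

theorem cg' (S : Sys n k (r ^ 4) Θ w w' f f') : Continuous (gg' r f f') := by
  have := S.cf
  unfold gg'; fun_prop

theorem cg (S : Sys n k (r ^ 4) Θ w w' f f') : Continuous (gg r f) := by
  have := S.cF
  unfold gg; fun_prop

theorem ga (h : CP r t δ) : gg r f (r ^ 2) = 0 := by
  have := pow_pos h.r0 2
  unfold gg; rw [div_self this.ne', one_smul, sub_self]

theorem y1_ex (S : Sys n k (r ^ 4) Θ w w' f f') (h : CP r t δ) (L : ‖f (r ^ 2)‖ ≤ 14 * δ * r) :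
    ∃ y₁, r ^ 2 ≤ y₁ ∧ y₁ ≤ 1 ∧ y₁ ^ 2 ≤ 2 * r ^ 4 ∧
      ‖f (r ^ 2)‖ ^ 2 * (log (Sv r t 0) - log (Sv r t y₁)) ≤ 134 * δ * r ^ 2 := by
  have hr := h.r0
  have ht := h.t0
  have hr1 := h.r1
  have d0 := h.d0
  have r2 := pow_pos hr 2
  rcases le_or_gt (2 * r ^ 4) 1 with hc | hc
  · refine ⟨√2 * r ^ 2, ?_, ?_, ?_, ?_⟩
    · have : 1 ≤ √2 := by rw [Real.one_le_sqrt]; norm_num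
      nlinarith only [this, r2]
    · have : (√2 * r ^ 2) ^ 2 ≤ 1 ^ 2 := by
        rw [mul_pow, sq_sqrt (by norm_num)]; nlinarith only [hc]
      exact le_of_sq_le_sq this (by norm_num)
    · rw [mul_pow, sq_sqrt (by norm_num)]; apply le_of_eq; ring
    · have : Sv r t (√2 * r ^ 2) = Sv r t 0 := by
        unfold Sv; rw [mul_pow, sq_sqrt (by norm_num)]; ring
      rw [this, sub_self, mul_zero]; positivity
  · refine ⟨1, pow_le_one₀ hr.le hr1.le, le_rfl, by linarith only [hc], ?_⟩
    have l0 : 0 < 1 - r ^ 4 := by have := pow_pos ht 2; linarith only [h.tl, this]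
    set z := √(1 - r ^ 4) with hz
    have z2 : z ^ 2 = 1 - r ^ 4 := sq_sqrt l0.le
    have z0 : 0 < z := sqrt_pos.2 l0
    have r21 : r ^ 2 < 1 := pow_lt_one₀ hr.le hr1 two_ne_zero
    have H := holder (c := r ^ 2) (d := 1) (α := 2) (s := z) r21.le (fun y _ => S.df y) S.cf.continuousOn (by norm_num) z0.le
      (S.sub_int (by linarith only [r2]) r21.le le_rfl) (by rw [z2]; nlinarith only [r21, r2])
    rw [S.f1, zero_sub, norm_neg] at H
    have l1 : log (Sv r t 0) ≤ 1 := by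
      have h0 := h.Spos 0
      have := log_le_sub_one_of_pos h0
      have : Sv r t 0 ≤ 2 := by
        unfold Sv
        have a1 : r ^ 4 ≤ 1 := pow_le_one₀ hr.le hr1.le
        have a2 : t ^ 2 ≤ 1 := by linarith only [h.tl, pow_pos hr 4]
        nlinarith only [a1, a2, pow_pos hr 4, pow_pos ht 2]
      linarith
    have l2 : - log (Sv r t 1) ≤ 4 / z - 4 := by
      have : log (z ^ 4) ≤ log (Sv r t 1) := by
        apply log_le_log (by positivity)
        unfold Sv
        have : z ^ 4 = (1 - r ^ 4) ^ 2 := by rw [← z2]; ring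
        rw [this]; nlinarith only [pow_pos ht 4]
      rw [log_pow] at this
      have e := log_le_sub_one_of_pos (show 0 < 1 / z by positivity)
      rw [one_div, log_inv] at e
      push_cast at this
      rw [div_eq_mul_inv]
      linarith only [this, e]
    have zi : 0 < 4 / z := by positivity
    have : log (Sv r t 0) - log (Sv r t 1) ≤ 4 / z := by linarith only [l1, l2]
    calc ‖f (r ^ 2)‖ ^ 2 * (log (Sv r t 0) - log (Sv r t 1)) ≤ ‖f (r ^ 2)‖ ^ 2 * (4 / z) := by gcongr
      _ = ‖f (r ^ 2)‖ * ‖f (r ^ 2)‖ * (4 / z) := by ring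
      _ ≤ (14 * δ * r) * (2 * z) * (4 / z) := by gcongr
      _ = 112 * δ * r := by field_simp; ring
      _ ≤ 134 * δ * r ^ 2 := by
        have : 112 / 134 ≤ r := by
          by_contra hh
          push Not at hh
          have := pow_lt_pow_left₀ hh hr.le (n := 4) (by norm_num)
          norm_num at this
          linarith
        have : 112 * r ≤ 134 * r ^ 2 := by nlinarith only [this, hr]
        nlinarith only [this, d0]

theorem L5 (S : Sys n k (r ^ 4) Θ w w' f f') (h : CP r t δ) (L : ‖f (r ^ 2)‖ ≤ 14 * δ * r) :
    (∫ y in (r ^ 2)..1, ‖f' y‖ ^ 2) + (∫ y in (0:ℝ)..(r ^ 2), ‖ZZ r t f f' y‖ ^ 2) ≤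
     (∫ y in (0:ℝ)..1, ‖f' y‖ ^ 2) - 2 * (∫ y in (0:ℝ)..1, ro r t y * ‖f y‖ ^ 2) + 1600 * δ := by
  obtain ⟨y₁, h1, h2, h3, h4⟩ := S.y1_ex h L
  have hr := h.r0
  have ht := h.t0
  have hr1 := h.r1
  have d0 := h.d0
  have d1 := h.d1
  have r2 := pow_pos hr 2
  have cf := S.cF
  have cf' := S.cf
  have cg := S.cg
  have cg' := S.cg'
  have cS := @CP.cS r t
  have cro := h.cro
  have nz : ∀ y, Sv r t y ≠ 0 := fun y => (h.Spos y).ne'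
  have r21 : r ^ 2 < 1 := pow_lt_one₀ hr.le hr1 two_ne_zero
  have y10 : 0 ≤ y₁ := r2.le.trans h1
  have cgS : Continuous (fun y => ‖gg r f y‖ ^ 2 / Sv r t y) := Continuous.div kont cS nz
  have y1r : y₁ ≤ 3 / 2 * r ^ 2 := by
    apply le_of_sq_le_sq _ (by positivity)
    nlinarith only [h3, pow_pos hr 4]
  set e := f (r ^ 2) with he
  -- split of ∫ ρ‖f‖²
  have a0 : (∫ y in y₁..1, ro r t y * ‖f y‖ ^ 2) ≤ 0 := by
    have := int_le1 h2 (F := fun y => ro r t y * ‖f y‖ ^ 2) (G := fun _ => 1) (α := 0) kont kont (by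
      intro y hy
      have := h.ro_np (h1.trans hy.1)
      rw [zero_mul]; exact mul_nonpos_of_nonpos_of_nonneg this (by positivity))
    simpa using this
  have a1 : (∫ y in (r ^ 2)..y₁, ro r t y * ‖gg r f y‖ ^ 2) ≤ 0 := by
    have := int_le1 h1 (F := fun y => ro r t y * ‖gg r f y‖ ^ 2) (G := fun _ => 1) (α := 0) kont kont (by
      intro y hy
      have := h.ro_np hy.1
      rw [zero_mul]; exact mul_nonpos_of_nonpos_of_nonneg this (by positivity))
    simpa using this
  have s1 := int_split y10 h2 (F := fun y => ro r t y * ‖f y‖ ^ 2) kont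
  have s2 := int_split r2.le h1 (F := fun y => ro r t y * ‖gg r f y‖ ^ 2) kont
  have s3 := int_split r2.le r21.le (F := fun y => ‖f' y‖ ^ 2) kont
  -- main pointwise on [0,y₁]
  have I1 := int_le4 y10 (F := fun y => ro r t y * ‖f y‖ ^ 2) (G := fun y => ro r t y * ‖gg r f y‖ ^ 2)
    (H := fun y => ‖gg r f y‖ ^ 2 / Sv r t y) (K := fun _ => (1:ℝ)) (J := fun y => y * ro r t y)
    (α := 1) (β := 3 * δ * r ^ 4) (γ := 147 * δ / r ^ 2) (θ := ‖e‖ ^ 2 / r ^ 2)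
    kont kont cgS.continuousOn kont kont (by
      intro y hy
      have hS := h.Spos y
      have y0 : 0 ≤ y := hy.1
      have e1 : f y = gg r f y + (y / r ^ 2) • e := by unfold gg; rw [sub_add_cancel]
      have e2 : ‖f y‖ ^ 2 = ‖gg r f y‖ ^ 2 + 2 * (y / r ^ 2) * inner ℝ (gg r f y) e + (y / r ^ 2) ^ 2 * ‖e‖ ^ 2 := by
        rw [e1, norm_add_sq_real, norm_rsmul_sq, inner_smul_right]; ring
      have b1 : ro r t y * (y / r ^ 2) ^ 2 ≤ y * ro r t y / r ^ 2 := by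
        have q : 0 ≤ ro r t y * (r ^ 4 - y ^ 2) := by rw [CP.roV]; positivity
        have q2 : ro r t y * (r ^ 4 - y ^ 2) = ro r t y * (r ^ 2 - y) * (r ^ 2 + y) := by ring
        have q3 : 0 ≤ ro r t y * (r ^ 2 - y) := by
          rw [q2] at q
          exact nonneg_of_mul_nonneg_left q (by positivity)
        have q4 : y * ro r t y / r ^ 2 - ro r t y * (y / r ^ 2) ^ 2 = y * (ro r t y * (r ^ 2 - y)) / r ^ 4 := by field_simp
        have : 0 ≤ y * (ro r t y * (r ^ 2 - y)) / r ^ 4 := by positivity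
        linarith only [q4, this]
      have b2 := mul_le_mul_of_nonneg_right b1 (sq_nonneg ‖e‖)
      have b3 : ro r t y * (2 * (y / r ^ 2) * inner ℝ (gg r f y) e) ≤ 3 * δ * r ^ 4 * (‖gg r f y‖ ^ 2 / Sv r t y) + 147 * δ / r ^ 2 := by
        have c1 : y / r ^ 2 ≤ 3 / 2 := by rw [div_le_iff₀ r2]; exact hy.2.trans y1r
        have c2 := abs_real_inner_le_norm (gg r f y) e
        have c3 : |ro r t y| * ‖gg r f y‖ ≤ 1 / 2 * (r ^ 3 / 7 * (‖gg r f y‖ ^ 2 / Sv r t y) + 7 / r ^ 3) := by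
          have c4 := mul_le_mul_of_nonneg_right (h.ro_sq y) (sq_nonneg ‖gg r f y‖)
          have c5 : 0 ≤ (r ^ 3 / 7) * (|ro r t y| * ‖gg r f y‖ - 7 / r ^ 3) ^ 2 := by positivity
          have c6 : (r ^ 3 / 7) * (|ro r t y| * ‖gg r f y‖ - 7 / r ^ 3) ^ 2 = r ^ 3 / 7 * (ro r t y ^ 2 * ‖gg r f y‖ ^ 2) + 7 / r ^ 3 - 2 * (|ro r t y| * ‖gg r f y‖) := by
            rw [← sq_abs (ro r t y)]; field_simp; ring
          have c7 : r ^ 3 / 7 * (ro r t y ^ 2 * ‖gg r f y‖ ^ 2) ≤ r ^ 3 / 7 * (‖gg r f y‖ ^ 2 / Sv r t y) := by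
            gcongr; rw [one_div, inv_mul_eq_div] at c4; exact c4
          linarith only [c5, c6, c7]
        calc ro r t y * (2 * (y / r ^ 2) * inner ℝ (gg r f y) e) ≤ |ro r t y * (2 * (y / r ^ 2) * inner ℝ (gg r f y) e)| := le_abs_self _
          _ = |ro r t y| * (2 * (y / r ^ 2) * |inner ℝ (gg r f y) e|) := by
            rw [abs_mul, abs_mul, abs_of_nonneg (show 0 ≤ 2 * (y / r ^ 2) by positivity)]
          _ ≤ |ro r t y| * (2 * (3 / 2) * (‖gg r f y‖ * (14 * δ * r))) := by
            gcongr; exact c2.trans (by gcongr)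
          _ = 42 * δ * r * (|ro r t y| * ‖gg r f y‖) := by ring
          _ ≤ 42 * δ * r * (1 / 2 * (r ^ 3 / 7 * (‖gg r f y‖ ^ 2 / Sv r t y) + 7 / r ^ 3)) := by gcongr
          _ = _ := by field_simp; ring
      rw [e2]
      have : ‖e‖ ^ 2 / r ^ 2 * (y * ro r t y) = y * ro r t y / r ^ 2 * ‖e‖ ^ 2 := by ring
      linarith only [b2, b3, this])
  -- bounds
  have I2 : (∫ y in (0:ℝ)..y₁, y * ro r t y) = (log (Sv r t 0) - log (Sv r t y₁)) / 4 := by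
    rw [ftc y10 (G := fun y => - (log (Sv r t y) / 4)) (fun y _ => by
      have := (((CP.dS (r := r) (t := t) y).log (nz y)).div_const 4).neg
      refine this.congr_deriv ?_
      unfold ro; ring) kont]
    ring
  have I3 := h.hS_half h1 (g := gg r f) (g' := gg' r f f') S.dg cg' (ga h)
  have eb : ‖(1 / r ^ 2) • e‖ ^ 2 ≤ 196 * δ ^ 2 / r ^ 2 := by
    rw [norm_rsmul_sq]
    calc (1 / r ^ 2) ^ 2 * ‖e‖ ^ 2 ≤ (1 / r ^ 2) ^ 2 * (14 * δ * r) ^ 2 := by gcongr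
      _ = _ := by field_simp; ring
  have dd : δ ^ 2 ≤ δ / 10 ^ 12 := by nlinarith only [d1, d0]
  have I4 : (∫ y in (0:ℝ)..y₁, ‖gg' r f f' y‖ ^ 2) ≤ 9 := by
    have := int_le2 y10 (F := fun y => ‖gg' r f f' y‖ ^ 2) (G := fun y => ‖f' y‖ ^ 2) (H := fun _ => (1:ℝ)) (α := 2) (β := 2 * (196 * δ ^ 2 / r ^ 2))
      kont kont kont (by
        intro y _
        have := norm_add_sq_le2 (f' y) (-((1 / r ^ 2) • e))
        rw [norm_neg, ← sub_eq_add_neg] at this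
        change ‖f' y - (1 / r ^ 2) • e‖ ^ 2 ≤ _
        linarith only [this, eb])
    have q := S.sub_int (c := 0) (d := y₁) (by norm_num) y10 h2
    rw [intervalIntegral.integral_const, smul_eq_mul, mul_one, sub_zero] at this
    have : 2 * (196 * δ ^ 2 / r ^ 2) * y₁ ≤ 2 * (196 * δ ^ 2 / r ^ 2) * (3 / 2 * r ^ 2) := by gcongr
    have : 2 * (196 * δ ^ 2 / r ^ 2) * (3 / 2 * r ^ 2) = 588 * δ ^ 2 := by field_simp; ring
    linarith
  rw [intervalIntegral.integral_const, smul_eq_mul, mul_one, sub_zero, I2] at I1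
  have B1 : 3 * δ * r ^ 4 * (∫ y in (0:ℝ)..y₁, ‖gg r f y‖ ^ 2 / Sv r t y) ≤ 216 * δ := by
    calc _ ≤ 3 * δ * r ^ 4 * (8 / r ^ 4 * 9) := by
          gcongr; exact I3.trans (by gcongr)
      _ = _ := by field_simp; ring
  have B2 : 147 * δ / r ^ 2 * y₁ ≤ 221 * δ := by
    calc _ ≤ 147 * δ / r ^ 2 * (3 / 2 * r ^ 2) := by gcongr
      _ = 147 * 3 / 2 * δ := by field_simp
      _ ≤ _ := by linarith only [d0]
  have B3 : ‖e‖ ^ 2 / r ^ 2 * ((log (Sv r t 0) - log (Sv r t y₁)) / 4) ≤ 34 * δ := by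
    have := div_le_div_of_nonneg_right h4 (show 0 ≤ 4 * r ^ 2 by positivity)
    calc _ = ‖e‖ ^ 2 * (log (Sv r t 0) - log (Sv r t y₁)) / (4 * r ^ 2) := by ring
      _ ≤ _ := this
      _ = 134 / 4 * δ := by field_simp
      _ ≤ _ := by linarith only [d0]
  -- g' vs f'
  have I5 := int_le3 r2.le (F := fun y => ‖gg' r f f' y‖ ^ 2) (G := fun y => ‖f' y‖ ^ 2) (H := fun y => ‖f' y‖ ^ 2) (K := fun _ => (1:ℝ))
    (α := 1) (β := 14 * δ) (γ := 14 * δ / r ^ 2 + 196 * δ ^ 2 / r ^ 2) kont kont kont kont (by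
      intro y _
      change ‖f' y - (1 / r ^ 2) • e‖ ^ 2 ≤ _
      rw [norm_sub_sq_real, inner_smul_right]
      have c2 := (abs_le.1 (abs_real_inner_le_norm (f' y) e)).1
      have c3 : -2 * (1 / r ^ 2 * inner ℝ (f' y) e) ≤ 14 * δ * ‖f' y‖ ^ 2 + 14 * δ / r ^ 2 := by
        have u : -2 * (1 / r ^ 2 * inner ℝ (f' y) e) ≤ 2 * (1 / r ^ 2 * (‖f' y‖ * (14 * δ * r))) := by
          have : - inner ℝ (f' y) e ≤ ‖f' y‖ * (14 * δ * r) := by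
            have : ‖f' y‖ * ‖e‖ ≤ ‖f' y‖ * (14 * δ * r) := by gcongr
            linarith only [this, c2]
          have := mul_le_mul_of_nonneg_left this (show 0 ≤ 2 * (1 / r ^ 2) by positivity)
          linarith only [this]
        have v : 14 * δ * ‖f' y‖ ^ 2 + 14 * δ / r ^ 2 - 2 * (1 / r ^ 2 * (‖f' y‖ * (14 * δ * r))) = 14 * δ * (‖f' y‖ - 1 / r) ^ 2 := by
          field_simp; ring
        have : 0 ≤ 14 * δ * (‖f' y‖ - 1 / r) ^ 2 := by positivity
        linarith only [u, v, this]
      linarith only [c3, eb])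
  rw [intervalIntegral.integral_const, smul_eq_mul, mul_one, sub_zero] at I5
  have B4 : (14 * δ / r ^ 2 + 196 * δ ^ 2 / r ^ 2) * r ^ 2 = 14 * δ + 196 * δ ^ 2 := by field_simp
  have B5 := S.sub_int (c := 0) (d := r ^ 2) (by norm_num) r2.le r21.le
  have B6 : 14 * δ * (∫ y in (0:ℝ)..(r ^ 2), ‖f' y‖ ^ 2) ≤ 14 * δ * 2 ^ 2 := by gcongr
  -- qid
  have Pnz : ∀ y ∈ Icc 0 (r ^ 2), Pv r t y ≠ 0 := fun y hy => (h.Ppos hy.1 hy.2).ne'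
  have cP : Continuous (Pv r t) := by unfold Pv; fun_prop
  have cq : ContinuousOn (fun y => (-2 * Pv r t y - -2 * y * (-2 * y)) / Pv r t y ^ 2) (Icc 0 (r ^ 2)) :=
    ContinuousOn.div kont kont (fun y hy => pow_ne_zero 2 (Pnz y hy))
  have Q := qid r2.le (g := gg r f) (g' := gg' r f f') (q := fun y => -2 * y / Pv r t y)
    (q' := fun y => (-2 * Pv r t y - -2 * y * (-2 * y)) / Pv r t y ^ 2) (fun y _ => S.dg y)
    (fun y hy => ((((hasDerivAt_id y).const_mul (-2)).congr_deriv (by norm_num)).div (CP.dP y) (Pnz y hy))) cg'.continuousOn cq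
  rw [ga h] at Q
  simp only [norm_zero, mul_zero, zero_div, zero_mul, zero_pow two_ne_zero, sub_zero] at Q
  have cq1 : ContinuousOn (fun y => (-2 * y) / Pv r t y) (Icc 0 (r ^ 2)) :=
    ContinuousOn.div kont kont Pnz
  have Q2 := int_le2 r2.le (F := fun y => (‖gg' r f f' y‖ ^ 2 + ((-2 * Pv r t y - -2 * y * (-2 * y)) / Pv r t y ^ 2 + (-2 * y / Pv r t y) ^ 2) * ‖gg r f y‖ ^ 2))
    (G := fun y => ‖gg' r f f' y‖ ^ 2) (H := fun y => ro r t y * ‖gg r f y‖ ^ 2) (α := 1) (β := -2) kont kont kont (by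
      intro y hy
      have hp := h.Ppos hy.1 hy.2
      have e1 : (-2 * Pv r t y - -2 * y * (-2 * y)) / Pv r t y ^ 2 + (-2 * y / Pv r t y) ^ 2 = -2 / Pv r t y := by field_simp; ring
      have e2 : ro r t y ≤ 1 / Pv r t y := by rw [le_div_iff₀ hp]; exact h.ro_P hy.1 hy.2
      have e3 := mul_le_mul_of_nonneg_right e2 (sq_nonneg ‖gg r f y‖)
      have e4 : -2 / Pv r t y = -2 * (1 / Pv r t y) := by ring
      rw [e1, e4]; linarith only [e3])
  rw [← Q] at Q2
  have Q3 : (∫ y in (0:ℝ)..(r ^ 2), ‖ZZ r t f f' y‖ ^ 2) = ∫ y in (0:ℝ)..(r ^ 2), ‖gg' r f f' y - (-2 * y / Pv r t y) • gg r f y‖ ^ 2 := rfl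
  linarith only [Q2, Q3, I5, B4, B6, dd, d0, B1, B2, B3, I1, s1, s2, s3, a0, a1]

end Sys

def Tv (r y : ℝ) : ℝ := y / r ^ 2 * (1 - (r ^ 4 - y ^ 2) ^ 2 / r ^ 8)
def Tv' (r y : ℝ) : ℝ := 1 / r ^ 2 * (1 - (r ^ 4 - y ^ 2) ^ 2 / r ^ 8) + y / r ^ 2 * (4 * y * (r ^ 4 - y ^ 2) / r ^ 8)

/-- data for the interval `[0, √2 a]` -/
structure DD (r d : ℝ) : Prop where
  d0 : 0 < d
  d2 : d ^ 2 = 2 * r ^ 4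
  d1 : d ≤ 1

namespace DD
variable {r t δ d : ℝ}

theorem le (D : DD r d) (h : CP r t δ) : r ^ 2 ≤ d ∧ d ≤ 3 / 2 * r ^ 2 := by
  have hr := h.r0
  have := D.d2
  have := pow_pos hr 4
  constructor
  · apply le_of_sq_le_sq _ D.d0.le
    linarith
  · apply le_of_sq_le_sq _ (by positivity)
    linarith

theorem dT (h : CP r t δ) (y : ℝ) : HasDerivAt (Tv r) (Tv' r y) y := by
  have h1 : HasDerivAt (fun y : ℝ => r ^ 4 - y ^ 2) (-(2 * y)) y :=
    ((hasDerivAt_pow 2 y).const_sub (r ^ 4)).congr_deriv (by norm_num)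
  have h2 := ((h1.pow 2).div_const (r ^ 8)).const_sub 1
  have h3 := ((hasDerivAt_id y).div_const (r ^ 2)).mul h2
  unfold Tv
  refine h3.congr_deriv ?_
  unfold Tv'
  simp only [Nat.cast_ofNat, id, Pi.pow_apply]
  ring

theorem cT : Continuous (Tv r) := by unfold Tv; fun_prop
theorem cT' : Continuous (Tv' r) := by unfold Tv'; fun_prop

theorem B (D : DD r d) (h : CP r t δ) {y : ℝ} (y0 : 0 ≤ y) (yd : y ≤ d) :
    0 ≤ 1 - (r ^ 4 - y ^ 2) ^ 2 / r ^ 8 ∧ 1 - (r ^ 4 - y ^ 2) ^ 2 / r ^ 8 ≤ 1 := by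
  have hr := h.r0
  have r4 := pow_pos hr 4
  have r8 := pow_pos hr 8
  have y2 : y ^ 2 ≤ 2 * r ^ 4 := by have := D.d2; nlinarith only [this, y0, yd]
  constructor
  · rw [sub_nonneg, div_le_one r8]
    nlinarith only [y2, sq_nonneg y]
  · have : 0 ≤ (r ^ 4 - y ^ 2) ^ 2 / r ^ 8 := by positivity
    linarith

theorem T_nn (D : DD r d) (h : CP r t δ) {y : ℝ} (y0 : 0 ≤ y) (yd : y ≤ d) : 0 ≤ Tv r y := by
  have hr := h.r0
  have := (D.B h y0 yd).1
  unfold Tv; positivity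

theorem T_le (D : DD r d) (h : CP r t δ) {y : ℝ} (y0 : 0 ≤ y) (yd : y ≤ d) : Tv r y ≤ y / r ^ 2 := by
  have hr := h.r0
  have := (D.B h y0 yd).2
  unfold Tv
  have : y / r ^ 2 * (1 - (r ^ 4 - y ^ 2) ^ 2 / r ^ 8) ≤ y / r ^ 2 * 1 := by gcongr
  linarith

theorem T_sq (D : DD r d) (h : CP r t δ) {y : ℝ} (y0 : 0 ≤ y) (yd : y ≤ d) : Tv r y ^ 2 ≤ 2 := by
  have hr := h.r0
  have := pow_le_pow_left₀ (D.T_nn h y0 yd) (D.T_le h y0 yd) 2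
  refine this.trans ?_
  rw [div_pow, div_le_iff₀ (by positivity)]
  have := D.d2
  nlinarith only [this, y0, yd]

theorem T'_abs (D : DD r d) (h : CP r t δ) {y : ℝ} (y0 : 0 ≤ y) (yd : y ≤ d) : |Tv' r y| ≤ 9 / r ^ 2 := by
  have hr := h.r0
  have r4 := pow_pos hr 4
  obtain ⟨b1, b2⟩ := D.B h y0 yd
  have y2 : y ^ 2 ≤ 2 * r ^ 4 := by have := D.d2; nlinarith only [this, y0, yd]
  have e : Tv' r y = (1 / r ^ 2) * ((1 - (r ^ 4 - y ^ 2) ^ 2 / r ^ 8) + 4 * (y ^ 2 * (r ^ 4 - y ^ 2)) / r ^ 8) := by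
    unfold Tv'; ring
  rw [e, abs_mul, abs_of_pos (by positivity)]
  have b3 : |4 * (y ^ 2 * (r ^ 4 - y ^ 2)) / r ^ 8| ≤ 8 := by
    rw [abs_div, abs_of_pos (pow_pos hr 8), div_le_iff₀ (pow_pos hr 8), abs_le]
    constructor <;> nlinarith only [y2, sq_nonneg y, mul_nonneg (sq_nonneg y) (sub_nonneg.2 y2), r4]
  have b4 := abs_add_le (1 - (r ^ 4 - y ^ 2) ^ 2 / r ^ 8) (4 * (y ^ 2 * (r ^ 4 - y ^ 2)) / r ^ 8)
  rw [abs_of_nonneg b1] at b4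
  calc 1 / r ^ 2 * _ ≤ 1 / r ^ 2 * 9 := by gcongr; linarith
    _ = _ := by ring

theorem T0 : Tv r 0 = 0 := by unfold Tv; simp

theorem Td (D : DD r d) (h : CP r t δ) : Tv r d = 0 := by
  have hr := h.r0
  unfold Tv
  rw [D.d2]
  have : (r ^ 4 - 2 * r ^ 4) ^ 2 / r ^ 8 = 1 := by field_simp; ring
  rw [this]; ring

theorem Ta (h : CP r t δ) : Tv r (r ^ 2) = 1 := by
  have hr := h.r0
  unfold Tv
  have : r ^ 4 - (r ^ 2) ^ 2 = 0 := by ring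
  rw [this]; field_simp; norm_num

end DD

namespace Sys
variable {n k Θ r t δ d s : ℝ} {w w' f f' : ℝ → ℂ}

theorem J1 (h : CP r t δ) (D : DD r d) : |∫ y in (0:ℝ)..d, ro r t y * Tv r y * (y / r ^ 2)| ≤ 3 / 2 / r ^ 2 := by
  have hr := h.r0
  have d0 := D.d0.le
  have cro := h.cro
  have cT := @DD.cT r
  have r2 := pow_pos hr 2
  have nz : ∀ y, Sv r t y ≠ 0 := fun y => (h.Spos y).ne'
  have I := ftc d0 (G := fun y => - (1 / 2) * ((1 + t ^ 4 / r ^ 8) * (log (Sv r t y) / 2) - (r ^ 4 - y ^ 2) ^ 2 / (2 * r ^ 8)))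
    (G' := fun y => ro r t y * y * (1 - (r ^ 4 - y ^ 2) ^ 2 / r ^ 8)) (fun y _ => by
      have h1 : HasDerivAt (fun y : ℝ => r ^ 4 - y ^ 2) (-(2 * y)) y :=
        ((hasDerivAt_pow 2 y).const_sub (r ^ 4)).congr_deriv (by norm_num)
      have := ((((((CP.dS (r := r) (t := t) y).log (nz y)).div_const 2).const_mul (1 + t ^ 4 / r ^ 8))).sub ((h1.pow 2).div_const (2 * r ^ 8))).const_mul (- (1 / 2))
      refine this.congr_deriv ?_
      have hS := h.Spos y
      simp only [Nat.cast_ofNat]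
      unfold ro
      have e : Sv r t y = (r ^ 4 - y ^ 2) ^ 2 + t ^ 4 := rfl
      have hS2 := hS.ne'
      rw [← sub_eq_zero]
      have e2 : t ^ 4 = Sv r t y - (r ^ 4 - y ^ 2) ^ 2 := by rw [e]; ring
      rw [e2]
      field_simp
      ring) kont
  have eS : Sv r t d = Sv r t 0 := by unfold Sv; rw [D.d2]; ring
  have I0 : (∫ y in (0:ℝ)..d, ro r t y * y * (1 - (r ^ 4 - y ^ 2) ^ 2 / r ^ 8)) = 0 := by
    rw [I, eS, D.d2]; ring
  have up := int_le2 d0 (F := fun y => ro r t y * Tv r y * (y / r ^ 2)) (G := fun y => ro r t y * y * (1 - (r ^ 4 - y ^ 2) ^ 2 / r ^ 8))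
    (H := fun _ => (1:ℝ)) (α := 1 / r ^ 2) (β := 0) kont kont kont
  have key : ∀ y ∈ Icc 0 d, ro r t y * Tv r y * (y / r ^ 2) = 1 / r ^ 2 * (ro r t y * y * (1 - (r ^ 4 - y ^ 2) ^ 2 / r ^ 8)) -
      (ro r t y * (r ^ 4 - y ^ 2)) * (y / (r ^ 2 + y)) * (1 - (r ^ 4 - y ^ 2) ^ 2 / r ^ 8) / r ^ 4 := by
    intro y hy
    have : 0 < r ^ 2 + y := by linarith only [r2, hy.1]
    unfold Tv
    field_simp
    ring
  have kb : ∀ y ∈ Icc 0 d, 0 ≤ (ro r t y * (r ^ 4 - y ^ 2)) * (y / (r ^ 2 + y)) * (1 - (r ^ 4 - y ^ 2) ^ 2 / r ^ 8) ∧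
      (ro r t y * (r ^ 4 - y ^ 2)) * (y / (r ^ 2 + y)) * (1 - (r ^ 4 - y ^ 2) ^ 2 / r ^ 8) ≤ 1 := by
    intro y hy
    obtain ⟨b1, b2⟩ := D.B h hy.1 hy.2
    have y0 := hy.1
    have : 0 < r ^ 2 + y := by linarith only [r2, hy.1]
    have c1 : 0 ≤ ro r t y * (r ^ 4 - y ^ 2) := by rw [CP.roV]; have := h.Spos y; positivity
    have c2 : ro r t y * (r ^ 4 - y ^ 2) ≤ 1 := by
      have := h.one_sub y
      have : 0 ≤ t ^ 4 / Sv r t y := by have := h.Spos y; positivity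
      linarith
    have c3 : 0 ≤ y / (r ^ 2 + y) := by positivity
    have c4 : y / (r ^ 2 + y) ≤ 1 := by rw [div_le_one this]; linarith
    exact ⟨by positivity, mul_le_one₀ (mul_le_one₀ c2 c3 c4) b1 b2⟩
  have up := up (by
    intro y hy
    rw [key y hy]
    have := div_nonneg (kb y hy).1 (pow_pos hr 4).le
    linarith only [this])
  have lo := int_le2 d0 (F := fun y => -(ro r t y * Tv r y * (y / r ^ 2))) (G := fun y => ro r t y * y * (1 - (r ^ 4 - y ^ 2) ^ 2 / r ^ 8))
    (H := fun _ => (1:ℝ)) (α := - (1 / r ^ 2)) (β := 1 / r ^ 4) kont kont kont (by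
      intro y hy
      rw [key y hy]
      have := div_le_div_of_nonneg_right (kb y hy).2 (pow_pos hr 4).le
      linarith only [this])
  rw [I0, intervalIntegral.integral_neg, intervalIntegral.integral_const, smul_eq_mul, mul_one, sub_zero] at lo
  rw [I0] at up
  have := (D.le h).2
  have z : 1 / r ^ 4 * d ≤ 1 / r ^ 4 * (3 / 2 * r ^ 2) := by gcongr
  have z2 : 1 / r ^ 4 * (3 / 2 * r ^ 2) = 3 / 2 / r ^ 2 := by field_simp
  have z3 : 0 < 3 / 2 / r ^ 2 := by positivity
  rw [abs_le]
  constructor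
  · linarith only [lo, z, z2]
  · linarith only [up, z3]

theorem J2 (S : Sys n k (r ^ 4) Θ w w' f f') (h : CP r t δ) (hn : n = t ^ 3 / r ^ 2) (hΘ : Θ ≤ δ) (D : DD r d)
    (hk : k * r ^ 2 ≤ 1 / 2) (hs : 0 ≤ s) (hds : 10 ^ 6 * δ ≤ s)
    (hK : k ^ 2 * (∫ y in (0:ℝ)..1, ‖f y‖ ^ 2) ≤ s ^ 2) (c : ℂ) :
    ∫ y in (0:ℝ)..d, (2 * ro r t y * Tv r y * inner ℝ (f y) c - Tv' r y * inner ℝ (f' y) c) ≤ s * ‖c‖ / r := by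
  have hr := h.r0
  have ht := h.t0
  have d0 := D.d0.le
  have cro := h.cro
  have cro' := h.cro'
  have cT := @DD.cT r
  have cT' := @DD.cT' r
  have cf := S.cF
  have cf' := S.cf
  have cw := S.cW
  have cS := @CP.cS r t
  have r2 := pow_pos hr 2
  have r4 := pow_pos hr 4
  have k1 := S.hk
  have n0 := S.hn
  have Θ0 := S.hΘ
  have δ0 := h.d0
  obtain ⟨hd1, hd2⟩ := D.le h
  have nz : ∀ y, Sv r t y ≠ 0 := fun y => (h.Spos y).ne'
  have ct : Continuous (fun y => t ^ 4 / Sv r t y) := Continuous.div kont cS nz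
  have c1S : Continuous (fun y => 1 / Sv r t y) := Continuous.div kont cS nz
  have k2 : k ^ 2 ≤ 1 / (4 * r ^ 4) := by
    rw [le_div_iff₀ (by positivity)]
    have := pow_le_pow_left₀ (by positivity) hk 2
    nlinarith only [this]
  have ihS := h.int_half hd1
  have A := S.P1 0 d (12 * ‖c‖ / r) (fun y => Tv r y • c) (fun y => Tv' r y • c) (by norm_num) d0 D.d1
    (fun y _ => (DD.dT h y).smul_const c) kont (by simp [DD.T0]) (by simp [D.Td h]) (by positivity) (by
      have := int_le1 d0 (F := fun y => ‖Tv' r y • c‖ ^ 2 + k ^ 2 * ‖Tv r y • c‖ ^ 2) (G := fun _ => (1:ℝ)) (α := 82 / r ^ 4 * ‖c‖ ^ 2)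
        kont kont (by
          intro y hy
          rw [norm_rsmul_sq, norm_rsmul_sq]
          have q1 := pow_le_pow_left₀ (abs_nonneg _) (D.T'_abs h hy.1 hy.2) 2
          rw [sq_abs] at q1
          have q2 := D.T_sq h hy.1 hy.2
          have q3 : k ^ 2 * Tv r y ^ 2 ≤ 1 / (4 * r ^ 4) * 2 := by gcongr
          have q4 : Tv' r y ^ 2 + k ^ 2 * Tv r y ^ 2 ≤ 82 / r ^ 4 := by
            have e1 : (9 / r ^ 2) ^ 2 = 81 * (1 / r ^ 4) := by field_simp; norm_num
            have e2 : 1 / (4 * r ^ 4) * 2 = 1 / 2 * (1 / r ^ 4) := by field_simp; norm_num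
            have e3 : 82 / r ^ 4 = 82 * (1 / r ^ 4) := by ring
            have e4 : 0 < 1 / r ^ 4 := by positivity
            linarith only [q1, q3, e1, e2, e3, e4]
          have := mul_le_mul_of_nonneg_right q4 (sq_nonneg ‖c‖)
          linarith only [this])
      refine this.trans ?_
      rw [intervalIntegral.integral_const, smul_eq_mul, mul_one, sub_zero]
      calc 82 / r ^ 4 * ‖c‖ ^ 2 * d ≤ 96 / r ^ 4 * ‖c‖ ^ 2 * (3 / 2 * r ^ 2) := by gcongr; norm_num
        _ = _ := by field_simp; ring)
  have Bb := S.P2 0 d (11 * r / t ^ 3 * ‖c‖) (fun y => (ro r t y * Tv r y) • c) (fun y => (ro' r t y * Tv r y + ro r t y * Tv' r y) • c) (by norm_num) d0 D.d1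
    (fun y _ => ((h.dro y).mul (DD.dT h y)).smul_const c) kont (by simp [DD.T0]) (by simp [D.Td h]) (by positivity) (by
      have := int_le2 d0 (F := fun y => ‖(ro' r t y * Tv r y + ro r t y * Tv' r y) • c‖ ^ 2 + k ^ 2 * ‖(ro r t y * Tv r y) • c‖ ^ 2)
        (G := fun y => 1 / Sv r t y) (H := fun _ => (1:ℝ)) (α := 24 * r ^ 4 / t ^ 4 * ‖c‖ ^ 2) (β := 41 / (t ^ 4 * r ^ 4) * ‖c‖ ^ 2)
        kont c1S.continuousOn kont (by
          intro y hy
          have hS := h.Spos y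
          rw [norm_rsmul_sq, norm_rsmul_sq]
          have q1 := pow_le_pow_left₀ (abs_nonneg _) (D.T'_abs h hy.1 hy.2) 2
          rw [sq_abs] at q1
          have q2 := D.T_sq h hy.1 hy.2
          have q3 := h.ro_sq1 y
          have q4 := h.ro'_sq y
          have j1 : ro' r t y ^ 2 * Tv r y ^ 2 ≤ 6 * r ^ 4 / t ^ 4 * (1 / Sv r t y) * 2 := by gcongr
          have j2 : ro r t y ^ 2 * Tv' r y ^ 2 ≤ 1 / (4 * t ^ 4) * (9 / r ^ 2) ^ 2 := by gcongr
          have j3 : k ^ 2 * (ro r t y ^ 2 * Tv r y ^ 2) ≤ 1 / (4 * r ^ 4) * (1 / (4 * t ^ 4) * 2) := by gcongr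
          have e2 : 1 / (4 * t ^ 4) * (9 / r ^ 2) ^ 2 = 81 / 4 * (1 / (t ^ 4 * r ^ 4)) := by field_simp; norm_num
          have e3 : 1 / (4 * r ^ 4) * (1 / (4 * t ^ 4) * 2) = 1 / 8 * (1 / (t ^ 4 * r ^ 4)) := by field_simp; norm_num
          have e4 : 0 < 1 / (t ^ 4 * r ^ 4) := by positivity
          have q5 : (ro' r t y * Tv r y + ro r t y * Tv' r y) ^ 2 + k ^ 2 * (ro r t y * Tv r y) ^ 2 ≤ 24 * r ^ 4 / t ^ 4 * (1 / Sv r t y) + 41 / (t ^ 4 * r ^ 4) := by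
            have e5 : 41 / (t ^ 4 * r ^ 4) = 41 * (1 / (t ^ 4 * r ^ 4)) := by ring
            have e6 : 24 * r ^ 4 / t ^ 4 * (1 / Sv r t y) = 4 * (6 * r ^ 4 / t ^ 4 * (1 / Sv r t y)) := by ring
            linarith only [j1, j2, j3, e2, e3, e4, e5, e6, sq_nonneg (ro' r t y * Tv r y - ro r t y * Tv' r y)]
          have := mul_le_mul_of_nonneg_right q5 (sq_nonneg ‖c‖)
          linarith only [this])
      refine this.trans ?_
      rw [intervalIntegral.integral_const, smul_eq_mul, mul_one, sub_zero]
      have i1 : 24 * r ^ 4 / t ^ 4 * ‖c‖ ^ 2 * (∫ y in (0:ℝ)..d, 1 / Sv r t y) ≤ 24 * r ^ 4 / t ^ 4 * ‖c‖ ^ 2 * (4 / (r ^ 2 * t ^ 2)) := by gcongr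
      have i2 : 41 / (t ^ 4 * r ^ 4) * ‖c‖ ^ 2 * d ≤ 41 / (t ^ 4 * r ^ 4) * ‖c‖ ^ 2 * (3 / 2 * r ^ 2) := by gcongr
      have i3 : 41 / (t ^ 4 * r ^ 4) * ‖c‖ ^ 2 * (3 / 2 * r ^ 2) = 123 / 2 * ‖c‖ ^ 2 * t ^ 2 / (t ^ 6 * r ^ 2) := by field_simp; ring
      have i4 : 123 / 2 * ‖c‖ ^ 2 * t ^ 2 / (t ^ 6 * r ^ 2) ≤ 123 / 2 * ‖c‖ ^ 2 * (1 / 10 ^ 24 * r ^ 4) / (t ^ 6 * r ^ 2) := by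
        have := h.t2_le'; gcongr
      have i5 : 123 / 2 * ‖c‖ ^ 2 * (1 / 10 ^ 24 * r ^ 4) / (t ^ 6 * r ^ 2) = 123 / 2 / 10 ^ 24 * (‖c‖ ^ 2 * r ^ 2 / t ^ 6) := by field_simp
      have i6 : 24 * r ^ 4 / t ^ 4 * ‖c‖ ^ 2 * (4 / (r ^ 2 * t ^ 2)) = 96 * (‖c‖ ^ 2 * r ^ 2 / t ^ 6) := by field_simp; ring
      have i7 : (11 * r / t ^ 3 * ‖c‖) ^ 2 = 121 * (‖c‖ ^ 2 * r ^ 2 / t ^ 6) := by field_simp; ring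
      have i8 : 0 ≤ ‖c‖ ^ 2 * r ^ 2 / t ^ 6 := by positivity
      have i9 : 123 / 2 / 10 ^ 24 * (‖c‖ ^ 2 * r ^ 2 / t ^ 6) ≤ 1 * (‖c‖ ^ 2 * r ^ 2 / t ^ 6) := by gcongr; norm_num
      linarith only [i1, i2, i3, i4, i5, i6, i7, i8, i9])
  have L3 := S.L3 h hn hΘ
  have L3' : (∫ y in (0:ℝ)..d, ‖w y‖ ^ 2) ≤ (1100 * (δ / t)) ^ 2 :=
    (int_sub (by norm_num) d0 D.d1 (F := fun y => ‖w y‖ ^ 2) kont (fun y _ => by positivity)).trans L3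
  have C1 := cs_dom d0 (F := fun y => (t ^ 4 / Sv r t y) * Tv r y * inner ℝ (w y) c) (A := fun y => ‖w y‖)
    (B := fun y => 3 / 2 * ‖c‖ * (t ^ 4 / Sv r t y)) (α := 1100 * (δ / t)) (β := 3 / 2 * ‖c‖ * (2 * t / r))
    kont kont (continuous_const.mul ct).continuousOn (by positivity) (by positivity) (by
      intro y hy
      have hS := h.Spos y
      have q := abs_real_inner_le_norm (w y) c
      have q1 := D.T_nn h hy.1 hy.2
      have q2 : Tv r y ≤ 3 / 2 := by
        have := D.T_sq h hy.1 hy.2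
        nlinarith only [this, q1]
      rw [abs_mul, abs_of_nonneg (by positivity)]
      calc t ^ 4 / Sv r t y * Tv r y * |inner ℝ (w y) c| ≤ t ^ 4 / Sv r t y * (3 / 2) * (‖w y‖ * ‖c‖) := by gcongr
        _ = _ := by ring) L3' (by
      have := int_le1 d0 (F := fun y => (3 / 2 * ‖c‖ * (t ^ 4 / Sv r t y)) ^ 2) (G := fun y => 1 / Sv r t y) (α := (3 / 2 * ‖c‖) ^ 2 * t ^ 4)
        ((continuous_const.mul ct).pow 2).continuousOn c1S.continuousOn (by
          intro y hy
          have hS := h.Spos y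
          have : t ^ 4 / Sv r t y ≤ 1 := by rw [div_le_one hS]; exact h.S_ge y
          calc (3 / 2 * ‖c‖ * (t ^ 4 / Sv r t y)) ^ 2 = (3 / 2 * ‖c‖) ^ 2 * (t ^ 4 * (1 / Sv r t y)) * (t ^ 4 / Sv r t y) := by ring
            _ ≤ (3 / 2 * ‖c‖) ^ 2 * (t ^ 4 * (1 / Sv r t y)) * 1 := by gcongr
            _ = _ := by ring)
      refine this.trans ?_
      calc _ ≤ (3 / 2 * ‖c‖) ^ 2 * t ^ 4 * (4 / (r ^ 2 * t ^ 2)) := by gcongr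
        _ = _ := by field_simp; ring)
  have hK' : (∫ y in (0:ℝ)..d, (k * ‖f y‖) ^ 2) ≤ s ^ 2 := by
    have := int_sub (le_refl (0:ℝ)) d0 D.d1 (F := fun y => (k * ‖f y‖) ^ 2) kont (fun y _ => by positivity)
    refine this.trans ?_
    simp only [mul_pow]
    rw [icm]; exact hK
  have C2 := cs_dom d0 (F := fun y => k ^ 2 * Tv r y * inner ℝ (f y) c) (A := fun y => k * ‖f y‖)
    (B := fun y => k * Tv r y * ‖c‖) (α := s) (β := 9 / 10 * ‖c‖ / r) kont kont kont hs (by positivity) (by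
      intro y hy
      have q := abs_real_inner_le_norm (f y) c
      have q1 := D.T_nn h hy.1 hy.2
      rw [abs_mul, abs_of_nonneg (by positivity)]
      calc _ ≤ k ^ 2 * Tv r y * (‖f y‖ * ‖c‖) := by gcongr
        _ = _ := by ring) hK' (by
      have := int_le1 d0 (F := fun y => (k * Tv r y * ‖c‖) ^ 2) (G := fun _ => (1:ℝ)) (α := 1 / (4 * r ^ 4) * 2 * ‖c‖ ^ 2)
        kont kont (by
          intro y hy
          have q2 := D.T_sq h hy.1 hy.2
          calc (k * Tv r y * ‖c‖) ^ 2 = k ^ 2 * Tv r y ^ 2 * ‖c‖ ^ 2 := by ring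
            _ ≤ 1 / (4 * r ^ 4) * 2 * ‖c‖ ^ 2 := by gcongr
            _ = _ := by ring)
      refine this.trans ?_
      rw [intervalIntegral.integral_const, smul_eq_mul, mul_one, sub_zero]
      calc _ ≤ 1 / (4 * r ^ 4) * 2 * ‖c‖ ^ 2 * (3 / 2 * r ^ 2) := by gcongr
        _ = 3 / 4 * (‖c‖ ^ 2 / r ^ 2) := by field_simp
        _ ≤ 81 / 100 * (‖c‖ ^ 2 / r ^ 2) := by nlinarith only [show 0 ≤ ‖c‖ ^ 2 / r ^ 2 by positivity]
        _ = _ := by field_simp; ring)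
  have comb := int_le4 d0 (F := fun y => 2 * ro r t y * Tv r y * inner ℝ (f y) c - Tv' r y * inner ℝ (f' y) c)
    (G := fun y => (r ^ 4 - y ^ 2) * inner ℝ (w y) ((ro r t y * Tv r y) • c) + 2 * inner ℝ (f y) ((ro r t y * Tv r y) • c))
    (H := fun y => inner ℝ (w y) (Tv r y • c) + inner ℝ (f' y) (Tv' r y • c) + k ^ 2 * inner ℝ (f y) (Tv r y • c))
    (K := fun y => (t ^ 4 / Sv r t y) * Tv r y * inner ℝ (w y) c) (J := fun y => k ^ 2 * Tv r y * inner ℝ (f y) c)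
    (α := 1) (β := -1) (γ := 1) (θ := 1) kont kont kont kont kont (by
      intro y _
      rw [← h.one_sub y]
      simp only [inner_smul_right]
      apply le_of_eq; ring)
  have A' := (abs_le.1 A).1
  have B' := (abs_le.1 Bb).2
  have C1' := (abs_le.1 C1).2
  have C2' := (abs_le.1 C2).2
  set v := ‖c‖ / r with hv
  have v0 : 0 ≤ v := by positivity
  have e1 : Θ * (12 * ‖c‖ / r) = 12 * Θ * v := by rw [hv]; ring
  have e2 : Θ * n * (11 * r / t ^ 3 * ‖c‖) = 11 * Θ * v := by rw [hn, hv]; field_simp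
  have e3 : 1100 * (δ / t) * (3 / 2 * ‖c‖ * (2 * t / r)) = 3300 * δ * v := by rw [hv]; field_simp; ring
  have e4 : s * (9 / 10 * ‖c‖ / r) = 9 / 10 * s * v := by rw [hv]; ring
  have e5 : s * ‖c‖ / r = s * v := by rw [hv]; ring
  rw [e1] at A'
  rw [e2] at B'
  rw [e3] at C1'
  rw [e4] at C2'
  rw [e5]
  have g1 : Θ * v ≤ δ * v := by gcongr
  have g2 : 10 ^ 6 * δ * v ≤ s * v := by gcongr
  have g3 : 0 ≤ δ * v := by positivity
  linarith only [A', B', C1', C2', comb, g1, g2, g3]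

end Sys

def cc (r t : ℝ) (f : ℝ → ℂ) : ℂ := (1 / Pv r t 0) • f 0
def XX (r t : ℝ) (f : ℝ → ℂ) (y : ℝ) : ℂ := (1 / Pv r t y) • gg r f y - cc r t f

namespace Sys
variable {n k Θ r t δ d s : ℝ} {w w' f f' : ℝ → ℂ}

theorem cZ (S : Sys n k (r ^ 4) Θ w w' f f') (h : CP r t δ) : ContinuousOn (ZZ r t f f') (Icc 0 (r ^ 2)) := by
  have cg := S.cg
  have cg' := S.cg'
  have cP : Continuous (Pv r t) := by unfold Pv; fun_prop
  have cq1 : ContinuousOn (fun y => (-2 * y) / Pv r t y) (Icc 0 (r ^ 2)) :=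
    ContinuousOn.div kont kont (fun y hy => (h.Ppos hy.1 hy.2).ne')
  unfold ZZ
  fun_prop

theorem eb (h : CP r t δ) (L : ‖f (r ^ 2)‖ ≤ 14 * δ * r) : ‖(1 / r ^ 2) • f (r ^ 2)‖ ^ 2 ≤ 196 * δ ^ 2 / r ^ 2 := by
  have hr := h.r0
  rw [norm_rsmul_sq]
  calc (1 / r ^ 2) ^ 2 * ‖f (r ^ 2)‖ ^ 2 ≤ (1 / r ^ 2) ^ 2 * (14 * δ * r) ^ 2 := by gcongr
    _ = _ := by field_simp; ring

theorem H5a (S : Sys n k (r ^ 4) Θ w w' f f') (h : CP r t δ) (L : ‖f (r ^ 2)‖ ≤ 14 * δ * r)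
    (hk : 1 / 2 ≤ k * r ^ 2) (hds : 10 ^ 6 * δ ≤ s)
    (hK : k ^ 2 * (∫ y in (0:ℝ)..1, ‖f y‖ ^ 2) ≤ s ^ 2)
    (hZ : (∫ y in (0:ℝ)..(r ^ 2), ‖ZZ r t f f' y‖ ^ 2) ≤ s ^ 2) :
    (∫ y in (0:ℝ)..(r ^ 2), ‖f' y‖ ^ 2) ≤ 30000 * s ^ 2 := by
  have hr := h.r0
  have r2 := pow_pos hr 2
  have r4 := pow_pos hr 4
  have t4 := pow_pos h.t0 4
  have r21 : r ^ 2 < 1 := pow_lt_one₀ hr.le h.r1 two_ne_zero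
  have cf := S.cF
  have cf' := S.cf
  have cg := S.cg
  have cg' := S.cg'
  have k1 := S.hk
  have d0 := h.d0
  set e := f (r ^ 2) with he
  have K1 : (∫ y in (0:ℝ)..(r ^ 2), ‖f y‖ ^ 2) ≤ 4 * r ^ 4 * s ^ 2 := by
    have a1 := int_sub (le_refl (0:ℝ)) r2.le r21.le (F := fun y => ‖f y‖ ^ 2) kont (fun y _ => by positivity)
    have a2 : (1 / 2) ^ 2 ≤ (k * r ^ 2) ^ 2 := by gcongr
    have a3 : 0 ≤ ∫ y in (0:ℝ)..1, ‖f y‖ ^ 2 := int_nn (by norm_num) (fun y _ => by positivity)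
    have a4 := mul_le_mul_of_nonneg_right a2 a3
    have a5 := mul_le_mul_of_nonneg_left hK r4.le
    nlinarith only [a1, a4, a5]
  have G1 := int_le2 r2.le (F := fun y => ‖gg r f y‖ ^ 2) (G := fun y => ‖f y‖ ^ 2) (H := fun _ => (1:ℝ)) (α := 2) (β := 2 * (14 * δ * r) ^ 2)
    kont kont kont (by
      intro y hy
      have := norm_add_sq_le2 (f y) (-((y / r ^ 2) • e))
      rw [norm_neg, ← sub_eq_add_neg, norm_rsmul_sq] at this
      change ‖f y - (y / r ^ 2) • e‖ ^ 2 ≤ _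
      have y0 := hy.1
      have q : y / r ^ 2 ≤ 1 := by rw [div_le_one r2]; exact hy.2
      have : (y / r ^ 2) ^ 2 * ‖e‖ ^ 2 ≤ 1 ^ 2 * (14 * δ * r) ^ 2 := by gcongr
      linarith)
  rw [intervalIntegral.integral_const, smul_eq_mul, mul_one, sub_zero] at G1
  have Pnz : ∀ y ∈ Icc 0 (r ^ 2), Pv r t y ≠ 0 := fun y hy => (h.Ppos hy.1 hy.2).ne'
  have cP : Continuous (Pv r t) := by unfold Pv; fun_prop
  have cq : ContinuousOn (fun y => (-2 * Pv r t y - -2 * y * (-2 * y)) / Pv r t y ^ 2) (Icc 0 (r ^ 2)) :=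
    ContinuousOn.div kont kont (fun y hy => pow_ne_zero 2 (Pnz y hy))
  have cq' : ContinuousOn (fun y => (-1 * Pv r t y - -1 * y * (-2 * y)) / Pv r t y ^ 2) (Icc 0 (r ^ 2)) :=
    ContinuousOn.div kont kont (fun y hy => pow_ne_zero 2 (Pnz y hy))
  have cq1 : ContinuousOn (fun y => (-2 * y) / Pv r t y) (Icc 0 (r ^ 2)) :=
    ContinuousOn.div kont kont Pnz
  have cq2 : ContinuousOn (fun y => (-1 * y) / Pv r t y) (Icc 0 (r ^ 2)) :=
    ContinuousOn.div kont kont Pnz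
  have Q := qid r2.le (g := gg r f) (g' := gg' r f f') (q := fun y => -2 * y / Pv r t y)
    (q' := fun y => (-2 * Pv r t y - -2 * y * (-2 * y)) / Pv r t y ^ 2) (fun y _ => S.dg y)
    (fun y hy => ((((hasDerivAt_id y).const_mul (-2)).congr_deriv (by norm_num)).div (CP.dP y) (Pnz y hy))) cg'.continuousOn cq
  have R := qid r2.le (g := gg r f) (g' := gg' r f f') (q := fun y => -1 * y / Pv r t y)
    (q' := fun y => (-1 * Pv r t y - -1 * y * (-2 * y)) / Pv r t y ^ 2) (fun y _ => S.dg y)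
    (fun y hy => ((((hasDerivAt_id y).const_mul (-1)).congr_deriv (by norm_num)).div (CP.dP y) (Pnz y hy))) cg'.continuousOn cq'
  rw [ga h] at Q R
  simp only [norm_zero, mul_zero, zero_div, zero_mul, zero_pow two_ne_zero, sub_zero] at Q R
  have R0 : 0 ≤ ∫ y in (0:ℝ)..(r ^ 2), ‖gg' r f f' y - (-1 * y / Pv r t y) • gg r f y‖ ^ 2 := int_nn r2.le (fun y _ => by positivity)
  rw [R] at R0
  have Q3 : (∫ y in (0:ℝ)..(r ^ 2), ‖ZZ r t f f' y‖ ^ 2) = ∫ y in (0:ℝ)..(r ^ 2), ‖gg' r f f' y - (-2 * y / Pv r t y) • gg r f y‖ ^ 2 := rfl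
  rw [Q3, Q] at hZ
  have M := int_le3 r2.le (F := fun y => (1 / 2) * ‖gg' r f f' y‖ ^ 2)
    (G := fun y => ‖gg' r f f' y‖ ^ 2 + ((-2 * Pv r t y - -2 * y * (-2 * y)) / Pv r t y ^ 2 + (-2 * y / Pv r t y) ^ 2) * ‖gg r f y‖ ^ 2)
    (H := fun y => ‖gg' r f f' y‖ ^ 2 + ((-1 * Pv r t y - -1 * y * (-2 * y)) / Pv r t y ^ 2 + (-1 * y / Pv r t y) ^ 2) * ‖gg r f y‖ ^ 2)
    (K := fun y => ‖gg r f y‖ ^ 2) (α := 1) (β := - (1 / 2)) (γ := 2 / r ^ 4) kont kont kont kont (by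
      intro y hy
      have hp := h.Ppos hy.1 hy.2
      have e1 : (-2 * Pv r t y - -2 * y * (-2 * y)) / Pv r t y ^ 2 + (-2 * y / Pv r t y) ^ 2 = -2 * (1 / Pv r t y) := by field_simp; ring
      have e2 : (-1 * Pv r t y - -1 * y * (-2 * y)) / Pv r t y ^ 2 + (-1 * y / Pv r t y) ^ 2 = - (Pv r t y + y ^ 2) * (1 / Pv r t y) ^ 2 := by
        field_simp; ring
      have e3 : r ^ 4 ≤ Pv r t y + y ^ 2 := by unfold Pv; have : 0 ≤ t ^ 4 / r ^ 4 := by positivity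
                                               linarith
      have e4 : 2 * (1 / Pv r t y) ≤ 1 / 2 * r ^ 4 * (1 / Pv r t y) ^ 2 + 2 / r ^ 4 := by
        have : 1 / 2 * r ^ 4 * (1 / Pv r t y) ^ 2 + 2 / r ^ 4 - 2 * (1 / Pv r t y) = 1 / 2 * r ^ 4 * (1 / Pv r t y - 2 / r ^ 4) ^ 2 := by
          field_simp; ring
        have : 0 ≤ 1 / 2 * r ^ 4 * (1 / Pv r t y - 2 / r ^ 4) ^ 2 := by positivity
        linarith
      have e5 : r ^ 4 * (1 / Pv r t y) ^ 2 ≤ (Pv r t y + y ^ 2) * (1 / Pv r t y) ^ 2 := by gcongr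
      have e6 : 2 * (1 / Pv r t y) ≤ 1 / 2 * (Pv r t y + y ^ 2) * (1 / Pv r t y) ^ 2 + 2 / r ^ 4 := by linarith only [e4, e5]
      have e7 := mul_le_mul_of_nonneg_right e6 (sq_nonneg ‖gg r f y‖)
      rw [e1, e2]
      linarith only [e7])
  rw [icm] at M
  have G2 : 2 / r ^ 4 * (∫ y in (0:ℝ)..(r ^ 2), ‖gg r f y‖ ^ 2) ≤ 2 / r ^ 4 * (2 * (4 * r ^ 4 * s ^ 2) + 2 * (14 * δ * r) ^ 2 * r ^ 2) := by
    gcongr; linarith only [G1, K1]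
  have G3 : 2 / r ^ 4 * (2 * (4 * r ^ 4 * s ^ 2) + 2 * (14 * δ * r) ^ 2 * r ^ 2) = 16 * s ^ 2 + 784 * δ ^ 2 := by field_simp; ring
  have eb := eb h L
  have N := int_le2 r2.le (F := fun y => ‖f' y‖ ^ 2) (G := fun y => ‖gg' r f f' y‖ ^ 2) (H := fun _ => (1:ℝ)) (α := 2) (β := 2 * (196 * δ ^ 2 / r ^ 2))
      kont kont kont (by
        intro y _
        have := norm_add_sq_le2 (gg' r f f' y) ((1 / r ^ 2) • e)
        have e1 : gg' r f f' y + (1 / r ^ 2) • e = f' y := by unfold gg'; rw [sub_add_cancel]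
        rw [e1] at this
        linarith only [this, eb])
  rw [intervalIntegral.integral_const, smul_eq_mul, mul_one, sub_zero] at N
  have N2 : 2 * (196 * δ ^ 2 / r ^ 2) * r ^ 2 = 392 * δ ^ 2 := by field_simp; norm_num
  have ds : δ ^ 2 ≤ s ^ 2 := by
    have : δ ≤ s := by linarith
    gcongr
  nlinarith only [N, N2, M, G2, G3, hZ, R0, ds, sq_nonneg s]

theorem dX (S : Sys n k (r ^ 4) Θ w w' f f') (h : CP r t δ) {y : ℝ} (y0 : 0 ≤ y) (y1 : y ≤ r ^ 2) :
    HasDerivAt (XX r t f) ((1 / Pv r t y) • ZZ r t f f' y) y := by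
  have hp := h.Ppos y0 y1
  have h1 : HasDerivAt (fun y => 1 / Pv r t y) (2 * y / Pv r t y ^ 2) y :=
    ((hasDerivAt_const y (1:ℝ)).div (CP.dP y) hp.ne').congr_deriv (by ring)
  have h2 := (h1.smul (S.dg y)).sub_const (cc r t f)
  refine h2.congr_deriv ?_
  unfold ZZ
  rw [smul_sub, smul_smul]
  have : 1 / Pv r t y * (-2 * y / Pv r t y) = - (2 * y / Pv r t y ^ 2) := by field_simp
  rw [this, neg_smul, sub_neg_eq_add]

theorem X0 (h : CP r t δ) : XX r t f 0 = 0 := by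
  unfold XX cc gg
  rw [zero_div, zero_smul, sub_zero, sub_self]

theorem X1 (S : Sys n k (r ^ 4) Θ w w' f f') (h : CP r t δ)
    (hZ : (∫ y in (0:ℝ)..(r ^ 2), ‖ZZ r t f f' y‖ ^ 2) ≤ s ^ 2) :
    (∫ y in (0:ℝ)..(r ^ 2), ‖XX r t f y‖ ^ 2) ≤ (2 * s / r ^ 2) ^ 2 := by
  have hr := h.r0
  have r2 := pow_pos hr 2
  have r4 := pow_pos hr 4
  have t4 := pow_pos h.t0 4
  have cZ := S.cZ h
  have cP : Continuous (Pv r t) := by unfold Pv; fun_prop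
  have cX : ContinuousOn (XX r t f) (Icc 0 (r ^ 2)) := cont_of (fun y hy => S.dX h hy.1 hy.2)
  have c1 : ContinuousOn (fun y => 1 / Pv r t y) (Icc 0 (r ^ 2)) :=
    ContinuousOn.div kont kont (fun y hy => (h.Ppos hy.1 hy.2).ne')
  have F := ftc r2.le (G := fun y => (r ^ 2 - y) * ‖XX r t f y‖ ^ 2)
    (G' := fun y => -1 * ‖XX r t f y‖ ^ 2 + (r ^ 2 - y) * (2 * inner ℝ (XX r t f y) ((1 / Pv r t y) • ZZ r t f f' y)))
    (fun y hy => ((hasDerivAt_id y).const_sub (r ^ 2)).mul (hd_normsq (S.dX h hy.1 hy.2))) kont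
  simp only [X0 h, norm_zero, sub_self, zero_mul, zero_pow two_ne_zero, mul_zero] at F
  have M := int_le2 r2.le (F := fun y => -1 * ‖XX r t f y‖ ^ 2 + (r ^ 2 - y) * (2 * inner ℝ (XX r t f y) ((1 / Pv r t y) • ZZ r t f f' y)))
    (G := fun y => ‖XX r t f y‖ ^ 2) (H := fun y => ‖ZZ r t f f' y‖ ^ 2) (α := - (1 / 2)) (β := 2 / r ^ 4) kont kont kont (by
      intro y hy
      have hp := h.Ppos hy.1 hy.2
      have y1 : 0 ≤ r ^ 2 - y := by linarith only [hy.2]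
      have hpp : (r ^ 2 - y) * r ^ 2 ≤ Pv r t y := by
        unfold Pv
        have : 0 ≤ t ^ 4 / r ^ 4 := by positivity
        nlinarith only [this, hy.1, y1]
      have q1 : (r ^ 2 - y) * (1 / Pv r t y) ≤ 1 / r ^ 2 := by
        rw [mul_one_div, div_le_div_iff₀ hp r2]; linarith
      have q2 := real_inner_le_norm (XX r t f y) (ZZ r t f f' y)
      rw [inner_smul_right]
      have q3 : (r ^ 2 - y) * (1 / Pv r t y) * inner ℝ (XX r t f y) (ZZ r t f f' y) ≤ 1 / r ^ 2 * (‖XX r t f y‖ * ‖ZZ r t f f' y‖) := by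
        calc _ ≤ (r ^ 2 - y) * (1 / Pv r t y) * (‖XX r t f y‖ * ‖ZZ r t f f' y‖) := by gcongr
          _ ≤ _ := by gcongr
      have q4 : 0 ≤ (1 / 2) * (‖XX r t f y‖ - 2 * (1 / r ^ 2) * ‖ZZ r t f f' y‖) ^ 2 := by positivity
      have q5 : 2 / r ^ 4 = 2 * (1 / r ^ 2) ^ 2 := by field_simp
      rw [q5]
      nlinarith only [q3, q4])
  rw [F] at M
  have e : (2 * s / r ^ 2) ^ 2 = 2 * (2 / r ^ 4 * s ^ 2) := by field_simp
  have : 2 / r ^ 4 * (∫ y in (0:ℝ)..(r ^ 2), ‖ZZ r t f f' y‖ ^ 2) ≤ 2 / r ^ 4 * s ^ 2 := by gcongr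
  linarith

theorem R1 (S : Sys n k (r ^ 4) Θ w w' f f') (h : CP r t δ) (D : DD r d) (L : ‖f (r ^ 2)‖ ≤ 14 * δ * r)
    (hs : 0 ≤ s) (hds : 10 ^ 6 * δ ≤ s) (hO : (∫ y in (r ^ 2)..1, ‖f' y‖ ^ 2) ≤ s ^ 2) (c : ℂ) :
    |∫ y in (r ^ 2)..d, (2 * ro r t y * Tv r y * inner ℝ (gg r f y) c - Tv' r y * inner ℝ (gg' r f f' y) c)| ≤ 26 * s * (‖c‖ / r) := by
  have hr := h.r0
  have r2 := pow_pos hr 2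
  have r4 := pow_pos hr 4
  have cf' := S.cf
  have cg := S.cg
  have cg' := S.cg'
  have cro := h.cro
  have cT := @DD.cT r
  have cT' := @DD.cT' r
  have d0 := h.d0
  obtain ⟨hd1, hd2⟩ := D.le h
  have cgS : Continuous (fun y => ‖gg r f y‖ ^ 2 / Sv r t y) := Continuous.div kont CP.cS (fun y => (h.Spos y).ne')
  have eb := eb h L
  have O1 := int_sub le_rfl hd1 D.d1 (F := fun y => ‖f' y‖ ^ 2) kont (fun y _ => by positivity)
  have N := int_le2 hd1 (F := fun y => ‖gg' r f f' y‖ ^ 2) (G := fun y => ‖f' y‖ ^ 2) (H := fun _ => (1:ℝ)) (α := 2) (β := 2 * (196 * δ ^ 2 / r ^ 2))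
      kont kont kont (by
        intro y _
        have := norm_add_sq_le2 (f' y) (-((1 / r ^ 2) • f (r ^ 2)))
        rw [norm_neg, ← sub_eq_add_neg] at this
        change ‖f' y - (1 / r ^ 2) • f (r ^ 2)‖ ^ 2 ≤ _
        linarith only [this, eb])
  rw [intervalIntegral.integral_const, smul_eq_mul, mul_one] at N
  have N2 : 2 * (196 * δ ^ 2 / r ^ 2) * (d - r ^ 2) ≤ 2 * (196 * δ ^ 2 / r ^ 2) * (1 / 2 * r ^ 2) := by gcongr; linarith
  have N3 : 2 * (196 * δ ^ 2 / r ^ 2) * (1 / 2 * r ^ 2) = 196 * δ ^ 2 := by field_simp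
  have ds : (10 ^ 6 * δ) ^ 2 ≤ s ^ 2 := by gcongr
  have N4 : (∫ y in (r ^ 2)..d, ‖gg' r f f' y‖ ^ 2) ≤ (2 * s) ^ 2 := by nlinarith only [N, N2, N3, ds, O1, hO]
  have G := h.hS_right hd1 (g := gg r f) (g' := gg' r f f') (fun y _ => S.dg y) cg'.continuousOn (ga h)
  have G1 : (∫ y in (r ^ 2)..d, (|ro r t y| * ‖gg r f y‖) ^ 2) ≤ (6 * s / r ^ 2) ^ 2 := by
    have := int_le hd1 (F := fun y => (|ro r t y| * ‖gg r f y‖) ^ 2) (G := fun y => ‖gg r f y‖ ^ 2 / Sv r t y) kont cgS.continuousOn (by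
      intro y _
      have c4 := mul_le_mul_of_nonneg_right (h.ro_sq y) (sq_nonneg ‖gg r f y‖)
      rw [one_div, inv_mul_eq_div] at c4
      rw [mul_pow, sq_abs]; exact c4)
    refine this.trans (G.trans ?_)
    calc _ ≤ 8 / r ^ 4 * (2 * s) ^ 2 := by gcongr
      _ = 32 * (s ^ 2 / r ^ 4) := by ring
      _ ≤ 36 * (s ^ 2 / r ^ 4) := by nlinarith only [show 0 ≤ s ^ 2 / r ^ 4 by positivity]
      _ = _ := by ring
  have C1 := cs_dom hd1 (F := fun y => 2 * ro r t y * Tv r y * inner ℝ (gg r f y) c) (A := fun y => |ro r t y| * ‖gg r f y‖)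
    (B := fun y => 2 * Tv r y * ‖c‖) (α := 6 * s / r ^ 2) (β := 2 * ‖c‖ * r) kont kont kont (by positivity) (by positivity) (by
      intro y hy
      have q := abs_real_inner_le_norm (gg r f y) c
      have q1 := D.T_nn h (r2.le.trans hy.1) hy.2
      rw [abs_mul, abs_mul, abs_mul, abs_of_nonneg q1, abs_two]
      calc _ ≤ 2 * |ro r t y| * Tv r y * (‖gg r f y‖ * ‖c‖) := by gcongr
        _ = _ := by ring) G1 (by
      have := int_le1 hd1 (F := fun y => (2 * Tv r y * ‖c‖) ^ 2) (G := fun _ => (1:ℝ)) (α := 8 * ‖c‖ ^ 2)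
        kont kont (by
          intro y hy
          have q2 := D.T_sq h (r2.le.trans hy.1) hy.2
          have := mul_le_mul_of_nonneg_right q2 (sq_nonneg ‖c‖)
          nlinarith only [this])
      rw [intervalIntegral.integral_const, smul_eq_mul, mul_one] at this
      refine this.trans ?_
      calc _ ≤ 8 * ‖c‖ ^ 2 * (1 / 2 * r ^ 2) := by gcongr; linarith
        _ = _ := by ring)
  have C2 := cs_dom hd1 (F := fun y => Tv' r y * inner ℝ (gg' r f f' y) c) (A := fun y => ‖gg' r f f' y‖)
    (B := fun y => 9 / r ^ 2 * ‖c‖) (α := 2 * s) (β := 7 * (‖c‖ / r)) kont kont kont (by positivity) (by positivity) (by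
      intro y hy
      have q := abs_real_inner_le_norm (gg' r f f' y) c
      have q1 := D.T'_abs h (r2.le.trans hy.1) hy.2
      rw [abs_mul]
      calc _ ≤ 9 / r ^ 2 * (‖gg' r f f' y‖ * ‖c‖) := by gcongr
        _ = _ := by ring) N4 (by
      rw [intervalIntegral.integral_const, smul_eq_mul]
      calc _ ≤ (1 / 2 * r ^ 2) * (9 / r ^ 2 * ‖c‖) ^ 2 := by gcongr; linarith
        _ = 81 / 2 * (‖c‖ / r) ^ 2 := by field_simp; ring
        _ ≤ 49 * (‖c‖ / r) ^ 2 := by nlinarith only [show 0 ≤ (‖c‖ / r) ^ 2 by positivity]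
        _ = _ := by ring)
  rw [int_min hd1 kont kont]
  have e : 6 * s / r ^ 2 * (2 * ‖c‖ * r) = 12 * (s * (‖c‖ / r)) := by field_simp; ring
  have := abs_sub (∫ y in (r ^ 2)..d, 2 * ro r t y * Tv r y * inner ℝ (gg r f y) c) (∫ y in (r ^ 2)..d, Tv' r y * inner ℝ (gg' r f f' y) c)
  linarith only [this, C1, C2, e]

end Sys

namespace Sys
variable {n k Θ r t δ d s : ℝ} {w w' f f' : ℝ → ℂ}

theorem gX (h : CP r t δ) {y : ℝ} (y0 : 0 ≤ y) (y1 : y ≤ r ^ 2) :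
    gg r f y = Pv r t y • (XX r t f y + cc r t f) := by
  have hp := h.Ppos y0 y1
  unfold XX
  rw [sub_add_cancel, smul_smul, mul_one_div, div_self hp.ne', one_smul]

theorem gX' (h : CP r t δ) {y : ℝ} (y0 : 0 ≤ y) (y1 : y ≤ r ^ 2) :
    gg' r f f' y = ZZ r t f f' y - (2 * y) • (XX r t f y + cc r t f) := by
  have hp := h.Ppos y0 y1
  unfold ZZ
  rw [gX h y0 y1, smul_smul, div_mul_cancel₀ _ hp.ne', sub_sub, ← add_smul]
  have : -2 * y + 2 * y = 0 := by ring
  rw [this, zero_smul, sub_zero]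

theorem R2 (S : Sys n k (r ^ 4) Θ w w' f f') (h : CP r t δ) (D : DD r d) (hs : 0 ≤ s)
    (hZ : (∫ y in (0:ℝ)..(r ^ 2), ‖ZZ r t f f' y‖ ^ 2) ≤ s ^ 2) {c : ℂ} (hc : c = cc r t f) :
    19 / 10 * r ^ 2 * ‖c‖ ^ 2 - 49 * s * (‖c‖ / r) ≤
    ∫ y in (0:ℝ)..(r ^ 2), (2 * ro r t y * Tv r y * inner ℝ (gg r f y) c - Tv' r y * inner ℝ (gg' r f f' y) c) := by
  have hr := h.r0
  have ht := h.t0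
  have r2 := pow_pos hr 2
  have r4 := pow_pos hr 4
  have t4 := pow_pos ht 4
  have cg := S.cg
  have cg' := S.cg'
  have cro := h.cro
  have cT := @DD.cT r
  have cT' := @DD.cT' r
  have cZ := S.cZ h
  have cX : ContinuousOn (XX r t f) (Icc 0 (r ^ 2)) := cont_of (fun y hy => S.dX h hy.1 hy.2)
  have cP : Continuous (Pv r t) := by unfold Pv; fun_prop
  obtain ⟨hd1, hd2⟩ := D.le h
  have c1S : Continuous (fun y => 1 / Sv r t y) := Continuous.div kont CP.cS (fun y => (h.Spos y).ne')
  have X := S.X1 h hZ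
  have Tle : ∀ y ∈ Icc 0 (r ^ 2), Tv r y ≤ 1 := fun y hy =>
    (D.T_le h hy.1 (hy.2.trans hd1)).trans (by rw [div_le_one r2]; exact hy.2)
  have C1 := cs_dom r2.le (F := fun y => (2 * ro r t y * Pv r t y * Tv r y + 2 * y * Tv' r y) * inner ℝ (XX r t f y) c)
    (A := fun y => ‖XX r t f y‖) (B := fun _ => 20 * ‖c‖) (α := 2 * s / r ^ 2) (β := 20 * ‖c‖ * r)
    kont kont kont (by positivity) (by positivity) (by
      intro y hy
      have y0 := hy.1
      have hp := h.Ppos hy.1 hy.2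
      have q := abs_real_inner_le_norm (XX r t f y) c
      have q0 := D.T_nn h hy.1 (hy.2.trans hd1)
      have q1 := Tle y hy
      have q2 := h.ro_P hy.1 hy.2
      have q3 := h.ro_nn hy.1 hy.2
      have q4 := D.T'_abs h hy.1 (hy.2.trans hd1)
      have b1 : |2 * ro r t y * Pv r t y * Tv r y| ≤ 2 := by
        rw [abs_of_nonneg (by positivity)]
        have : (ro r t y * Pv r t y) * Tv r y ≤ 1 := mul_le_one₀ q2 q0 q1
        linarith only [this]
      have b2 : |2 * y * Tv' r y| ≤ 18 := by
        rw [abs_mul, abs_of_nonneg (by positivity)]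
        calc _ ≤ 2 * r ^ 2 * (9 / r ^ 2) := by gcongr; exact hy.2
          _ = _ := by field_simp; norm_num
      have b3 := abs_add_le (2 * ro r t y * Pv r t y * Tv r y) (2 * y * Tv' r y)
      rw [abs_mul]
      calc _ ≤ 20 * (‖XX r t f y‖ * ‖c‖) := by gcongr; linarith
        _ = _ := by ring) X (by
      rw [intervalIntegral.integral_const, smul_eq_mul]; apply le_of_eq; ring)
  have C2 := cs_dom r2.le (F := fun y => Tv' r y * inner ℝ (ZZ r t f f' y) c) (A := fun y => ‖ZZ r t f f' y‖)
    (B := fun y => 9 / r ^ 2 * ‖c‖) (α := s) (β := 9 * (‖c‖ / r)) kont kont kont (by positivity) (by positivity) (by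
      intro y hy
      have q := abs_real_inner_le_norm (ZZ r t f f' y) c
      have q1 := D.T'_abs h hy.1 (hy.2.trans hd1)
      rw [abs_mul]
      calc _ ≤ 9 / r ^ 2 * (‖ZZ r t f f' y‖ * ‖c‖) := by gcongr
        _ = _ := by ring) hZ (by
      rw [intervalIntegral.integral_const, smul_eq_mul]
      apply le_of_eq; field_simp; ring)
  have I0 : (∫ y in (0:ℝ)..(r ^ 2), (2 * Tv r y + 2 * y * Tv' r y)) = 2 * r ^ 2 := by
    rw [ftc r2.le (G := fun y => 2 * y * Tv r y) (fun y _ => by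
      have := ((hasDerivAt_id y).const_mul 2).mul (DD.dT h y)
      refine this.congr_deriv ?_
      simp only [id]; ring) kont]
    rw [DD.Ta h]; ring
  have main := int_le4 r2.le (F := fun y => -(2 * ro r t y * Tv r y * inner ℝ (gg r f y) c - Tv' r y * inner ℝ (gg' r f f' y) c))
    (G := fun y => 2 * Tv r y + 2 * y * Tv' r y) (H := fun y => 1 / Sv r t y)
    (K := fun y => (2 * ro r t y * Pv r t y * Tv r y + 2 * y * Tv' r y) * inner ℝ (XX r t f y) c) (J := fun y => Tv' r y * inner ℝ (ZZ r t f f' y) c)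
    (α := -‖c‖ ^ 2) (β := 2 * t ^ 4 * ‖c‖ ^ 2) (γ := -1) (θ := 1) kont kont c1S.continuousOn kont kont (by
      intro y hy
      have hS := h.Spos y
      have q0 := D.T_nn h hy.1 (hy.2.trans hd1)
      have q1 := Tle y hy
      have q3 := h.ro_nn hy.1 hy.2
      rw [gX h hy.1 hy.2, gX' h hy.1 hy.2, ← hc, inner_smul_left, inner_sub_left, inner_smul_left, inner_add_left, real_inner_self_eq_norm_sq]
      simp only [conj_trivial]
      have o := h.one_sub y
      have b : 1 - ro r t y * Pv r t y ≤ t ^ 4 * (1 / Sv r t y) := by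
        have : ro r t y * Pv r t y = ro r t y * (r ^ 4 - y ^ 2) + ro r t y * (t ^ 4 / r ^ 4) := by unfold Pv; ring
        have : 0 ≤ ro r t y * (t ^ 4 / r ^ 4) := by positivity
        rw [mul_one_div]
        linarith
      have b2 : (1 - ro r t y * Pv r t y) * Tv r y ≤ t ^ 4 * (1 / Sv r t y) := by
        calc _ ≤ t ^ 4 * (1 / Sv r t y) * Tv r y := by gcongr
          _ ≤ t ^ 4 * (1 / Sv r t y) * 1 := by gcongr
          _ = _ := by ring
      have b3 := mul_le_mul_of_nonneg_right b2 (sq_nonneg ‖c‖)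
      linarith only [b3])
  rw [I0, intervalIntegral.integral_neg] at main
  have hI := (int_split (F := fun y => 1 / Sv r t y) r2.le hd1 c1S.continuousOn).symm
  have hJ := h.int_half hd1
  have hN : 0 ≤ ∫ y in (r ^ 2)..d, 1 / Sv r t y := int_nn hd1 (fun y _ => by have := h.Spos y; positivity)
  have B1 : 2 * t ^ 4 * ‖c‖ ^ 2 * (∫ y in (0:ℝ)..(r ^ 2), 1 / Sv r t y) ≤ 1 / 10 * r ^ 2 * ‖c‖ ^ 2 := by
    calc _ ≤ 2 * t ^ 4 * ‖c‖ ^ 2 * (4 / (r ^ 2 * t ^ 2)) := by gcongr; linarith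
      _ = 8 * ‖c‖ ^ 2 / r ^ 2 * t ^ 2 := by field_simp; ring
      _ ≤ 8 * ‖c‖ ^ 2 / r ^ 2 * (1 / 10 ^ 24 * r ^ 4) := by have := h.t2_le'; gcongr
      _ = 8 / 10 ^ 24 * (r ^ 2 * ‖c‖ ^ 2) := by field_simp
      _ ≤ 1 / 10 * (r ^ 2 * ‖c‖ ^ 2) := by nlinarith only [show 0 ≤ r ^ 2 * ‖c‖ ^ 2 by positivity]
      _ = _ := by ring
  have e : 2 * s / r ^ 2 * (20 * ‖c‖ * r) = 40 * (s * (‖c‖ / r)) := by field_simp; ring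
  have a1 := (abs_le.1 C1).1
  have a2 := (abs_le.1 C2).2
  linarith only [main, B1, e, a1, a2]

theorem H5b (S : Sys n k (r ^ 4) Θ w w' f f') (h : CP r t δ) (hn : n = t ^ 3 / r ^ 2) (hΘ : Θ ≤ δ) (L : ‖f (r ^ 2)‖ ≤ 14 * δ * r)
    (hk : k * r ^ 2 ≤ 1 / 2) (hs : 0 ≤ s) (hds : 10 ^ 6 * δ ≤ s)
    (hK : k ^ 2 * (∫ y in (0:ℝ)..1, ‖f y‖ ^ 2) ≤ s ^ 2)
    (hO : (∫ y in (r ^ 2)..1, ‖f' y‖ ^ 2) ≤ s ^ 2)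
    (hZ : (∫ y in (0:ℝ)..(r ^ 2), ‖ZZ r t f f' y‖ ^ 2) ≤ s ^ 2) :
    (∫ y in (0:ℝ)..(r ^ 2), ‖f' y‖ ^ 2) ≤ 30000 * s ^ 2 := by
  have hr := h.r0
  have r2 := pow_pos hr 2
  have r4 := pow_pos hr 4
  have d0 := h.d0
  have r2h : r ^ 2 ≤ 1 / 2 := by nlinarith only [hk, S.hk, r2]
  obtain ⟨d, D⟩ : ∃ d, DD r d := by
    refine ⟨√2 * r ^ 2, by positivity, ?_, ?_⟩
    · rw [mul_pow, sq_sqrt (by norm_num)]; ring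
    · have : √2 ≤ 2 := by rw [sqrt_le_left (by norm_num)]; norm_num
      nlinarith only [this, r2h, r2]
  obtain ⟨hd1, hd2⟩ := D.le h
  have cf := S.cF
  have cf' := S.cf
  have cg := S.cg
  have cg' := S.cg'
  have cro := h.cro
  have cT := @DD.cT r
  have cT' := @DD.cT' r
  have cZ := S.cZ h
  have cX : ContinuousOn (XX r t f) (Icc 0 (r ^ 2)) := cont_of (fun y hy => S.dX h hy.1 hy.2)
  set c := cc r t f with hc
  set e := f (r ^ 2) with he
  have j1 := J1 h D
  have j2 := S.J2 h hn hΘ D hk hs hds hK c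
  have ra := S.R1 h D L hs hds hO c
  have rb := S.R2 h D hs hZ hc
  have IT : (∫ y in (0:ℝ)..d, Tv' r y) = 0 := by
    rw [ftc D.d0.le (fun y _ => DD.dT h y) cT'.continuousOn, DD.T0, D.Td h, sub_self]
  have sp := int_split r2.le hd1 (F := fun y => 2 * ro r t y * Tv r y * inner ℝ (gg r f y) c - Tv' r y * inner ℝ (gg' r f f' y) c) kont
  have dec := int_le3 D.d0.le (F := fun y => 2 * ro r t y * Tv r y * inner ℝ (gg r f y) c - Tv' r y * inner ℝ (gg' r f f' y) c)
    (G := fun y => 2 * ro r t y * Tv r y * inner ℝ (f y) c - Tv' r y * inner ℝ (f' y) c) (H := fun y => ro r t y * Tv r y * (y / r ^ 2))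
    (K := fun y => Tv' r y) (α := 1) (β := - 2 * inner ℝ e c) (γ := 1 / r ^ 2 * inner ℝ e c) kont kont kont kont (by
      intro y _
      unfold gg gg'
      rw [inner_sub_left, inner_sub_left, inner_smul_left, inner_smul_left]
      simp only [conj_trivial]
      apply le_of_eq; ring)
  rw [IT] at dec
  have b1 : - 2 * inner ℝ e c * (∫ y in (0:ℝ)..d, ro r t y * Tv r y * (y / r ^ 2)) ≤ 42 * δ * (‖c‖ / r) := by
    have q := abs_real_inner_le_norm e c
    refine (le_abs_self _).trans ?_
    rw [abs_mul, abs_mul]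
    calc _ ≤ 2 * (14 * δ * r * ‖c‖) * (3 / 2 / r ^ 2) := by
          gcongr
          · norm_num
          · exact q.trans (by gcongr)
      _ = _ := by field_simp; ring
  have a1 := (abs_le.1 ra).1
  have v0 : 0 ≤ ‖c‖ / r := by positivity
  have e1 : s * ‖c‖ / r = s * (‖c‖ / r) := by ring
  have b2 : 42 * δ * (‖c‖ / r) ≤ s * (‖c‖ / r) := by gcongr; linarith
  have key : 19 / 10 * r ^ 2 * ‖c‖ ^ 2 ≤ 77 * s * (‖c‖ / r) := by linarith only [j2, dec, b1, sp, rb, a1, e1, b2]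
  have ck : ‖c‖ * r ^ 3 ≤ 41 * s := by
    rcases eq_or_lt_of_le (norm_nonneg c) with h0 | h0
    · rw [← h0]; linarith
    · have : 77 * s * (‖c‖ / r) = ‖c‖ * (77 * s) / r := by ring
      rw [this, le_div_iff₀ hr] at key
      have : ‖c‖ * (19 / 10 * (‖c‖ * r ^ 3)) ≤ ‖c‖ * (77 * s) := by linarith only [key]
      have := le_of_mul_le_mul_left this h0
      linarith
  have ck2 : (‖c‖ * r ^ 3) ^ 2 ≤ (41 * s) ^ 2 := by gcongr
  have X := S.X1 h hZ
  have eb := eb h L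
  have fin := int_le3 r2.le (F := fun y => ‖f' y‖ ^ 2) (G := fun y => ‖ZZ r t f f' y‖ ^ 2) (H := fun y => ‖XX r t f y‖ ^ 2)
    (K := fun _ => (1:ℝ)) (α := 4) (β := 16 * r ^ 4) (γ := 16 * r ^ 4 * ‖c‖ ^ 2 + 4 * (196 * δ ^ 2 / r ^ 2)) kont kont kont kont (by
      intro y hy
      have q : f' y = (ZZ r t f f' y + (1 / r ^ 2) • e) + (-(2 * y)) • (XX r t f y + c) := by
        have := gX' (f := f) (f' := f') h hy.1 hy.2
        have e1 : gg' r f f' y + (1 / r ^ 2) • e = f' y := by unfold gg'; rw [sub_add_cancel]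
        rw [← e1, this, neg_smul]; ring
      rw [q]
      have u1 := norm_add_sq_le2 (ZZ r t f f' y + (1 / r ^ 2) • e) ((-(2 * y)) • (XX r t f y + c))
      have u2 := norm_add_sq_le2 (ZZ r t f f' y) ((1 / r ^ 2) • e)
      have u3 := norm_add_sq_le2 (XX r t f y) c
      rw [norm_rsmul_sq] at u1
      have u4 : (-(2 * y)) ^ 2 ≤ 4 * r ^ 4 := by nlinarith only [hy.1, hy.2]
      have u5 : (-(2 * y)) ^ 2 * ‖XX r t f y + c‖ ^ 2 ≤ 4 * r ^ 4 * (2 * ‖XX r t f y‖ ^ 2 + 2 * ‖c‖ ^ 2) := by gcongr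
      linarith only [u1, u2, u5, eb])
  rw [intervalIntegral.integral_const, smul_eq_mul, mul_one, sub_zero] at fin
  have f1 : 16 * r ^ 4 * (∫ y in (0:ℝ)..(r ^ 2), ‖XX r t f y‖ ^ 2) ≤ 16 * r ^ 4 * (2 * s / r ^ 2) ^ 2 := by gcongr
  have f2 : 16 * r ^ 4 * (2 * s / r ^ 2) ^ 2 = 64 * s ^ 2 := by field_simp; ring
  have f3 : (16 * r ^ 4 * ‖c‖ ^ 2 + 4 * (196 * δ ^ 2 / r ^ 2)) * r ^ 2 = 16 * (‖c‖ * r ^ 3) ^ 2 + 784 * δ ^ 2 := by field_simp; ring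
  have ds : (10 ^ 6 * δ) ^ 2 ≤ s ^ 2 := by gcongr
  nlinarith only [fin, f1, f2, f3, ds, ck2, hZ, sq_nonneg s]

theorem half_final (S : Sys n k (r ^ 4) Θ w w' f f') (h : CP r t δ) (hn : n = t ^ 3 / r ^ 2) (hΘ : Θ ≤ δ) (L : ‖f (r ^ 2)‖ ≤ 14 * δ * r)
    (hs : 0 ≤ s) (hds : 10 ^ 6 * δ ≤ s)
    (hK : k ^ 2 * (∫ y in (0:ℝ)..1, ‖f y‖ ^ 2) ≤ s ^ 2)
    (hO : (∫ y in (r ^ 2)..1, ‖f' y‖ ^ 2) ≤ s ^ 2)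
    (hZ : (∫ y in (0:ℝ)..(r ^ 2), ‖ZZ r t f f' y‖ ^ 2) ≤ s ^ 2) :
    (∫ y in (0:ℝ)..1, ‖f' y‖ ^ 2) ≤ 30001 * s ^ 2 := by
  have cf' := S.cf
  have r21 : r ^ 2 < 1 := pow_lt_one₀ h.r0.le h.r1 two_ne_zero
  have sp := int_split (pow_pos h.r0 2).le r21.le (F := fun y => ‖f' y‖ ^ 2) kont
  have : (∫ y in (0:ℝ)..(r ^ 2), ‖f' y‖ ^ 2) ≤ 30000 * s ^ 2 := by
    rcases le_total (k * r ^ 2) (1 / 2) with hk | hk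
    · exact S.H5b h hn hΘ L hk hs hds hK hO hZ
    · exact S.H5a h L hk hds hK hZ
  linarith

end Sys

namespace Sys
variable {n k Θ A0 r t : ℝ} {w w' f f' : ℝ → ℂ}

theorem caseIII (S : Sys n k (r ^ 4) Θ w w' f f') (h : CP r t (1 / 10 ^ 12)) (hn : n = t ^ 3 / r ^ 2) (hΘ : Θ ≤ 1 / 10 ^ 12) : False := by
  have S' := S.reflect
  have cf := S.cF
  have cf' := S.cf
  have cro := h.cro
  have k1 := S.hk
  have r2 := pow_pos h.r0 2
  have r21 : r ^ 2 < 1 := pow_lt_one₀ h.r0.le h.r1 two_ne_zero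
  have L := S.L1 h hn hΘ
  have L' := S'.L1 h hn hΘ
  have L4 := S.L4 h hn hΘ
  have L5 := S.L5 h L
  have L5' := S'.L5 h L'
  have hf := S.half_final h hn hΘ L (s := 6 / 10 ^ 5) (by norm_num) (by norm_num)
  have hf' := S'.half_final h hn hΘ L' (s := 6 / 10 ^ 5) (by norm_num) (by norm_num)
  have M := S.M1
  simp only [norm_neg] at L5' hf'
  have roe : ∀ y, ro r t (-y) = ro r t y := fun y => by unfold ro Sv; rw [neg_sq]
  have h11 : (-1:ℝ) ≤ 0 := by norm_num
  have h01 : (0:ℝ) ≤ 1 := by norm_num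
  have n1 : (∫ y in (0:ℝ)..1, ‖f' (-y)‖ ^ 2) = ∫ y in (-1:ℝ)..0, ‖f' y‖ ^ 2 := by
    rw [intervalIntegral.integral_comp_neg (fun y => ‖f' y‖ ^ 2), neg_zero]
  have n2 : (∫ y in (0:ℝ)..1, ‖f (-y)‖ ^ 2) = ∫ y in (-1:ℝ)..0, ‖f y‖ ^ 2 := by
    rw [intervalIntegral.integral_comp_neg (fun y => ‖f y‖ ^ 2), neg_zero]
  have n3 : (∫ y in (0:ℝ)..1, ro r t y * ‖f (-y)‖ ^ 2) = ∫ y in (-1:ℝ)..0, ro r t y * ‖f y‖ ^ 2 := by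
    have := intervalIntegral.integral_comp_neg (a := (0:ℝ)) (b := 1) (fun y => ro r t y * ‖f y‖ ^ 2)
    simp only [roe, neg_zero] at this
    exact this
  rw [n1, n3] at L5'
  rw [n1, n2] at hf'
  have s1 := int_split h11 h01 (F := fun y => ‖f' y‖ ^ 2) kont
  have s2 := int_split h11 h01 (F := fun y => ‖f y‖ ^ 2) kont
  have s3 := int_split h11 h01 (F := fun y => ro r t y * ‖f y‖ ^ 2) kont
  rw [int_add (by norm_num) kont kont, icm] at L4 M
  have p1 : 0 ≤ ∫ y in (r ^ 2)..1, ‖f' y‖ ^ 2 := int_nn r21.le (fun y _ => by positivity)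
  have p2 : 0 ≤ ∫ y in (r ^ 2)..1, ‖f' (-y)‖ ^ 2 := int_nn r21.le (fun y _ => by positivity)
  have p3 : 0 ≤ ∫ y in (0:ℝ)..(r ^ 2), ‖ZZ r t f f' y‖ ^ 2 := int_nn r2.le (fun y _ => by positivity)
  have p4 : 0 ≤ ∫ y in (0:ℝ)..(r ^ 2), ‖ZZ r t (fun y => f (-y)) (fun y => - f' (-y)) y‖ ^ 2 := int_nn r2.le (fun y _ => by positivity)
  have p5 : 0 ≤ k ^ 2 * ∫ y in (0:ℝ)..1, ‖f y‖ ^ 2 := mul_nonneg (sq_nonneg k) (int_nn h01 (fun y _ => by positivity))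
  have p6 : 0 ≤ k ^ 2 * ∫ y in (-1:ℝ)..0, ‖f y‖ ^ 2 := mul_nonneg (sq_nonneg k) (int_nn h11 (fun y _ => by positivity))
  rw [s1, s2, mul_add] at L4 M
  rw [s3] at L4
  norm_num at L4 L5 L5' hf hf' p1 p2 p3 p4 p5 p6 M
  have hf := hf (by linarith) (by linarith) (by linarith)
  have hf' := hf' (by linarith) (by linarith) (by linarith)
  linarith

theorem contra (S : Sys n k A0 Θ w w' f f') (hΘ : Θ ≤ 1 / 10 ^ 39) : False := by
  have hn := S.hn
  have hΘ0 := S.hΘ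
  set m := √n with hm
  have m0 : 0 < m := sqrt_pos.2 hn
  have m2 : n = m ^ 2 := (sq_sqrt hn.le).symm
  rcases le_or_gt (1 - m) A0 with h1 | h1
  · exact caseI S m0 m2 h1 (hΘ.trans (by norm_num))
  rcases le_or_gt A0 ((2 * 10 ^ 36) / 2 * n) with h2 | h2
  · refine caseII S m0 m2 (by norm_num) h2 ?_
    linarith
  have A0p : 0 < A0 := lt_trans (by positivity) h2
  set r := √(√A0) with hr
  have r0 : 0 < r := sqrt_pos.2 (sqrt_pos.2 A0p)
  have r4 : r ^ 4 = A0 := by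
    have : r ^ 4 = (r ^ 2) ^ 2 := by ring
    rw [this, sq_sqrt (sqrt_nonneg _), sq_sqrt A0p.le]
  set t := (n * r ^ 2) ^ ((1:ℝ) / 3) with ht
  have t0 : 0 < t := rpow_pos_of_pos (by positivity) _
  have t3 : t ^ 3 = n * r ^ 2 := by
    rw [ht, ← rpow_natCast, ← rpow_mul (by positivity)]; norm_num
  have r1 : r ^ 4 ≤ 1 := by linarith
  have r21 : r ^ 2 ≤ 1 := by
    have : r ≤ 1 := by
      by_contra hh
      push Not at hh
      have := one_lt_pow₀ hh (n := 4) (by norm_num)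
      linarith
    exact pow_le_one₀ r0.le this
  have S2 : Sys n k (r ^ 4) Θ w w' f f' := by rw [r4]; exact S
  refine S2.caseIII (r := r) (t := t) ⟨t0, r0, ?_, ?_, by norm_num, le_rfl⟩ ?_ (hΘ.trans (by norm_num))
  · apply le_of_pow_le_pow_left₀ (n := 3) (by norm_num) (by positivity)
    rw [t3]
    have : n ≤ 1 / 10 ^ 36 * r ^ 4 := by linarith
    calc n * r ^ 2 ≤ (1 / 10 ^ 36 * r ^ 4) * r ^ 2 := by gcongr
      _ = _ := by ring
  · have : t ^ 2 ≤ m := by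
      apply le_of_pow_le_pow_left₀ (n := 3) (by norm_num) (by positivity)
      have e : (t ^ 2) ^ 3 = (n * r ^ 2) ^ 2 := by rw [← t3]; ring
      rw [e]
      have m1 : m ≤ 1 := by rw [hm]; exact sqrt_le_one.2 S.hn1
      calc (n * r ^ 2) ^ 2 ≤ (n * 1) ^ 2 := by gcongr
        _ = m ^ 3 * m := by rw [m2]; ring
        _ ≤ m ^ 3 * 1 := by gcongr
        _ = _ := by ring
    linarith
  · rw [t3]; field_simp
end Sys

/-- multiplication by `σ i` -/
def jj (σ : ℝ) (a : ℂ) : ℂ := ((σ : ℂ) * Complex.I) * a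

theorem jj_eq (σ : ℝ) (a b : ℂ) : inner ℝ (jj σ a) b = σ * (a.re * b.im - a.im * b.re) := by
  unfold jj
  rw [Complex.inner]
  simp
  ring

theorem jj_eq2 (σ : ℝ) (a b : ℂ) : inner ℝ a (jj σ b) = σ * (a.im * b.re - a.re * b.im) := by
  rw [real_inner_comm, jj_eq]; ring

theorem jj_self (σ : ℝ) (a : ℂ) : inner ℝ (jj σ a) a = 0 := by rw [jj_eq]; ring

theorem jj_left (σ : ℝ) (a b : ℂ) : inner ℝ (jj σ a) b = - inner ℝ a (jj σ b) := by rw [jj_eq, jj_eq2]; ring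

theorem norm_jj {σ : ℝ} (h : σ ^ 2 = 1) (a : ℂ) : ‖jj σ a‖ = ‖a‖ := by
  unfold jj
  rw [norm_mul, norm_mul, Complex.norm_I, mul_one, Complex.norm_real, Real.norm_eq_abs, (sq_eq_one_iff_of_ne_zero' h), one_mul]
where
  sq_eq_one_iff_of_ne_zero' {σ : ℝ} (h : σ ^ 2 = 1) : |σ| = 1 := by
    rwa [sq_eq_one_iff_of_side] at h
  sq_eq_one_iff_of_side {σ : ℝ} : σ ^ 2 = 1 ↔ |σ| = 1 := by
    rw [← sq_abs]; constructor
    · intro h; nlinarith [abs_nonneg σ]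
    · intro h; rw [h]; norm_num

theorem jj_jj {σ : ℝ} (h : σ ^ 2 = 1) (a b : ℂ) : inner ℝ (jj σ a) (jj σ b) = inner ℝ a b := by
  rw [jj_eq, Complex.inner]
  unfold jj
  simp
  linear_combination (a.re * b.re + a.im * b.im) * h

theorem cjj (σ : ℝ) : Continuous (jj σ) := by unfold jj; fun_prop

theorem djj (σ : ℝ) {g : ℝ → ℂ} {g' : ℂ} {y : ℝ} (h : HasDerivAt g g' y) : HasDerivAt (fun y => jj σ (g y)) (jj σ g') y := by
  unfold jj; exact h.const_mul _

theorem ibp {c d k : ℝ} (hcd : c ≤ d) {u u' u'' ψ ψ' : ℝ → ℂ} (hu : ∀ y ∈ Icc c d, HasDerivAt u' (u'' y) y)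
    (hψ : ∀ y ∈ Icc c d, HasDerivAt ψ (ψ' y) y) (cu : ContinuousOn u (Icc c d)) (cu'' : ContinuousOn u'' (Icc c d))
    (cψ' : ContinuousOn ψ' (Icc c d)) (hc : ψ c = 0) (hd : ψ d = 0) :
    (∫ y in c..d, inner ℝ (u'' y - (k ^ 2) • u y) (ψ y)) = - ∫ y in c..d, (inner ℝ (u' y) (ψ' y) + k ^ 2 * inner ℝ (u y) (ψ y)) := by
  have cu' := cont_of hu
  have cψ := cont_of hψ
  have F := ftc hcd (G := fun y => inner ℝ (u' y) (ψ y)) (G' := fun y => inner ℝ (u' y) (ψ' y) + inner ℝ (u'' y) (ψ y))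
    (fun y hy => (hu y hy).inner ℝ (hψ y hy)) kont
  simp only [hc, hd, inner_zero_right, sub_zero] at F
  rw [← sub_eq_zero, sub_neg_eq_add, ← int_add hcd kont kont, ← F]
  apply int_cg hcd
  intro y _
  rw [inner_sub_left, inner_smul_left]
  simp only [conj_trivial]
  ring

structure Base (σ n k A0 ε : ℝ) (w w' w'' φ φ' φ'' G G' : ℝ → ℂ) : Prop where
  hσ : σ ^ 2 = 1
  hn : 0 < n
  hn1 : n ≤ 1
  hk : 1 ≤ k
  hε : 0 ≤ ε
  dw : ∀ y, HasDerivAt w (w' y) y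
  dw' : ∀ y, HasDerivAt w' (w'' y) y
  dφ : ∀ y, HasDerivAt φ (φ' y) y
  dφ' : ∀ y, HasDerivAt φ' (φ'' y) y
  dG : ∀ y, HasDerivAt G (G' y) y
  cw'' : Continuous w''
  cφ'' : Continuous φ''
  cG' : Continuous G'
  w0 : w (-1) = 0
  w1 : w 1 = 0
  φ0 : φ (-1) = 0
  φ1 : φ 1 = 0
  G0 : G (-1) = 0
  G1 : G 1 = 0
  eqn : ∀ y ∈ Icc (-1:ℝ) 1, (A0 - y ^ 2) • w y + (2:ℝ) • φ y = jj σ (G y + (n ^ 2) • (w'' y - (k ^ 2) • w y) + (ε * n) • w y)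
  lap : ∀ y ∈ Icc (-1:ℝ) 1, φ'' y - (k ^ 2) • φ y = w y

theorem c_of {g g' : ℝ → ℂ} (h : ∀ y, HasDerivAt g (g' y) y) : Continuous g :=
  continuous_iff_continuousAt.2 fun y => (h y).continuousAt

namespace Base
variable {σ n k A0 ε : ℝ} {w w' w'' φ φ' φ'' G G' : ℝ → ℂ}

theorem scale (B : Base σ n k A0 ε w w' w'' φ φ' φ'' G G') (c : ℝ) :
    Base σ n k A0 ε (fun y => c • w y) (fun y => c • w' y) (fun y => c • w'' y) (fun y => c • φ y) (fun y => c • φ' y) (fun y => c • φ'' y)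
      (fun y => c • G y) (fun y => c • G' y) := by
  have := B.cw''
  have := B.cφ''
  have := B.cG'
  refine ⟨B.hσ, B.hn, B.hn1, B.hk, B.hε, fun y => (B.dw y).const_smul c, fun y => (B.dw' y).const_smul c, fun y => (B.dφ y).const_smul c,
    fun y => (B.dφ' y).const_smul c, fun y => (B.dG y).const_smul c, kont, kont, kont, by simp [B.w0], by simp [B.w1],
    by simp [B.φ0], by simp [B.φ1], by simp [B.G0], by simp [B.G1], ?_, ?_⟩
  · intro y hy
    have e := congrArg (fun z => c • z) (B.eqn y hy)
    unfold jj at e ⊢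
    simp only [Complex.real_smul] at e ⊢
    linear_combination e
  · intro y hy
    rw [← B.lap y hy]
    simp only [Complex.real_smul]; ring

/-- pairing of `w` with a test function -/
theorem pw (B : Base σ n k A0 ε w w' w'' φ φ' φ'' G G') {c d : ℝ} (h1 : -1 ≤ c) (hcd : c ≤ d) (h2 : d ≤ 1) {ψ ψ' : ℝ → ℂ}
    (hψ : ∀ y ∈ Icc c d, HasDerivAt ψ (ψ' y) y) (cψ' : ContinuousOn ψ' (Icc c d)) (hc : ψ c = 0) (hd : ψ d = 0) :
    (∫ y in c..d, inner ℝ (w y) (ψ y)) = - ∫ y in c..d, (inner ℝ (φ' y) (ψ' y) + k ^ 2 * inner ℝ (φ y) (ψ y)) := by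
  rw [← ibp hcd (fun y _ => B.dφ' y) hψ (c_of B.dφ).continuousOn B.cφ''.continuousOn cψ' hc hd]
  apply int_cg hcd
  intro y hy
  rw [B.lap y ⟨h1.trans hy.1, hy.2.trans h2⟩]

theorem energy (B : Base σ n k A0 ε w w' w'' φ φ' φ'' G G') {U η : ℝ} (hU : 0 ≤ U) (hη : 0 ≤ η)
    (hφ : (∫ y in (-1:ℝ)..1, (‖φ' y‖ ^ 2 + k ^ 2 * ‖φ y‖ ^ 2)) ≤ U ^ 2)
    (hG : (∫ y in (-1:ℝ)..1, (‖G' y‖ ^ 2 + k ^ 2 * ‖G y‖ ^ 2)) ≤ η ^ 2) :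
    ∃ Y, 0 ≤ Y ∧ (∫ y in (-1:ℝ)..1, (‖w' y‖ ^ 2 + k ^ 2 * ‖w y‖ ^ 2)) = (Y / n) ^ 2 ∧ n * (∫ y in (-1:ℝ)..1, ‖w y‖ ^ 2) ≤ Y * U ∧
      Y ^ 2 ≤ η * U + ε * (Y * U) := by
  have h11 : (-1:ℝ) ≤ 1 := by norm_num
  have hn := B.hn
  have hε := B.hε
  have cw := c_of B.dw
  have cw' := c_of B.dw'
  have cφ := c_of B.dφ
  have cφ' := c_of B.dφ'
  have cG := c_of B.dG
  have cw'' := B.cw''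
  have cG' := B.cG'
  have cφ'' := B.cφ''
  have cj := cjj σ
  set E := ∫ y in (-1:ℝ)..1, (‖w' y‖ ^ 2 + k ^ 2 * ‖w y‖ ^ 2) with hE
  have E0 : 0 ≤ E := int_nn h11 (fun y _ => by positivity)
  have hY : E = (n * √E / n) ^ 2 := by rw [mul_div_cancel_left₀ _ hn.ne', sq_sqrt E0]
  have W := B.pw le_rfl h11 le_rfl (fun y _ => B.dw y) cw'.continuousOn B.w0 B.w1
  have W2 := cs_pair (k := k) h11 (A := φ') (B := φ) (P := w') (Q := w) (α := U) (β := √E) kont kont kont kont hU (sqrt_nonneg _) hφ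
    (by rw [sq_sqrt E0])
  simp only [real_inner_self_eq_norm_sq] at W
  have W3 : (∫ y in (-1:ℝ)..1, ‖w y‖ ^ 2) ≤ U * √E := by rw [W]; linarith [(abs_le.1 W2).1]
  have g1 := B.pw le_rfl h11 le_rfl (fun y _ => B.dG y) cG'.continuousOn B.G0 B.G1
  have g2 := cs_pair (k := k) h11 (A := φ') (B := φ) (P := G') (Q := G) (α := U) (β := η) kont kont kont kont hU hη hφ hG
  have z := B.pw le_rfl h11 le_rfl (ψ := fun y => jj σ (φ y)) (ψ' := fun y => jj σ (φ' y)) (fun y _ => djj σ (B.dφ y)) kont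
    (by simp [B.φ0, jj]) (by simp [B.φ1, jj])
  have z0 : (∫ y in (-1:ℝ)..1, inner ℝ (w y) (jj σ (φ y))) = 0 := by
    rw [z]
    have : ∀ a, inner ℝ a (jj σ a) = 0 := fun a => by rw [real_inner_comm, jj_self]
    simp [this]
  have i := ibp (k := k) h11 (fun y _ => B.dw' y) (fun y _ => B.dw y) cw.continuousOn cw''.continuousOn cw'.continuousOn B.w0 B.w1
  simp only [real_inner_self_eq_norm_sq] at i
  have main := int_le4 h11 (F := fun y => - (n ^ 2 * inner ℝ (w'' y - (k ^ 2) • w y) (w y))) (G := fun y => inner ℝ (w y) (G y)) (H := fun y => ‖w y‖ ^ 2)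
    (K := fun y => inner ℝ (w y) (jj σ (φ y))) (J := fun _ => (0:ℝ)) (α := 1) (β := ε * n) (γ := 2) (θ := 0) kont kont kont kont kont (by
      intro y hy
      have e := congrArg (fun z => inner ℝ z (jj σ (w y))) (B.eqn y hy)
      simp only [jj_jj B.hσ, inner_add_left, inner_smul_left, conj_trivial, real_inner_self_eq_norm_sq] at e
      have e1 : inner ℝ (w y) (jj σ (w y)) = 0 := by rw [real_inner_comm, jj_self]
      have e2 : inner ℝ (φ y) (jj σ (w y)) = - inner ℝ (w y) (jj σ (φ y)) := by rw [real_inner_comm, jj_left]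
      have e3 := real_inner_comm (w y) (G y)
      rw [e1, e2] at e
      linarith only [e, e3])
  rw [intervalIntegral.integral_neg, icm, i, z0, g1] at main
  have g3 := (abs_le.1 g2).1
  refine ⟨n * √E, by positivity, hY, ?_, ?_⟩
  · calc _ ≤ n * (U * √E) := by gcongr
      _ = _ := by ring
  · have e4 : ε * n * (∫ y in (-1:ℝ)..1, ‖w y‖ ^ 2) ≤ ε * n * (U * √E) := by gcongr
    rw [mul_pow, sq_sqrt E0]
    rw [← hE] at main
    linarith only [main, e4, g3]

end Base

namespace Base
variable {σ n k A0 ε : ℝ} {w w' w'' φ φ' φ'' G G' : ℝ → ℂ}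

theorem toFalse (B : Base σ n k A0 ε w w' w'' φ φ' φ'' G G') {η : ℝ} (hη : 0 ≤ η) (hη1 : η ≤ 1 / 10 ^ 160) (hε1 : ε ≤ 1 / 10 ^ 160)
    (hφ : (∫ y in (-1:ℝ)..1, (‖φ' y‖ ^ 2 + k ^ 2 * ‖φ y‖ ^ 2)) = 1)
    (hG : (∫ y in (-1:ℝ)..1, (‖G' y‖ ^ 2 + k ^ 2 * ‖G y‖ ^ 2)) ≤ η ^ 2) : False := by
  have h11 : (-1:ℝ) ≤ 1 := by norm_num
  have hn := B.hn
  have hε := B.hε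
  have cw := c_of B.dw
  have cw' := c_of B.dw'
  have cφ := c_of B.dφ
  have cφ' := c_of B.dφ'
  have cG := c_of B.dG
  have cw'' := B.cw''
  have cG' := B.cG'
  have cj := cjj σ
  have j0 : jj σ 0 = 0 := by simp [jj]
  obtain ⟨Y, hY, y1, y2, y3⟩ := B.energy (U := 1) (by norm_num) hη (by rw [hφ]; norm_num) hG
  have hY1 : Y ≤ (1 / 10 ^ 39) ^ 2 := by
    by_contra hc
    push Not at hc
    have a1 : (1 / 10 ^ 39) ^ 2 * Y ≤ Y ^ 2 := by nlinarith
    have a2 : ε * Y ≤ 1 / 10 ^ 160 * Y := by gcongr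
    have a3 : (1 / 10 ^ 160 : ℝ) ≤ 1 / 10 ^ 4 * ((1 / 10 ^ 39) ^ 2 * (1 / 10 ^ 39) ^ 2) := by norm_num
    have a6 : (1 / 10 ^ 160 : ℝ) ≤ 1 / 10 ^ 4 * (1 / 10 ^ 39) ^ 2 := by norm_num
    have a4 : (0:ℝ) < (1 / 10 ^ 39) ^ 2 := by positivity
    generalize (1 / 10 ^ 39 : ℝ) ^ 2 = a at *
    generalize (1 / 10 ^ 160 : ℝ) = b at *
    have a5 : b * Y ≤ 1 / 10 ^ 4 * a * Y := by gcongr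
    linarith only [a1, a2, a3, a4, a5, y3, hη1, hc, mul_lt_mul_of_pos_left hc a4, mul_pos a4 a4]
  have hη2 : η ^ 2 ≤ 1 / 4 := by
    have : η ≤ 1 / 2 := hη1.trans (by norm_num)
    nlinarith
  have eq2 : ∀ y ∈ Icc (-1:ℝ) 1, ∀ z : ℂ, (A0 - y ^ 2) * inner ℝ (w y) z + 2 * inner ℝ (φ y - (1 / 2 : ℝ) • jj σ (G y)) z
      = - (n ^ 2 * inner ℝ (w'' y - (k ^ 2) • w y) (jj σ z) + (ε * n) * inner ℝ (w y) (jj σ z)) := by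
    intro y hy z
    have e := congrArg (fun x => inner ℝ x z) (B.eqn y hy)
    simp only [jj_left, inner_add_left, inner_sub_left, inner_smul_left, conj_trivial] at e ⊢
    linarith
  have res : ∀ {c d : ℝ} {α : ℝ} {u v : ℝ → ℂ}, -1 ≤ c → c ≤ d → d ≤ 1 → Continuous u → Continuous v →
      (∫ y in (-1:ℝ)..1, (‖u y‖ ^ 2 + k ^ 2 * ‖v y‖ ^ 2)) ≤ α → (∫ y in c..d, (‖u y‖ ^ 2 + k ^ 2 * ‖v y‖ ^ 2)) ≤ α := by
    intro c d α u v a b e cu cv h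
    exact (int_sub a b e kont (fun y _ => by positivity)).trans h
  have P4 : ∀ (R : ℝ) (q q' : ℝ → ℝ), (∀ y ∈ Icc (-1:ℝ) 1, HasDerivAt q (q' y) y) →
    ContinuousOn q' (Icc (-1:ℝ) 1) → 0 ≤ R →
    (∫ y in (-1:ℝ)..1, ‖w y‖ ^ 2 * (q' y) ^ 2) ≤ R ^ 2 →
    |∫ y in (-1:ℝ)..1, q y * ((A0 - y ^ 2) * ‖w y‖ ^ 2 + 2 * inner ℝ (φ y - (1 / 2 : ℝ) • jj σ (G y)) (w y))| ≤ n * Y * R := by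
    intro R q q' hq cq' hR h
    have cq := cont_ofR hq
    have js : ∀ a, inner ℝ a (jj σ a) = 0 := fun a => by rw [real_inner_comm, jj_self]
    have e1 : (∫ y in (-1:ℝ)..1, q y * ((A0 - y ^ 2) * ‖w y‖ ^ 2 + 2 * inner ℝ (φ y - (1 / 2 : ℝ) • jj σ (G y)) (w y)))
        = n ^ 2 * ∫ y in (-1:ℝ)..1, - (q y * inner ℝ (w'' y) (jj σ (w y))) := by
      rw [← icm]
      apply int_cg h11
      intro y hy
      have e := eq2 y hy (w y)
      rw [real_inner_self_eq_norm_sq] at e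
      simp only [inner_sub_left (w'' y), inner_smul_left (w y), js] at e
      rw [e]; simp; ring
    have F := ftc h11 (G := fun y => q y * inner ℝ (w' y) (jj σ (w y)))
      (G' := fun y => q' y * inner ℝ (w' y) (jj σ (w y)) + q y * (inner ℝ (w' y) (jj σ (w' y)) + inner ℝ (w'' y) (jj σ (w y))))
      (fun y hy => (hq y hy).mul ((B.dw' y).inner ℝ (djj σ (B.dw y)))) kont
    simp only [B.w0, B.w1, j0, inner_zero_right, mul_zero, sub_zero, js, zero_add] at F
    rw [int_add h11 kont kont] at F
    rw [e1, intervalIntegral.integral_neg]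
    have C := cs_dom h11 (F := fun y => q' y * inner ℝ (w' y) (jj σ (w y))) (A := fun y => ‖w' y‖) (B := fun y => ‖w y‖ * |q' y|) (α := Y / n) (β := R)
      kont kont kont (by positivity) hR (by
        intro y _
        rw [abs_mul]
        have := abs_real_inner_le_norm (w' y) (jj σ (w y))
        rw [norm_jj B.hσ] at this
        calc _ ≤ |q' y| * (‖w' y‖ * ‖w y‖) := by gcongr
          _ = _ := by ring) (by
        rw [← y1]
        exact int_le h11 kont kont (fun y _ => le_add_of_nonneg_right (by positivity))) (by
        simpa only [mul_pow, sq_abs] using h)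
    rw [show -(∫ y in (-1:ℝ)..1, q y * inner ℝ (w'' y) (jj σ (w y))) = ∫ y in (-1:ℝ)..1, q' y * inner ℝ (w' y) (jj σ (w y)) by linarith, abs_mul, abs_of_nonneg (sq_nonneg n)]
    calc _ ≤ n ^ 2 * (Y / n * R) := by gcongr
      _ = _ := by field_simp
  have hGn : (∫ y in (-1:ℝ)..1, (‖jj σ (G' y)‖ ^ 2 + k ^ 2 * ‖jj σ (G y)‖ ^ 2)) ≤ η ^ 2 := by simpa only [norm_jj B.hσ] using hG
  have S : Sys n k A0 (1 / 10 ^ 39) w w' (fun y => φ y - (1 / 2 : ℝ) • jj σ (G y)) (fun y => φ' y - (1 / 2 : ℝ) • jj σ (G' y)) := by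
    refine ⟨hn, B.hn1, B.hk, by norm_num, B.dw, fun y => (B.dφ y).sub ((djj σ (B.dG y)).const_smul (1 / 2 : ℝ)), cw', kont, B.w0, B.w1,
      by simp [B.φ0, B.G0, j0], by simp [B.φ1, B.G1, j0], ?_, ?_, ?_, ?_, ?_, ?_, ?_⟩
    · intro c d R ψ ψ' hc hcd hd dψ cψ' ψc ψd hR h
      have cψ := cont_of dψ
      have p := B.pw hc hcd hd dψ cψ' ψc ψd
      have C := cs_pair (k := k) hcd (A := fun y => jj σ (G' y)) (B := fun y => jj σ (G y)) (P := ψ') (Q := ψ) (α := η) (β := R)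
        kont kont kont kont hη hR (res hc hcd hd kont kont hGn) h
      have e : (∫ y in c..d, (inner ℝ (w y) (ψ y) + inner ℝ (φ' y - (1 / 2 : ℝ) • jj σ (G' y)) (ψ' y) + k ^ 2 * inner ℝ (φ y - (1 / 2 : ℝ) • jj σ (G y)) (ψ y)))
          = - (1 / 2) * ∫ y in c..d, (inner ℝ (jj σ (G' y)) (ψ' y) + k ^ 2 * inner ℝ (jj σ (G y)) (ψ y)) := by
        rw [← icm, ← sub_eq_zero, ← int_min hcd kont kont, show (0:ℝ) = (∫ y in c..d, inner ℝ (w y) (ψ y)) + ∫ y in c..d, (inner ℝ (φ' y) (ψ' y) + k ^ 2 * inner ℝ (φ y) (ψ y)) by rw [p]; ring,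
          ← int_add hcd kont kont]
        apply int_cg hcd
        intro y _
        simp only [inner_sub_left, inner_smul_left, conj_trivial]
        ring
      rw [e, abs_mul, show |-(1 / 2 : ℝ)| = 1 / 2 by norm_num [abs_of_neg]]
      have : η ≤ 1 / 10 ^ 39 := hη1.trans (by norm_num)
      have := mul_le_mul_of_nonneg_right this hR
      have : 0 ≤ η * R := by positivity
      linarith
    · intro c d R ψ ψ' hc hcd hd dψ cψ' ψc ψd hR h
      have cψ := cont_of dψ
      have dJ : ∀ y ∈ Icc c d, HasDerivAt (fun y => jj σ (ψ y)) (jj σ (ψ' y)) y := fun y hy => djj σ (dψ y hy)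
      have cJ : ContinuousOn (fun y => jj σ (ψ y)) (Icc c d) := kont
      have cJ' : ContinuousOn (fun y => jj σ (ψ' y)) (Icc c d) := kont
      have p := B.pw hc hcd hd dJ cJ' (by simp [ψc, j0]) (by simp [ψd, j0])
      have i := ibp (k := k) hcd (fun y _ => B.dw' y) dJ cw.continuousOn cw''.continuousOn cJ' (by simp [ψc, j0]) (by simp [ψd, j0])
      have hJ : (∫ y in c..d, (‖jj σ (ψ' y)‖ ^ 2 + k ^ 2 * ‖jj σ (ψ y)‖ ^ 2)) ≤ R ^ 2 := by simpa only [norm_jj B.hσ] using h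
      have C1 := cs_pair (k := k) hcd (A := w') (B := w) (α := Y / n) (β := R)
        kont kont cJ' cJ (by positivity) hR (res hc hcd hd kont kont y1.le) hJ
      have C2 := cs_pair (k := k) hcd (A := φ') (B := φ) (α := 1) (β := R)
        kont kont cJ' cJ (by positivity) hR (res hc hcd hd kont kont (by rw [hφ]; norm_num)) hJ
      rw [int_cg hcd (fun y hy => eq2 y ⟨hc.trans hy.1, hy.2.trans hd⟩ (ψ y)), intervalIntegral.integral_neg, int_add hcd kont kont,
        icm, icm, i, p, abs_neg]
      refine (abs_add_le _ _).trans ?_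
      rw [abs_mul, abs_mul, abs_neg, abs_neg, abs_of_nonneg (sq_nonneg n), abs_of_nonneg (by positivity : 0 ≤ ε * n)]
      calc _ ≤ n ^ 2 * (Y / n * R) + ε * n * (1 * R) := by gcongr
        _ = (Y + ε) * n * R := by field_simp
        _ ≤ _ := by
          have : Y + ε ≤ 1 / 10 ^ 39 := by
            refine (add_le_add hY1 hε1).trans (by norm_num)
          gcongr
    · calc _ ≤ (Y / n) ^ 2 := by
            rw [← y1]
            exact int_le h11 kont kont (fun y _ => le_add_of_nonneg_right (by positivity))
        _ ≤ _ := by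
          have : Y ≤ 1 / 10 ^ 39 := hY1.trans (by norm_num)
          gcongr
    · rw [le_div_iff₀ hn]
      linarith
    · intro R q q' hq cq' hR h
      refine (P4 R q q' hq cq' hR h).trans ?_
      have : Y ≤ 1 / 10 ^ 39 := hY1.trans (by norm_num)
      gcongr
    · have := int_le2 h11 (F := fun y => ‖φ' y‖ ^ 2 + k ^ 2 * ‖φ y‖ ^ 2) (G := fun y => ‖φ' y - (1 / 2 : ℝ) • jj σ (G' y)‖ ^ 2 + k ^ 2 * ‖φ y - (1 / 2 : ℝ) • jj σ (G y)‖ ^ 2)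
        (H := fun y => ‖G' y‖ ^ 2 + k ^ 2 * ‖G y‖ ^ 2) (α := 2) (β := 1 / 2) kont kont kont (by
          intro y _
          have a1 := norm_add_sq_le2 (φ' y - (1 / 2 : ℝ) • jj σ (G' y)) ((1 / 2 : ℝ) • jj σ (G' y))
          have a2 := norm_add_sq_le2 (φ y - (1 / 2 : ℝ) • jj σ (G y)) ((1 / 2 : ℝ) • jj σ (G y))
          rw [sub_add_cancel, norm_rsmul_sq, norm_jj B.hσ] at a1 a2
          have := mul_le_mul_of_nonneg_left a2 (sq_nonneg k)
          linarith)
      rw [hφ] at this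
      linarith only [this, hG, hη2]
    · have := int_le2 h11 (H := fun y => ‖φ' y‖ ^ 2 + k ^ 2 * ‖φ y‖ ^ 2) (F := fun y => ‖φ' y - (1 / 2 : ℝ) • jj σ (G' y)‖ ^ 2 + k ^ 2 * ‖φ y - (1 / 2 : ℝ) • jj σ (G y)‖ ^ 2)
        (G := fun y => ‖G' y‖ ^ 2 + k ^ 2 * ‖G y‖ ^ 2) (α := 1 / 2) (β := 2) kont kont kont (by
          intro y _
          have a1 := norm_comb_sq 1 (-(1/2)) (φ' y) (jj σ (G' y))
          have a2 := norm_comb_sq 1 (-(1/2)) (φ y) (jj σ (G y))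
          rw [one_smul, neg_smul, ← sub_eq_add_neg, norm_jj B.hσ] at a1 a2
          have := mul_le_mul_of_nonneg_left a2 (sq_nonneg k)
          linarith)
      rw [hφ] at this
      linarith only [this, hG, hη2]
  exact S.contra le_rfl

end Base

namespace Base
variable {σ n k A0 ε : ℝ} {w w' w'' φ φ' φ'' G G' : ℝ → ℂ}

theorem int_scale (c k : ℝ) (u v : ℝ → ℂ) : (∫ y in (-1:ℝ)..1, (‖c • u y‖ ^ 2 + k ^ 2 * ‖c • v y‖ ^ 2)) =
    c ^ 2 * ∫ y in (-1:ℝ)..1, (‖u y‖ ^ 2 + k ^ 2 * ‖v y‖ ^ 2) := by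
  rw [← icm]
  congr 1; ext y
  rw [norm_rsmul_sq, norm_rsmul_sq]; ring

theorem bdU (B : Base σ n k A0 ε w w' w'' φ φ' φ'' G G') {U η : ℝ} (hU : 0 ≤ U) (hη : 0 ≤ η) (hε1 : ε ≤ 1 / 10 ^ 160)
    (hφ : (∫ y in (-1:ℝ)..1, (‖φ' y‖ ^ 2 + k ^ 2 * ‖φ y‖ ^ 2)) = U ^ 2)
    (hG : (∫ y in (-1:ℝ)..1, (‖G' y‖ ^ 2 + k ^ 2 * ‖G y‖ ^ 2)) ≤ η ^ 2) : U ≤ 10 ^ 160 * η := by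
  by_contra hc
  push Not at hc
  have h0 : 0 < U := lt_of_le_of_lt (by positivity) hc
  refine (B.scale U⁻¹).toFalse (η := U⁻¹ * η) (by positivity) ?_ hε1 ?_ ?_
  · rw [inv_mul_le_iff₀ h0]
    linarith
  · rw [int_scale, hφ]; field_simp
  · rw [int_scale, mul_pow]; gcongr

/-- pointwise bound by mean plus variation -/
theorem sup_le {H H' : ℝ → ℝ} (hH : ∀ y, HasDerivAt H (H' y) y) (cH' : Continuous H') {y : ℝ} (hy : y ∈ Icc (-1:ℝ) 1) {V : ℝ}
    (hV : (∫ y in (-1:ℝ)..1, |H' y|) ≤ V) : H y ≤ 1 / 2 * (∫ y in (-1:ℝ)..1, H y) + V := by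
  have h11 : (-1:ℝ) ≤ 1 := by norm_num
  have cH : Continuous H := continuous_iff_continuousAt.2 fun y => (hH y).continuousAt
  have key : ∀ z ∈ Icc (-1:ℝ) 1, H y ≤ H z + V := by
    intro z hz
    rcases le_total z y with h | h
    · have f := ftc h (fun x _ => hH x) cH'.continuousOn
      have a : (∫ x in z..y, H' x) ≤ ∫ x in z..y, |H' x| := int_le h kont kont (fun x _ => le_abs_self _)
      have b := int_sub hz.1 h hy.2 (F := fun x => |H' x|) kont (fun x _ => abs_nonneg _)
      linarith
    · have f := ftc h (fun x _ => hH x) cH'.continuousOn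
      have a : (∫ x in y..z, - H' x) ≤ ∫ x in y..z, |H' x| := int_le h kont kont (fun x _ => neg_le_abs _)
      have b := int_sub hy.1 h hz.2 (F := fun x => |H' x|) kont (fun x _ => abs_nonneg _)
      rw [intervalIntegral.integral_neg] at a
      linarith
  have := int_le h11 (F := fun _ => H y) (G := fun z => H z + V) kont kont key
  rw [int_add h11 kont kont] at this
  simp at this
  linarith

theorem final (B : Base σ n k A0 ε w w' w'' φ φ' φ'' G G') {U η m : ℝ} (hU : 0 ≤ U) (hη : 0 ≤ η) (hε1 : ε ≤ 1 / 10 ^ 160)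
    (hφ : (∫ y in (-1:ℝ)..1, (‖φ' y‖ ^ 2 + k ^ 2 * ‖φ y‖ ^ 2)) = U ^ 2)
    (hG : (∫ y in (-1:ℝ)..1, (‖G' y‖ ^ 2 + k ^ 2 * ‖G y‖ ^ 2)) ≤ η ^ 2) (hm : 0 < m) (hmn : m ^ 4 = n) :
    m ^ 4 * √(∫ y in (-1:ℝ)..1, ‖w' y‖ ^ 2) ≤ 2 * (10 ^ 160 * η) ∧ m ^ 2 * √(∫ y in (-1:ℝ)..1, ‖w y‖ ^ 2) ≤ 2 * (10 ^ 160 * η) ∧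
    (∀ y ∈ Icc (-1:ℝ) 1, m * √(‖φ' y‖ ^ 2 + k ^ 2 * ‖φ y‖ ^ 2) ≤ 3 * (10 ^ 160 * η)) ∧ U ≤ 10 ^ 160 * η := by
  have h11 : (-1:ℝ) ≤ 1 := by norm_num
  have hn := B.hn
  have hε := B.hε
  have cw := c_of B.dw
  have cw' := c_of B.dw'
  have cφ := c_of B.dφ
  have cφ' := c_of B.dφ'
  have cφ'' := B.cφ''
  have hUb := B.bdU hU hη hε1 hφ hG
  obtain ⟨Y, hY, y1, y2, y3⟩ := B.energy hU hη hφ.le hG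
  set T := 10 ^ 160 * η with hT
  have T0 : 0 ≤ T := by positivity
  have ηT : η ≤ T := le_mul_of_one_le_left hη (by norm_num)
  clear_value T
  have z2 : (1 / 10 ^ 160 : ℝ) ≤ 1 / 2 := by norm_num
  have YT : Y ≤ 2 * T := by
    by_contra hc
    push Not at hc
    have a1 : η * U ≤ T * T := by gcongr
    have a2 : ε * (Y * U) ≤ 1 / 10 ^ 160 * (Y * T) := by gcongr
    have a3 : 1 / 10 ^ 160 * (Y * T) ≤ 1 / 2 * (Y * T) :=
      mul_le_mul_of_nonneg_right z2 (by positivity)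
    nlinarith only [a1, a2, a3, y3, hc, T0, hY]
  set W := ∫ y in (-1:ℝ)..1, ‖w y‖ ^ 2 with hW
  have W0 : 0 ≤ W := int_nn h11 (fun y _ => by positivity)
  have nW : m ^ 2 * √W ≤ √2 * T := by
    apply le_of_sq_le_sq₀' (by positivity)
    rw [mul_pow, mul_pow, sq_sqrt W0, sq_sqrt (by norm_num), ← pow_mul, hmn]
    calc _ ≤ Y * U := y2
      _ ≤ 2 * T * T := by gcongr
      _ = _ := by ring
  have s2 : √2 ≤ 3 / 2 := by rw [sqrt_le_left (by norm_num)]; norm_num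
  have nW' : m ^ 2 * √W ≤ 3 / 2 * T := nW.trans (by gcongr)
  have m1 : m ≤ 1 := by
    by_contra hc
    push Not at hc
    have := one_lt_pow₀ hc (n := 4) (by norm_num)
    linarith [B.hn1]
  refine ⟨?_, by linarith, ?_, hUb⟩
  · rw [hmn]
    have : √(∫ y in (-1:ℝ)..1, ‖w' y‖ ^ 2) ≤ Y / n := by
      rw [sqrt_le_left (by positivity), ← y1]
      exact int_le h11 kont kont (fun y _ => le_add_of_nonneg_right (by positivity))
    calc _ ≤ n * (Y / n) := by gcongr
      _ = Y := by field_simp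
      _ ≤ _ := YT
  · have p := B.pw le_rfl h11 le_rfl (fun y _ => B.dφ y) cφ'.continuousOn B.φ0 B.φ1
    have V : (∫ y in (-1:ℝ)..1, ‖φ'' y + (k ^ 2) • φ y‖ ^ 2) ≤ √W ^ 2 := by
      rw [sq_sqrt W0]
      have := int_le3 h11 (F := fun y => ‖φ'' y + (k ^ 2) • φ y‖ ^ 2) (G := fun y => ‖w y‖ ^ 2) (H := fun y => inner ℝ (w y) (φ y))
        (K := fun y => inner ℝ (φ' y) (φ' y) + k ^ 2 * inner ℝ (φ y) (φ y)) (α := 1) (β := 4 * k ^ 2) (γ := 4 * k ^ 2) kont kont kont kont (by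
          intro y hy
          have e : φ'' y + (k ^ 2) • φ y = w y + (2 * k ^ 2) • φ y := by
            rw [← B.lap y hy, mul_smul, two_smul]; abel
          rw [e, norm_add_sq_real, inner_smul_right, norm_rsmul_sq]
          simp only [real_inner_self_eq_norm_sq]
          have : 0 ≤ 4 * k ^ 2 * ‖φ' y‖ ^ 2 := by positivity
          linarith)
      rw [p] at this
      linarith
    have C : (∫ y in (-1:ℝ)..1, |2 * inner ℝ (φ' y) (φ'' y + (k ^ 2) • φ y)|) ≤ (2 * U) * √W := by
      refine (le_abs_self _).trans (cs_dom h11 (A := fun y => 2 * ‖φ' y‖) (B := fun y => ‖φ'' y + (k ^ 2) • φ y‖) kont kont kont (by positivity) (by positivity) ?_ ?_ V)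
      · intro y _
        rw [abs_abs, abs_mul, abs_two, mul_assoc]
        gcongr
        exact abs_real_inner_le_norm _ _
      · simp only [mul_pow]
        rw [icm, ← hφ]
        have := int_le h11 (F := fun y => ‖φ' y‖ ^ 2) (G := fun y => ‖φ' y‖ ^ 2 + k ^ 2 * ‖φ y‖ ^ 2) kont kont (fun y _ => by
          have : 0 ≤ k ^ 2 * ‖φ y‖ ^ 2 := by positivity
          linarith)
        linarith
    intro y hy
    have b := sup_le (H := fun y => ‖φ' y‖ ^ 2 + k ^ 2 * ‖φ y‖ ^ 2) (H' := fun y => 2 * inner ℝ (φ' y) (φ'' y + (k ^ 2) • φ y)) (by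
      intro y
      have := (hd_normsq (B.dφ' y)).add ((hd_normsq (B.dφ y)).const_mul (k ^ 2))
      refine this.congr_deriv ?_
      rw [inner_add_right, inner_smul_right, real_inner_comm (φ' y) (φ y)]; ring) kont hy C
    rw [hφ] at b
    apply le_of_sq_le_sq₀' (by positivity)
    rw [mul_pow, sq_sqrt (by positivity)]
    have m2 : m ^ 2 ≤ 1 := pow_le_one₀ hm.le m1
    calc m ^ 2 * (‖φ' y‖ ^ 2 + k ^ 2 * ‖φ y‖ ^ 2) ≤ m ^ 2 * (1 / 2 * U ^ 2 + 2 * U * √W) := by gcongr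
      _ = 1 / 2 * (m ^ 2 * U ^ 2) + 2 * U * (m ^ 2 * √W) := by ring
      _ ≤ 1 / 2 * (1 * T ^ 2) + 2 * T * (3 / 2 * T) := by gcongr
      _ ≤ _ := by nlinarith
where
  le_of_sq_le_sq₀' {a b : ℝ} (hb : 0 ≤ b) (h : a ^ 2 ≤ b ^ 2) : a ≤ b := by
    exact le_of_abs_le (abs_le_of_sq_le_sq h hb)

end Base

theorem hk_sq (k₁ k₃ : ℤ) {f f' : ℝ → ℂ} (h : ∀ y, HasDerivAt f (f' y) y) (cf' : Continuous f') :
    (∫ y in (-1:ℝ)..1, (‖f' y‖ ^ 2 + kabs k₁ k₃ ^ 2 * ‖f y‖ ^ 2)) = hk k₁ k₃ f ^ 2 := by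
  have h11 : (-1:ℝ) ≤ 1 := by norm_num
  have cf := c_of h
  have e : deriv f = f' := funext fun y => (h y).deriv
  unfold hk
  rw [e, ← icm, ← int_add h11 kont kont, sq_sqrt]
  exact int_nn h11 (fun y _ => by positivity)

theorem hd_of {f : ℝ → ℂ} (h : ContDiff ℝ 1 f) : ∀ y, HasDerivAt f (deriv f y) y :=
  fun y => (h.differentiable (by norm_num) y).hasDerivAt

theorem cd_of {f : ℝ → ℂ} (h : ContDiff ℝ 2 f) : ContDiff ℝ 1 (deriv f) := by
  have : ContDiff ℝ (1 + 1) f := by norm_num; exact h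
  exact (contDiff_succ_iff_deriv.1 this).2.2

theorem main_aux {ν ε lam : ℝ} {k₁ k₃ : ℤ} {w φ F : ℝ → ℂ} (hν : 0 < ν) (hν1 : ν ≤ 1 / 2) (hε : 0 < ε) (hε1 : ε ≤ 1 / 10 ^ 160)
    (hk1 : 1 ≤ |k₁|) (hF : ContDiff ℝ 1 F) (F0 : F (-1) = 0) (F1 : F 1 = 0) (H : OSslipE3 ν k₁ k₃ (lam : ℂ) ε w φ F) :
    (ν / |(k₁ : ℝ)|) ^ ((1:ℝ)/2) * l2 (deriv w)
          + (ν / |(k₁ : ℝ)|) ^ ((1:ℝ)/4) * l2 w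
          + (ν / |(k₁ : ℝ)|) ^ ((1:ℝ)/8) * uLinf k₁ k₃ φ
          + hk k₁ k₃ φ
          ≤ (8 * 10 ^ 160) * |(k₁ : ℝ)|⁻¹ * hk k₁ k₃ F := by
  obtain ⟨Hw, Hφ, eqn, lap, w0, w1, φ0, φ1, -, -⟩ := H
  have ha1 : (1:ℝ) ≤ |(k₁ : ℝ)| := by exact_mod_cast hk1
  have hkk : 1 ≤ kabs k₁ k₃ := by
    unfold kabs
    rw [one_le_sqrt]
    have := sq_abs (k₁ : ℝ)
    nlinarith [sq_nonneg (k₃ : ℝ)]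
  have Hw2 : ContDiff ℝ 2 w := Hw.of_le (by norm_num)
  have Hw1 := cd_of Hw2
  have Hφ1 := cd_of Hφ
  have dw := hd_of (Hw.of_le (by norm_num))
  have dw' := hd_of Hw1
  have dφ := hd_of (Hφ.of_le (by norm_num))
  have dφ' := hd_of Hφ1
  have dF := hd_of hF
  have cw'' : Continuous (deriv (deriv w)) := Hw1.continuous_deriv (by norm_num)
  have cφ'' : Continuous (deriv (deriv φ)) := Hφ1.continuous_deriv (by norm_num)
  have cF' : Continuous (deriv F) := hF.continuous_deriv (by norm_num)
  obtain ⟨σ, hσ, hσk⟩ : ∃ σ : ℝ, σ ^ 2 = 1 ∧ (k₁ : ℝ) = - σ * |(k₁ : ℝ)| := by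
    rcases le_total 0 (k₁ : ℝ) with h | h
    · exact ⟨-1, by norm_num, by rw [abs_of_nonneg h]; ring⟩
    · exact ⟨1, by norm_num, by rw [abs_of_nonpos h]; ring⟩
  set a := |(k₁ : ℝ)| with ha
  have a0 : 0 < a := by linarith
  set m := (ν / a) ^ ((1:ℝ)/8) with hm
  have μ0 : 0 < ν / a := by positivity
  have m0 : 0 < m := rpow_pos_of_pos μ0 _
  have e2 : (ν / a) ^ ((1:ℝ)/4) = m ^ 2 := by
    rw [hm, ← rpow_natCast, ← rpow_mul μ0.le]; norm_num
  have e4 : (ν / a) ^ ((1:ℝ)/2) = m ^ 4 := by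
    rw [hm, ← rpow_natCast, ← rpow_mul μ0.le]; norm_num
  have e8 : m ^ 8 = ν / a := by
    rw [hm, ← rpow_natCast, ← rpow_mul μ0.le]; norm_num
  have m1 : m ≤ 1 := by
    by_contra hc
    push Not at hc
    have := one_lt_pow₀ hc (n := 8) (by norm_num)
    rw [e8, lt_div_iff₀ a0] at this
    linarith
  have eν : ν = (m ^ 4) ^ 2 * a := by rw [← pow_mul, e8]; field_simp
  have es : √(ν * a) = m ^ 4 * a := by
    rw [eν, show (m ^ 4) ^ 2 * a * a = (m ^ 4 * a) ^ 2 by ring, sqrt_sq (by positivity)]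
  have B : Base σ (m ^ 4) (kabs k₁ k₃) (1 - lam) ε w (deriv w) (deriv (deriv w)) φ (deriv φ) (deriv (deriv φ)) (fun y => a⁻¹ • F y) (fun y => a⁻¹ • deriv F y) := by
    refine ⟨hσ, by positivity, pow_le_one₀ m0.le m1, hkk, hε.le, dw, dw', dφ, dφ', fun y => (dF y).const_smul a⁻¹, cw'', cφ'', kont,
      w0, w1, φ0, φ1, by simp [F0], by simp [F1], ?_, ?_⟩
    · intro y hy
      have e := eqn y hy
      rw [es] at e
      have k1c : (k₁ : ℂ) = - (σ : ℂ) * (a : ℂ) := by exact_mod_cast congrArg (fun x : ℝ => (x : ℂ)) hσk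
      have νc : (ν : ℂ) = ((m : ℂ) ^ 4) ^ 2 * (a : ℂ) := by exact_mod_cast congrArg (fun x : ℝ => (x : ℂ)) eν
      have σc : (σ : ℂ) ^ 2 = 1 := by exact_mod_cast congrArg (fun x : ℝ => (x : ℂ)) hσ
      have ac : (a : ℂ)⁻¹ * (a : ℂ) = 1 := inv_mul_cancel₀ (by exact_mod_cast a0.ne')
      have hI := Complex.I_sq
      rw [k1c, νc] at e
      unfold jj
      simp only [Complex.real_smul]
      push_cast at e ⊢
      rw [← e]
      generalize (kabs k₁ k₃ : ℂ) = K at *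
      generalize deriv (deriv w) y = D at *
      linear_combination (-(σ : ℂ) * Complex.I * (-((m : ℂ) ^ 4) ^ 2 * (D - K ^ 2 * w y) - Complex.I * σ * ((1 - (y : ℂ) ^ 2 - lam) * w y + 2 * φ y) - ε * (m : ℂ) ^ 4 * w y)) * ac
        + (σ : ℂ) ^ 2 * ((1 - (y : ℂ) ^ 2 - lam) * w y + 2 * φ y) * hI - ((1 - (y : ℂ) ^ 2 - lam) * w y + 2 * φ y) * σc
    · intro y hy
      rw [← lap y hy, Complex.real_smul]
      push_cast
      rfl
  have hη : 0 ≤ a⁻¹ * hk k₁ k₃ F := mul_nonneg (by positivity) (sqrt_nonneg _)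
  obtain ⟨r1, r2, r3, r4⟩ := B.final (m := m) (U := hk k₁ k₃ φ) (η := a⁻¹ * hk k₁ k₃ F) (sqrt_nonneg _) hη hε1
    (hk_sq k₁ k₃ dφ (c_of dφ')) (by rw [Base.int_scale, hk_sq k₁ k₃ dF cF', mul_pow]) m0 rfl
  have r5 : m * uLinf k₁ k₃ φ ≤ 3 * (10 ^ 160 * (a⁻¹ * hk k₁ k₃ F)) := by
    rw [← le_div_iff₀' m0]
    unfold uLinf
    have q : 0 ≤ 3 * (10 ^ 160 * (a⁻¹ * hk k₁ k₃ F)) / m := by positivity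
    refine Real.iSup_le (fun y => Real.iSup_le (fun hy => ?_) q) q
    rw [le_div_iff₀' m0]
    exact r3 y hy
  rw [e2, e4]
  unfold l2
  linarith only [r1, r2, r4, r5]

end

/-- **Resolvent estimate with Navier-slip boundary condition, `F ∈ H¹₀`**
(Proposition 2.12): `|ν/k₁|^{1/2}‖w'‖ + |ν/k₁|^{1/4}‖w‖ + |ν/k₁|^{1/8}‖u‖_{L∞}
 + ‖u‖_{L²} ≤ C|k₁|^{-1}‖(∂_y,|k|)F‖_{L²}`. -/
theorem OS_slip_resolvent_H10 :
    ∃ ε₀ ν₀ C : ℝ, 0 < ε₀ ∧ ε₀ < 1 ∧ 0 < ν₀ ∧ ν₀ < 1 ∧ 0 < C ∧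
      ∀ (ν ε lam : ℝ) (k₁ k₃ : ℤ) (w φ F : ℝ → ℂ),
        0 < ν → ν ≤ ν₀ → 0 < ε → ε ≤ ε₀ → 1 ≤ |k₁| →
        ContDiff ℝ 1 F → F (-1) = 0 → F 1 = 0 →
        OSslipE3 ν k₁ k₃ (lam : ℂ) ε w φ F →
        (ν / |(k₁ : ℝ)|) ^ ((1:ℝ)/2) * l2 (deriv w)
          + (ν / |(k₁ : ℝ)|) ^ ((1:ℝ)/4) * l2 w
          + (ν / |(k₁ : ℝ)|) ^ ((1:ℝ)/8) * uLinf k₁ k₃ φ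
          + hk k₁ k₃ φ
          ≤ C * |(k₁ : ℝ)|⁻¹ * hk k₁ k₃ F := by
  refine ⟨1 / 10 ^ 160, 1 / 2, 8 * 10 ^ 160, by norm_num, by norm_num, by norm_num, by norm_num, by norm_num, ?_⟩
  intro ν ε lam k₁ k₃ w φ F hν hν1 hε hε1 hk1 hF F0 F1 H
  exact main_aux hν hν1 hε hε1 hk1 hF F0 F1 H

end
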